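/- Fix T > 0 and λ > 0. Let R : [0,T] × [0,∞) → [0,∞) be continuous, C^{1,2} on [0,T) × (0,∞), strictly positive on [0,T) × (0,∞), strictly increasing in x with R(t,0) = 0 and ∂_x R finite on [0,T) × [0,∞), and solving the fast-diffusion equation ∂_t R + (λ²/2) R² ∂_x² R = 0 on [0,T) × (0,∞), with terminal data R(T,x) = R_U(x), where R_U is C^7 on [0,∞), R_U(0) = 0, R_U is strictly increasing with R_U′ finite on [0,∞), and there exists K > 0 such that |∂_x^{(i)}(R_U^i)(x)| ≤ K for all x ≥ 0 and 2 ≤ i ≤ 7. Then for each 0 ≤ j ≤ 6 there exists a constant K_j > 0 such that |R(t,x)^j ∂_x^{(j+1)} R(t,x)| ≤ K_j for all (t,x) ∈ [0,T) × (0,∞). -/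

import Mathlib

open Set

/-- Partial derivative in the time variable. -/
noncomputable def partialT (v : ℝ → ℝ → ℝ) : ℝ → ℝ → ℝ := fun t x => deriv (fun s => v s x) t

/-- Second partial derivative in the wealth variable. -/
noncomputable def partialXX (v : ℝ → ℝ → ℝ) : ℝ → ℝ → ℝ := fun t x =>
  deriv (deriv (v t)) x

noncomputable def gam : MeasureTheory.Measure ℝ := ProbabilityTheory.gaussianReal 0 1

instance gam_prob : MeasureTheory.IsProbabilityMeasure gam := by
  unfold gam; infer_instance

/-- Gaussian average. -/
noncomputable def Ga (f : ℝ → ℝ) (s y : ℝ) : ℝ := ∫ z, f (y + s * z) ∂gam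

/-- Gaussian average weighted by z. -/
noncomputable def Gaz (f : ℝ → ℝ) (s y : ℝ) : ℝ := ∫ z, f (y + s * z) * z ∂gam

/-- Continuous with at most exponential growth. -/
def EG (f : ℝ → ℝ) : Prop :=
  Continuous f ∧ ∃ A B : ℝ, 0 ≤ A ∧ 0 ≤ B ∧ ∀ y, |f y| ≤ A * Real.exp (B * |y|)

lemma abs_le_exp_abs (z : ℝ) : |z| ≤ Real.exp |z| := by
  have := Real.add_one_le_exp |z|
  linarith

lemma exp_mul_abs_le (B z : ℝ) : Real.exp (B * |z|) ≤ Real.exp (B * z) + Real.exp (-B * z) := by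
  rcases abs_cases z with ⟨h, _⟩ | ⟨h, _⟩ <;> rw [h]
  · linarith [Real.exp_pos (-B * z)]
  · have : B * -z = -B * z := by ring
    rw [this]
    linarith [Real.exp_pos (B * z)]

lemma integrable_exp_abs (B : ℝ) : MeasureTheory.Integrable (fun z => Real.exp (B * |z|)) gam := by
  have h1 : MeasureTheory.Integrable (fun z => Real.exp (B * z)) gam :=
    ProbabilityTheory.integrable_exp_mul_gaussianReal B
  have h2 : MeasureTheory.Integrable (fun z => Real.exp (-B * z)) gam :=
    ProbabilityTheory.integrable_exp_mul_gaussianReal (-B)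
  refine (h1.add h2).mono' (by fun_prop) (Filter.Eventually.of_forall fun z => ?_)
  rw [Real.norm_eq_abs, abs_of_pos (Real.exp_pos _)]
  exact exp_mul_abs_le B z

lemma integrable_mul_exp_abs (A B : ℝ) :
    MeasureTheory.Integrable (fun z => A * Real.exp (B * |z|)) gam :=
  (integrable_exp_abs B).const_mul A

/-- local uniform bound -/
lemma EG.bound {f : ℝ → ℝ} (hf : EG f) (S Y : ℝ) :
    ∃ A B : ℝ, 0 ≤ A ∧ 0 ≤ B ∧ ∀ s y z, |s| ≤ S → |y| ≤ Y → |f (y + s * z)| ≤ A * Real.exp (B * |z|) := by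
  obtain ⟨hc, A, B, hA, hB, h⟩ := hf
  refine ⟨A * Real.exp (B * Y), B * |S|, by positivity, by positivity, fun s y z hs hy => ?_⟩
  have h1 : |y + s * z| ≤ Y + |S| * |z| := by
    calc |y + s * z| ≤ |y| + |s * z| := abs_add_le _ _
      _ = |y| + |s| * |z| := by rw [abs_mul]
      _ ≤ _ := by
        have : |s| ≤ |S| := hs.trans (le_abs_self S)
        gcongr
  calc |f (y + s * z)| ≤ A * Real.exp (B * |y + s * z|) := h _
    _ ≤ A * Real.exp (B * (Y + |S| * |z|)) := by gcongr
    _ = _ := by rw [mul_assoc, ← Real.exp_add]; ring_nf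

lemma EG.mul_z_bound {f : ℝ → ℝ} (hf : EG f) (S Y : ℝ) :
    ∃ A B : ℝ, 0 ≤ A ∧ 0 ≤ B ∧ ∀ s y z, |s| ≤ S → |y| ≤ Y →
      |f (y + s * z) * z| ≤ A * Real.exp (B * |z|) := by
  obtain ⟨A, B, hA, hB, h⟩ := hf.bound S Y
  refine ⟨A, B + 1, hA, by positivity, fun s y z hs hy => ?_⟩
  rw [abs_mul]
  calc |f (y + s * z)| * |z| ≤ (A * Real.exp (B * |z|)) * Real.exp |z| := by
        gcongr
        · exact h s y z hs hy
        · exact abs_le_exp_abs z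
    _ = _ := by rw [mul_assoc, ← Real.exp_add]; ring_nf

lemma EG.integrable {f : ℝ → ℝ} (hf : EG f) (s y : ℝ) :
    MeasureTheory.Integrable (fun z => f (y + s * z)) gam := by
  obtain ⟨A, B, hA, hB, h⟩ := hf.bound |s| |y|
  have hc := hf.1
  exact (integrable_mul_exp_abs A B).mono' (by fun_prop)
    (Filter.Eventually.of_forall fun z => h s y z le_rfl le_rfl)

lemma EG.integrable_z {f : ℝ → ℝ} (hf : EG f) (s y : ℝ) :
    MeasureTheory.Integrable (fun z => f (y + s * z) * z) gam := by
  obtain ⟨A, B, hA, hB, h⟩ := hf.mul_z_bound |s| |y|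
  have hc := hf.1
  exact (integrable_mul_exp_abs A B).mono' (by fun_prop)
    (Filter.Eventually.of_forall fun z => h s y z le_rfl le_rfl)

lemma Ga_zero (f : ℝ → ℝ) (y : ℝ) : Ga f 0 y = f y := by
  simp [Ga]

lemma nhds_bound (p : ℝ × ℝ) : ∀ᶠ q : ℝ × ℝ in nhds p, |q.1| ≤ |p.1| + 1 ∧ |q.2| ≤ |p.2| + 1 := by
  have h1 : ∀ᶠ q : ℝ × ℝ in nhds p, |q.1| < |p.1| + 1 :=
    (by fun_prop : Continuous fun q : ℝ × ℝ => |q.1|).continuousAt.eventually_lt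
      continuousAt_const (by simp)
  have h2 : ∀ᶠ q : ℝ × ℝ in nhds p, |q.2| < |p.2| + 1 :=
    (by fun_prop : Continuous fun q : ℝ × ℝ => |q.2|).continuousAt.eventually_lt
      continuousAt_const (by simp)
  filter_upwards [h1, h2] with q a b using ⟨a.le, b.le⟩

lemma EG.continuous_Ga {f : ℝ → ℝ} (hf : EG f) : Continuous (fun p : ℝ × ℝ => Ga f p.1 p.2) := by
  rw [continuous_iff_continuousAt]
  intro p
  obtain ⟨A, B, hA, hB, h⟩ := hf.bound (|p.1| + 1) (|p.2| + 1)
  have hc := hf.1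
  refine MeasureTheory.continuousAt_of_dominated (bound := fun z => A * Real.exp (B * |z|)) ?_ ?_
    (integrable_mul_exp_abs A B) ?_
  · exact Filter.Eventually.of_forall fun q => by fun_prop
  · filter_upwards [nhds_bound p] with q hq
    exact Filter.Eventually.of_forall fun z => h _ _ z hq.1 hq.2
  · exact Filter.Eventually.of_forall fun z => by fun_prop

lemma EG.continuous_Gaz {f : ℝ → ℝ} (hf : EG f) : Continuous (fun p : ℝ × ℝ => Gaz f p.1 p.2) := by
  rw [continuous_iff_continuousAt]
  intro p
  obtain ⟨A, B, hA, hB, h⟩ := hf.mul_z_bound (|p.1| + 1) (|p.2| + 1)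
  have hc := hf.1
  refine MeasureTheory.continuousAt_of_dominated (bound := fun z => A * Real.exp (B * |z|)) ?_ ?_
    (integrable_mul_exp_abs A B) ?_
  · exact Filter.Eventually.of_forall fun q => by fun_prop
  · filter_upwards [nhds_bound p] with q hq
    exact Filter.Eventually.of_forall fun z => h _ _ z hq.1 hq.2
  · exact Filter.Eventually.of_forall fun z => by fun_prop

/-- linear functional on the plane -/
noncomputable def lin2 (a b : ℝ) : ℝ × ℝ →L[ℝ] ℝ :=
  a • ContinuousLinearMap.fst ℝ ℝ ℝ + b • ContinuousLinearMap.snd ℝ ℝ ℝ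

@[simp] lemma lin2_apply (a b : ℝ) (v : ℝ × ℝ) : lin2 a b v = a * v.1 + b * v.2 := by
  simp [lin2]

lemma lin2_norm_le (a b : ℝ) : ‖lin2 a b‖ ≤ |a| + |b| := by
  refine ContinuousLinearMap.opNorm_le_bound _ (by positivity) fun v => ?_
  rw [lin2_apply]
  have h1 : |v.1| ≤ ‖v‖ := norm_fst_le v
  have h2 : |v.2| ≤ ‖v‖ := norm_snd_le v
  calc ‖a * v.1 + b * v.2‖ ≤ |a * v.1| + |b * v.2| := abs_add_le _ _
    _ = |a| * |v.1| + |b| * |v.2| := by rw [abs_mul, abs_mul]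
    _ ≤ |a| * ‖v‖ + |b| * ‖v‖ := by gcongr
    _ = _ := by ring

lemma Ga_hasFDerivAt {F f : ℝ → ℝ} (hF : EG F) (hf : EG f) (hd : ∀ y, HasDerivAt F (f y) y)
    (p : ℝ × ℝ) :
    HasFDerivAt (fun p : ℝ × ℝ => Ga F p.1 p.2) (lin2 (Gaz f p.1 p.2) (Ga f p.1 p.2)) p := by
  obtain ⟨A, B, hA, hB, h⟩ := hf.bound (|p.1| + 1) (|p.2| + 1)
  obtain ⟨A', B', hA', hB', h'⟩ := hf.mul_z_bound (|p.1| + 1) (|p.2| + 1)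
  have hFc := hF.1
  have hfc := hf.1
  have hmeas : ∀ q : ℝ × ℝ, MeasureTheory.AEStronglyMeasurable
      (fun z => lin2 (f (q.2 + q.1 * z) * z) (f (q.2 + q.1 * z))) gam := by
    intro q
    unfold lin2
    have : Continuous (fun z => (f (q.2 + q.1 * z) * z) • ContinuousLinearMap.fst ℝ ℝ ℝ +
      (f (q.2 + q.1 * z)) • ContinuousLinearMap.snd ℝ ℝ ℝ) := by fun_prop
    exact this.aestronglyMeasurable
  have key := hasFDerivAt_integral_of_dominated_of_fderiv_le (μ := gam) (𝕜 := ℝ)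
    (F := fun (q : ℝ × ℝ) z => F (q.2 + q.1 * z))
    (F' := fun (q : ℝ × ℝ) z => lin2 (f (q.2 + q.1 * z) * z) (f (q.2 + q.1 * z)))
    (x₀ := p) (bound := fun z => A' * Real.exp (B' * |z|) + A * Real.exp (B * |z|))
    (nhds_bound p) (Filter.Eventually.of_forall fun q => by fun_prop) (hF.integrable _ _)
    (hmeas p)
    (Filter.Eventually.of_forall fun z q hq => (lin2_norm_le _ _).trans
      (add_le_add (h' _ _ z hq.1 hq.2) (h _ _ z hq.1 hq.2)))
    ((integrable_mul_exp_abs _ _).add (integrable_mul_exp_abs _ _)) 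
    (Filter.Eventually.of_forall fun z q hq => ?_)
  · refine HasFDerivAt.congr_fderiv key ?_
    simp only [lin2]
    rw [MeasureTheory.integral_add, integral_smul_const, integral_smul_const]
    · rfl
    · exact (hf.integrable_z _ _).smul_const _
    · exact (hf.integrable _ _).smul_const _
  · have h1 : HasFDerivAt (fun q : ℝ × ℝ => q.2 + q.1 * z) (lin2 z 1) q := by
      have := (hasFDerivAt_snd (𝕜 := ℝ) (p := q)).add ((hasFDerivAt_fst (𝕜 := ℝ) (p := q)).mul_const z)
      refine HasFDerivAt.congr_fderiv this ?_
      ext <;> simp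
    have h2 := (hd (q.2 + q.1 * z)).comp_hasFDerivAt q h1
    refine HasFDerivAt.congr_fderiv h2 ?_
    ext <;> simp

/-- The density of the standard Gaussian. -/
noncomputable def phi (z : ℝ) : ℝ := ProbabilityTheory.gaussianPDFReal 0 1 z

lemma phi_eq (z : ℝ) : phi z = (√(2 * Real.pi))⁻¹ * Real.exp (-z ^ 2 / 2) := by
  simp [phi, ProbabilityTheory.gaussianPDFReal_def]

lemma phi_hasDerivAt (z : ℝ) : HasDerivAt phi (-z * phi z) z := by
  have : phi = fun z => (√(2 * Real.pi))⁻¹ * Real.exp (-z ^ 2 / 2) := funext phi_eq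
  rw [this]
  have h : HasDerivAt (fun z : ℝ => -z ^ 2 / 2) (-z) z := by
    have := ((hasDerivAt_pow 2 z).neg).div_const 2
    refine this.congr_deriv ?_
    norm_num
    ring
  refine (h.exp.const_mul _).congr_deriv ?_
  ring

lemma integral_gam (f : ℝ → ℝ) : ∫ z, f z ∂gam = ∫ z, phi z * f z := by
  unfold gam
  rw [ProbabilityTheory.integral_gaussianReal_eq_integral_smul (by norm_num)]
  rfl

lemma integrable_gam_iff {f : ℝ → ℝ} (hf : MeasureTheory.Integrable f gam) :
    MeasureTheory.Integrable (fun z => phi z * f z) := by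
  unfold gam at hf
  rw [ProbabilityTheory.gaussianReal_of_var_ne_zero _ (by norm_num)] at hf
  rw [MeasureTheory.integrable_withDensity_iff_integrable_smul₀'] at hf
  · refine hf.congr (Filter.Eventually.of_forall fun z => ?_)
    simp [phi, ProbabilityTheory.toReal_gaussianPDF]
  · exact (ProbabilityTheory.measurable_gaussianPDF 0 1).aemeasurable
  · exact Filter.Eventually.of_forall fun z => ProbabilityTheory.gaussianPDF_lt_top

lemma stein {F f : ℝ → ℝ} (hF : EG F) (hf : EG f) (hd : ∀ y, HasDerivAt F (f y) y) (s y : ℝ) :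
    Gaz F s y = s * Ga f s y := by
  have hdz : ∀ z, HasDerivAt (fun z => F (y + s * z)) (f (y + s * z) * s) z := by
    intro z
    have h1 : HasDerivAt (fun z => y + s * z) s z := by
      simpa using ((hasDerivAt_id z).const_mul s).const_add y
    exact (hd (y + s * z)).comp z h1
  have key := MeasureTheory.integral_mul_deriv_eq_deriv_mul_of_integrable
    (u := fun z => F (y + s * z)) (u' := fun z => f (y + s * z) * s) (v := phi)
    (v' := fun z => -z * phi z) (fun z _ => hdz z) (fun z _ => phi_hasDerivAt z)
    ((integrable_gam_iff (hF.integrable_z s y)).neg.congr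
      (Filter.Eventually.of_forall fun z => by simp only [Pi.neg_apply, Pi.mul_apply]; ring))
    ((integrable_gam_iff ((hf.integrable s y).const_mul s)).congr
      (Filter.Eventually.of_forall fun z => by simp only [Pi.mul_apply]; ring))
    ((integrable_gam_iff (hF.integrable s y)).congr
      (Filter.Eventually.of_forall fun z => by simp only [Pi.mul_apply]; ring))
  unfold Gaz Ga
  rw [integral_gam, ← MeasureTheory.integral_const_mul, integral_gam]
  have e1 : (fun z => phi z * (F (y + s * z) * z)) = fun z => -(F (y + s * z) * (-z * phi z)) := by
    funext z; ring
  rw [e1, MeasureTheory.integral_neg, key, neg_neg]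
  congr 1
  funext z; ring

lemma EG.antideriv {F f : ℝ → ℝ} (hf : EG f) (hd : ∀ y, HasDerivAt F (f y) y) : EG F := by
  obtain ⟨hc, A, B, hA, hB, h⟩ := hf
  refine ⟨continuous_iff_continuousAt.2 fun y => (hd y).continuousAt, |F 0| + A, B + 1,
    by positivity, by positivity, fun y => ?_⟩
  have h1 : |F y - F 0| ≤ A * Real.exp (B * |y|) * |y - 0| := by
    refine Convex.norm_image_sub_le_of_norm_hasDerivWithin_le (s := uIcc 0 y)
      (fun x _ => (hd x).hasDerivWithinAt) (fun x hx => ?_) (convex_uIcc 0 y) left_mem_uIcc right_mem_uIcc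
    have hxy : |x| ≤ |y| := by
      have := abs_sub_left_of_mem_uIcc hx
      simpa using this
    exact (h x).trans (by gcongr)
  have h2 : |F y| ≤ |F 0| + |F y - F 0| := by
    have := abs_add_le (F 0) (F y - F 0)
    simpa using this
  have h3 : A * Real.exp (B * |y|) * |y - 0| ≤ A * Real.exp ((B + 1) * |y|) := by
    rw [sub_zero, add_mul, one_mul, Real.exp_add, ← mul_assoc]
    gcongr
    exact abs_le_exp_abs y
  have h4 : 1 ≤ Real.exp ((B + 1) * |y|) := Real.one_le_exp (by positivity)
  nlinarith [abs_nonneg (F 0)]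

lemma Ga_hasDerivAt_y {F f : ℝ → ℝ} (hF : EG F) (hf : EG f) (hd : ∀ y, HasDerivAt F (f y) y)
    (s y : ℝ) : HasDerivAt (fun y => Ga F s y) (Ga f s y) y := by
  have h := Ga_hasFDerivAt hF hf hd (s, y)
  have h2 : HasDerivAt (fun y : ℝ => (s, y)) ((0 : ℝ), (1 : ℝ)) y :=
    (hasDerivAt_const y s).prodMk (hasDerivAt_id y)
  refine HasDerivAt.congr_deriv (h.comp_hasDerivAt y h2) ?_
  simp

lemma Ga_hasDerivAt_s {F f : ℝ → ℝ} (hF : EG F) (hf : EG f) (hd : ∀ y, HasDerivAt F (f y) y)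
    (s y : ℝ) : HasDerivAt (fun s => Ga F s y) (Gaz f s y) s := by
  have h := Ga_hasFDerivAt hF hf hd (s, y)
  have h2 : HasDerivAt (fun s : ℝ => (s, y)) ((1 : ℝ), (0 : ℝ)) s :=
    (hasDerivAt_id s).prodMk (hasDerivAt_const s y)
  have h3 := h.comp_hasDerivAt s h2
  have h4 : HasDerivAt (fun s => Ga F s y) ((lin2 (Gaz f s y) (Ga f s y)) (1, 0)) s := h3
  simpa using h4

lemma Gaz_hasDerivAt_y {F f : ℝ → ℝ} (hF : EG F) (hf : EG f) (hd : ∀ y, HasDerivAt F (f y) y)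
    (s y : ℝ) : HasDerivAt (fun y => Gaz F s y) (Gaz f s y) y := by
  obtain ⟨A', B', hA', hB', h'⟩ := hf.mul_z_bound |s| (|y| + 1)
  have hFc := hF.1
  have hfc := hf.1
  have hs : {x : ℝ | |x| < |y| + 1} ∈ nhds y := 
    (by fun_prop : Continuous fun q : ℝ => |q|).continuousAt.eventually_lt
      continuousAt_const (by simp)
  have key := hasDerivAt_integral_of_dominated_loc_of_deriv_le (μ := gam) (𝕜 := ℝ)
    (F := fun y z => F (y + s * z) * z) (F' := fun y z => f (y + s * z) * z) (x₀ := y)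
    (bound := fun z => A' * Real.exp (B' * |z|)) hs
    (Filter.Eventually.of_forall fun q => by fun_prop) (hF.integrable_z _ _) (by fun_prop)
    (Filter.Eventually.of_forall fun z q hq => h' _ _ z le_rfl (le_of_lt hq))
    (integrable_mul_exp_abs _ _)
    (Filter.Eventually.of_forall fun z q hq => ?_)
  · exact key.2
  · refine HasDerivAt.mul_const ?_ z
    exact (hd (q + s * z)).comp_add_const q (s * z)

lemma Ga_kernel {g : ℝ → ℝ} (hg : EG g) {s : ℝ} (hs : s ≠ 0) (y : ℝ) :
    HasDerivAt (fun y => Ga g s y) (Gaz g s y / s) y := by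
  have hd : ∀ y, HasDerivAt (fun y => ∫ t in (0:ℝ)..y, g t) (g y) y := fun y =>
    intervalIntegral.integral_hasDerivAt_right (hg.1.intervalIntegrable _ _)
      (hg.1.stronglyMeasurableAtFilter _ _) hg.1.continuousAt
  have hG := hg.antideriv hd
  have e : (fun y => Ga g s y) = fun y => Gaz (fun y => ∫ t in (0:ℝ)..y, g t) s y / s := by
    funext y
    rw [stein hG hg hd]
    field_simp
  rw [e]
  exact (Gaz_hasDerivAt_y hG hg hd s y).div_const s

/-- Data of a hodograph flow. -/
structure FL (V0 H0 h0 k0 : ℝ → ℝ) (C : ℝ) (I : Set ℝ) : Prop where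
  hC : 0 ≤ C
  dV : ∀ y, HasDerivAt V0 (H0 y) y
  dH : ∀ y, HasDerivAt H0 (h0 y) y
  dh : ∀ y, HasDerivAt h0 (k0 y) y
  ck : Continuous k0
  pos : ∀ y, 0 < h0 y
  bd : ∀ y, |k0 y| ≤ C * h0 y
  openI : IsOpen I
  surj : ∀ s, ∀ x ∈ I, ∃ y, Ga H0 s y = x

/-- The inverse of the flow map. -/
noncomputable def Yf (H0 : ℝ → ℝ) (s x : ℝ) : ℝ := Function.invFun (Ga H0 s) x

/-- Risk tolerance of the flow. -/
noncomputable def rf (H0 h0 : ℝ → ℝ) (s x : ℝ) : ℝ := Ga h0 s (Yf H0 s x)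

/-- Space derivative of the risk tolerance of the flow. -/
noncomputable def rxf (H0 h0 k0 : ℝ → ℝ) (s x : ℝ) : ℝ :=
  Ga k0 s (Yf H0 s x) / Ga h0 s (Yf H0 s x)

/-- Legendre transform of the flow. -/
noncomputable def Wf (V0 H0 : ℝ → ℝ) (s x : ℝ) : ℝ := x * Yf H0 s x - Ga V0 s (Yf H0 s x)

lemma log_growth {h k : ℝ → ℝ} {C : ℝ} (dh : ∀ y, HasDerivAt h (k y) y) (pos : ∀ y, 0 < h y)
    (bd : ∀ y, |k y| ≤ C * h y) (y v : ℝ) :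
    h (y + v) ≤ h y * Real.exp (C * |v|) ∧ h y * Real.exp (-(C * |v|)) ≤ h (y + v) := by
  have h1 : |Real.log (h (y + v)) - Real.log (h y)| ≤ C * |y + v - y| := by
    refine Convex.norm_image_sub_le_of_norm_hasDerivWithin_le (s := univ) (f := fun y => Real.log (h y))
      (fun x _ => ((dh x).log (pos x).ne').hasDerivWithinAt) (fun x _ => ?_) convex_univ
      (mem_univ _) (mem_univ _)
    rw [norm_div, Real.norm_eq_abs, Real.norm_eq_abs, abs_of_pos (pos x), div_le_iff₀ (pos x)]
    exact bd x
  rw [add_sub_cancel_left, abs_le] at h1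
  constructor
  · rw [← Real.exp_log (pos (y + v)), ← Real.exp_log (pos y), ← Real.exp_add]
    apply Real.exp_le_exp.2
    linarith
  · rw [← Real.exp_log (pos (y + v)), ← Real.exp_log (pos y), ← Real.exp_add]
    apply Real.exp_le_exp.2
    linarith

lemma Ga_mono {f g : ℝ → ℝ} (hf : EG f) (hg : EG g) (h : ∀ y, f y ≤ g y) (s y : ℝ) :
    Ga f s y ≤ Ga g s y :=
  MeasureTheory.integral_mono (hf.integrable s y) (hg.integrable s y) fun z => h _

lemma Ga_pos {f : ℝ → ℝ} (hf : EG f) (h : ∀ y, 0 < f y) (s y : ℝ) : 0 < Ga f s y := by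
  unfold Ga
  rw [MeasureTheory.integral_pos_iff_support_of_nonneg (fun z => (h _).le) (hf.integrable s y)]
  have : Function.support (fun z => f (y + s * z)) = univ := by
    ext z; simpa using (h _).ne'
  rw [this]
  simp

lemma EG.const_mul {f : ℝ → ℝ} (hf : EG f) (c : ℝ) : EG (fun y => c * f y) := by
  obtain ⟨hc, A, B, hA, hB, h⟩ := hf
  refine ⟨by fun_prop, |c| * A, B, by positivity, hB, fun y => ?_⟩
  rw [abs_mul, mul_assoc]
  gcongr
  exact h y

lemma Ga_const_mul (f : ℝ → ℝ) (c s y : ℝ) : Ga (fun y => c * f y) s y = c * Ga f s y := by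
  unfold Ga
  rw [MeasureTheory.integral_const_mul]

namespace FL
variable {V0 H0 h0 k0 : ℝ → ℝ} {C : ℝ} {I : Set ℝ}

lemma egh (F : FL V0 H0 h0 k0 C I) : EG h0 := by
  refine ⟨continuous_iff_continuousAt.2 fun y => (F.dh y).continuousAt, h0 0, C, (F.pos 0).le, F.hC,
    fun y => ?_⟩
  rw [abs_of_pos (F.pos y)]
  simpa using (log_growth F.dh F.pos F.bd 0 y).1

lemma egk (F : FL V0 H0 h0 k0 C I) : EG k0 := by
  obtain ⟨hc, A, B, hA, hB, h⟩ := F.egh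
  refine ⟨F.ck, C * A, B, mul_nonneg F.hC hA, hB, fun y => (F.bd y).trans ?_⟩
  rw [mul_assoc]
  exact mul_le_mul_of_nonneg_left ((le_abs_self _).trans (h y)) F.hC

lemma egH (F : FL V0 H0 h0 k0 C I) : EG H0 := F.egh.antideriv F.dH
lemma egV (F : FL V0 H0 h0 k0 C I) : EG V0 := F.egH.antideriv F.dV

lemma Bpos (F : FL V0 H0 h0 k0 C I) (s y : ℝ) : 0 < Ga h0 s y := Ga_pos F.egh F.pos s y

lemma H_y (F : FL V0 H0 h0 k0 C I) (s y : ℝ) : HasDerivAt (fun y => Ga H0 s y) (Ga h0 s y) y :=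
  Ga_hasDerivAt_y F.egH F.egh F.dH s y

lemma H_mono (F : FL V0 H0 h0 k0 C I) (s : ℝ) : StrictMono (Ga H0 s) :=
  strictMono_of_hasDerivAt_pos (fun y => F.H_y s y) (fun y => F.Bpos s y)

lemma Y_eq (F : FL V0 H0 h0 k0 C I) (s : ℝ) {x : ℝ} (hx : x ∈ I) : Ga H0 s (Yf H0 s x) = x :=
  Function.invFun_eq (F.surj s x hx)

lemma Y_H (F : FL V0 H0 h0 k0 C I) (s y : ℝ) : Yf H0 s (Ga H0 s y) = y :=
  Function.leftInverse_invFun (F.H_mono s).injective y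

lemma Y_cont (F : FL V0 H0 h0 k0 C I) (s : ℝ) {x : ℝ} (hx : x ∈ I) :
    ContinuousAt (fun p : ℝ × ℝ => Yf H0 p.1 p.2) (s, x) := by
  rw [Metric.continuousAt_iff']
  intro ε hε
  set y := Yf H0 s x with hy
  have hc := F.egH.continuous_Ga
  have h1 : ∀ᶠ q : ℝ × ℝ in nhds (s, x), Ga H0 q.1 (y - ε) < q.2 := by
    have ha : Continuous (fun q : ℝ × ℝ => Ga H0 q.1 (y - ε)) :=
      hc.comp (by fun_prop : Continuous fun q : ℝ × ℝ => (q.1, y - ε))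
    refine ha.continuousAt.eventually_lt continuous_snd.continuousAt ?_
    show Ga H0 s (y - ε) < x
    rw [← F.Y_eq s hx]
    exact F.H_mono s (by rw [← hy]; linarith)
  have h2 : ∀ᶠ q : ℝ × ℝ in nhds (s, x), q.2 < Ga H0 q.1 (y + ε) := by
    have ha : Continuous (fun q : ℝ × ℝ => Ga H0 q.1 (y + ε)) :=
      hc.comp (by fun_prop : Continuous fun q : ℝ × ℝ => (q.1, y + ε))
    refine continuous_snd.continuousAt.eventually_lt ha.continuousAt ?_
    show x < Ga H0 s (y + ε)
    conv_lhs => rw [← F.Y_eq s hx]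
    exact F.H_mono s (by rw [← hy]; linarith)
  have h3 : ∀ᶠ q : ℝ × ℝ in nhds (s, x), q.2 ∈ I :=
    continuous_snd.continuousAt.eventually_mem (F.openI.mem_nhds hx)
  filter_upwards [h1, h2, h3] with q a b c
  rw [← F.Y_eq q.1 c] at a b
  have a' := (F.H_mono q.1).lt_iff_lt.1 a
  have b' := (F.H_mono q.1).lt_iff_lt.1 b
  rw [Real.dist_eq, abs_lt]
  constructor <;> linarith

/-- invertible shear -/
noncomputable def shear (a b : ℝ) (hb : b ≠ 0) : (ℝ × ℝ) ≃L[ℝ] (ℝ × ℝ) :=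
  ContinuousLinearEquiv.equivOfInverse
    ((ContinuousLinearMap.fst ℝ ℝ ℝ).prod (lin2 a b))
    ((ContinuousLinearMap.fst ℝ ℝ ℝ).prod (lin2 (-a / b) (1 / b)))
    (fun v => by ext <;> simp; field_simp; ring)
    (fun v => by ext <;> simp; field_simp; ring)

lemma Y_fd (F : FL V0 H0 h0 k0 C I) (s : ℝ) {x : ℝ} (hx : x ∈ I) :
    HasFDerivAt (fun p : ℝ × ℝ => Yf H0 p.1 p.2)
      (lin2 (-(s * rxf H0 h0 k0 s x)) (1 / rf H0 h0 s x)) (s, x) := by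
  set y := Yf H0 s x with hy
  have hB := F.Bpos s y
  have hH := Ga_hasFDerivAt F.egH F.egh F.dH (s, y)
  simp only [stein F.egh F.egk F.dh] at hH
  have hf : HasFDerivAt (fun p : ℝ × ℝ => (p.1, Ga H0 p.1 p.2))
      ((shear (s * Ga k0 s y) (Ga h0 s y) hB.ne' : (ℝ × ℝ) ≃L[ℝ] (ℝ × ℝ)) : ℝ × ℝ →L[ℝ] ℝ × ℝ)
      ((fun p : ℝ × ℝ => (p.1, Yf H0 p.1 p.2)) (s, x)) :=
    (hasFDerivAt_fst (𝕜 := ℝ) (p := (s, y))).prodMk hH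
  have hg : ContinuousAt (fun p : ℝ × ℝ => (p.1, Yf H0 p.1 p.2)) (s, x) :=
    continuousAt_fst.prodMk (F.Y_cont s hx)
  have h3 : ∀ᶠ q : ℝ × ℝ in nhds (s, x), q.2 ∈ I :=
    continuous_snd.continuousAt.eventually_mem (F.openI.mem_nhds hx)
  have key := HasFDerivAt.of_local_left_inverse hg hf (by
    filter_upwards [h3] with q hq
    exact Prod.ext rfl (F.Y_eq q.1 hq))
  have k2 := hasFDerivAt_snd.comp (s, x) key
  refine HasFDerivAt.congr_fderiv k2 ?_
  ext
  · show lin2 (-(s * Ga k0 s y) / Ga h0 s y) (1 / Ga h0 s y) (1, 0) = _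
    simp [rxf, ← hy]
    ring
  · show lin2 (-(s * Ga k0 s y) / Ga h0 s y) (1 / Ga h0 s y) (0, 1) = _
    simp [rf, ← hy]

lemma hd_x {f : ℝ × ℝ → ℝ} {a b s x : ℝ} (h : HasFDerivAt f (lin2 a b) (s, x)) :
    HasDerivAt (fun x => f (s, x)) b x := by
  have h2 : HasDerivAt (fun y : ℝ => (s, y)) ((0 : ℝ), (1 : ℝ)) x :=
    (hasDerivAt_const x s).prodMk (hasDerivAt_id x)
  have h4 : HasDerivAt (fun x => f (s, x)) (lin2 a b (0, 1)) x := h.comp_hasDerivAt x h2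
  simpa using h4

lemma hd_s {f : ℝ × ℝ → ℝ} {a b s x : ℝ} (h : HasFDerivAt f (lin2 a b) (s, x)) :
    HasDerivAt (fun s => f (s, x)) a s := by
  have h2 : HasDerivAt (fun y : ℝ => (y, x)) ((1 : ℝ), (0 : ℝ)) s :=
    (hasDerivAt_id s).prodMk (hasDerivAt_const s x)
  have h4 : HasDerivAt (fun s => f (s, x)) (lin2 a b (1, 0)) s := h.comp_hasDerivAt s h2
  simpa using h4

lemma Y_x (F : FL V0 H0 h0 k0 C I) (s : ℝ) {x : ℝ} (hx : x ∈ I) :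
    HasDerivAt (fun x => Yf H0 s x) (1 / rf H0 h0 s x) x := hd_x (F.Y_fd s hx)

lemma r_pos (F : FL V0 H0 h0 k0 C I) (s x : ℝ) : 0 < rf H0 h0 s x := F.Bpos s _

lemma W_fd (F : FL V0 H0 h0 k0 C I) (s : ℝ) {x : ℝ} (hx : x ∈ I) :
    HasFDerivAt (fun p : ℝ × ℝ => Wf V0 H0 p.1 p.2)
      (lin2 (-(s * rf H0 h0 s x)) (Yf H0 s x)) (s, x) := by
  have hY := F.Y_fd s hx
  have hV := Ga_hasFDerivAt F.egV F.egH F.dV (s, Yf H0 s x)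
  simp only [stein F.egH F.egh F.dH] at hV
  have hV2 := HasFDerivAt.comp (s, x) (g := fun p : ℝ × ℝ => Ga V0 p.1 p.2)
    (f := fun p : ℝ × ℝ => (p.1, Yf H0 p.1 p.2)) hV
    ((hasFDerivAt_fst (𝕜 := ℝ) (p := (s, x))).prodMk hY)
  have h := ((hasFDerivAt_snd (𝕜 := ℝ) (p := (s, x))).mul hY).sub hV2
  refine HasFDerivAt.congr_fderiv h ?_
  have e := F.Y_eq s hx
  ext
  · simp [e, rf]
  · simp [e]

lemma W_x (F : FL V0 H0 h0 k0 C I) (s : ℝ) {x : ℝ} (hx : x ∈ I) :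
    HasDerivAt (fun x => Wf V0 H0 s x) (Yf H0 s x) x := hd_x (F.W_fd s hx)

lemma W_s (F : FL V0 H0 h0 k0 C I) (s : ℝ) {x : ℝ} (hx : x ∈ I) :
    HasDerivAt (fun s => Wf V0 H0 s x) (-(s * rf H0 h0 s x)) s := hd_s (F.W_fd s hx)

lemma W_cont (F : FL V0 H0 h0 k0 C I) (s : ℝ) {x : ℝ} (hx : x ∈ I) :
    ContinuousAt (fun p : ℝ × ℝ => Wf V0 H0 p.1 p.2) (s, x) := (F.W_fd s hx).continuousAt

lemma r_fd (F : FL V0 H0 h0 k0 C I) (s : ℝ) {x : ℝ} (hx : x ∈ I) :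
    HasFDerivAt (fun p : ℝ × ℝ => rf H0 h0 p.1 p.2)
      (lin2 (Gaz k0 s (Yf H0 s x) - s * rxf H0 h0 k0 s x * Ga k0 s (Yf H0 s x))
        (rxf H0 h0 k0 s x)) (s, x) := by
  have hY := F.Y_fd s hx
  have hV := Ga_hasFDerivAt F.egh F.egk F.dh (s, Yf H0 s x)
  have hV2 := HasFDerivAt.comp (s, x) (g := fun p : ℝ × ℝ => Ga h0 p.1 p.2)
    (f := fun p : ℝ × ℝ => (p.1, Yf H0 p.1 p.2)) hV
    ((hasFDerivAt_fst (𝕜 := ℝ) (p := (s, x))).prodMk hY)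
  refine HasFDerivAt.congr_fderiv hV2 ?_
  ext
  · simp; ring
  · simp [rxf, rf]; ring

lemma r_cont (F : FL V0 H0 h0 k0 C I) (s : ℝ) {x : ℝ} (hx : x ∈ I) :
    ContinuousAt (fun p : ℝ × ℝ => rf H0 h0 p.1 p.2) (s, x) := (F.r_fd s hx).continuousAt

lemma r_x (F : FL V0 H0 h0 k0 C I) (s : ℝ) {x : ℝ} (hx : x ∈ I) :
    HasDerivAt (fun x => rf H0 h0 s x) (rxf H0 h0 k0 s x) x := hd_x (F.r_fd s hx)

/-- Second space derivative. -/
noncomputable def rxxf (H0 h0 k0 : ℝ → ℝ) (s x : ℝ) : ℝ :=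
  (Gaz k0 s (Yf H0 s x) / s / Ga h0 s (Yf H0 s x) - (rxf H0 h0 k0 s x) ^ 2) / rf H0 h0 s x

lemma r_xx (F : FL V0 H0 h0 k0 C I) {s : ℝ} (hs : s ≠ 0) {x : ℝ} (hx : x ∈ I) :
    HasDerivAt (fun x => rxf H0 h0 k0 s x) (rxxf H0 h0 k0 s x) x := by
  set y := Yf H0 s x with hy
  have hB := F.Bpos s y
  have h1 := (Ga_kernel F.egk hs y).div (Ga_hasDerivAt_y F.egh F.egk F.dh s y) hB.ne'
  have h2 := h1.comp x (F.Y_x s hx)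
  refine HasDerivAt.congr_deriv h2 ?_
  unfold rxxf rxf rf
  rw [← hy]
  field_simp

lemma r_s (F : FL V0 H0 h0 k0 C I) {s : ℝ} (hs : s ≠ 0) {x : ℝ} (hx : x ∈ I) :
    HasDerivAt (fun s => rf H0 h0 s x) (s * rf H0 h0 s x ^ 2 * rxxf H0 h0 k0 s x) s := by
  have hB := F.Bpos s (Yf H0 s x)
  refine HasDerivAt.congr_deriv (hd_s (F.r_fd s hx)) ?_
  unfold rxxf rxf rf
  field_simp

lemma rxx_bound (F : FL V0 H0 h0 k0 C I) (S : ℝ) :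
    ∃ M, 0 ≤ M ∧ ∀ s, 0 < s → s ≤ S → ∀ x, |s * rf H0 h0 s x * rxxf H0 h0 k0 s x| ≤ M := by
  set N1 := ∫ z, Real.exp ((C * |S| + 1) * |z|) ∂gam
  set N2 := ∫ z, Real.exp (-(C * |S|) * |z|) ∂gam
  have hC := F.hC
  have hN1 : 0 ≤ N1 := MeasureTheory.integral_nonneg fun z => (Real.exp_pos _).le
  have hN2 : 0 < N2 := by
    have : EG (fun z => Real.exp (-(C * |S|) * |z|)) := 
      ⟨by fun_prop, 1, 0, by norm_num, le_rfl, fun y => by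
        rw [abs_of_pos (Real.exp_pos _)]
        simp only [zero_mul, Real.exp_zero, mul_one]
        apply Real.exp_le_one_iff.2
        have : 0 ≤ C * |S| * |y| := by positivity
        linarith⟩
    have h := Ga_pos this (fun _ => Real.exp_pos _) 1 0
    simpa [Ga, N2] using h
  refine ⟨C * N1 / N2 + |S| * C ^ 2, by positivity, fun s hs hsS x => ?_⟩
  set y := Yf H0 s x with hy
  have hB := F.Bpos s y
  have hsS' : |s| ≤ |S| := abs_le_abs_of_nonneg hs.le hsS
  have b1 : |Gaz k0 s y| ≤ C * (h0 y * N1) := by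
    unfold Gaz
    rw [← Real.norm_eq_abs, ← MeasureTheory.integral_const_mul, ← MeasureTheory.integral_const_mul]
    refine MeasureTheory.norm_integral_le_of_norm_le (((integrable_exp_abs _).const_mul _).const_mul _)
      (Filter.Eventually.of_forall fun z => ?_)
    rw [norm_mul, Real.norm_eq_abs, Real.norm_eq_abs, add_mul, Real.exp_add, one_mul, ← mul_assoc,
      ← mul_assoc]
    have hh0 := F.pos y
    refine mul_le_mul ?_ (abs_le_exp_abs z) (abs_nonneg z) (by positivity)
    · rw [mul_assoc]
      refine (F.bd _).trans ?_
      gcongr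
      refine (log_growth F.dh F.pos F.bd y (s * z)).1.trans ?_
      rw [abs_mul, ← mul_assoc C |s|]
      gcongr
  have b2 : h0 y * N2 ≤ Ga h0 s y := by
    unfold Ga
    rw [← MeasureTheory.integral_const_mul]
    refine MeasureTheory.integral_mono ((integrable_exp_abs _).const_mul _) (F.egh.integrable s y) fun z => ?_
    refine le_trans ?_ (log_growth F.dh F.pos F.bd y (s * z)).2
    have := F.pos y
    show _ * Real.exp _ ≤ _
    gcongr
    rw [abs_mul, neg_mul, mul_assoc]
    gcongr
  have b3 : |Ga k0 s y| ≤ C * Ga h0 s y := by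
    rw [abs_le]
    constructor
    · have := Ga_mono (F.egh.const_mul (-C)) F.egk (fun y => by have := (abs_le.1 (F.bd y)).1; linarith) s y
      rw [Ga_const_mul] at this
      linarith
    · have := Ga_mono F.egk (F.egh.const_mul C) (fun y => by have := (abs_le.1 (F.bd y)).2; linarith) s y
      rw [Ga_const_mul] at this
      linarith
  have e : s * rf H0 h0 s x * rxxf H0 h0 k0 s x = Gaz k0 s y / Ga h0 s y - s * (Ga k0 s y / Ga h0 s y) ^ 2 := by
    unfold rxxf rxf rf
    rw [← hy]
    field_simp
  rw [e]
  refine (abs_sub _ _).trans (add_le_add ?_ ?_)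
  · rw [abs_div, abs_of_pos hB]
    have hy0 := F.pos y
    calc |Gaz k0 s y| / Ga h0 s y ≤ C * (h0 y * N1) / (h0 y * N2) := by gcongr
      _ = C * N1 / N2 := by field_simp
  · rw [abs_mul, abs_pow, abs_div, abs_of_pos hB]
    gcongr
    rw [div_le_iff₀ hB]
    exact b3

lemma rx_bound (F : FL V0 H0 h0 k0 C I) (s x : ℝ) : |rxf H0 h0 k0 s x| ≤ C := by
  set y := Yf H0 s x with hy
  have hB := F.Bpos s y
  unfold rxf
  rw [abs_div, abs_of_pos hB, div_le_iff₀ hB, abs_le]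
  constructor
  · have := Ga_mono (F.egh.const_mul (-C)) F.egk (fun y => by have := (abs_le.1 (F.bd y)).1; linarith) s y
    rw [Ga_const_mul] at this
    linarith
  · have := Ga_mono F.egk (F.egh.const_mul C) (fun y => by have := (abs_le.1 (F.bd y)).2; linarith) s y
    rw [Ga_const_mul] at this
    linarith

/-- Young's inequality -/
lemma young (F : FL V0 H0 h0 k0 C I) (s : ℝ) {x : ℝ} (hx : x ∈ I) (y : ℝ) :
    x * y - Wf V0 H0 s x ≤ Ga V0 s y := by
  have hcv : ConvexOn ℝ univ (fun y => Ga V0 s y) := by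
    refine MonotoneOn.convexOn_of_deriv convex_univ ?_ ?_ ?_
    · exact fun y _ => (Ga_hasDerivAt_y F.egV F.egH F.dV s y).continuousAt.continuousWithinAt
    · exact fun y _ => (Ga_hasDerivAt_y F.egV F.egH F.dV s y).differentiableAt.differentiableWithinAt
    · intro a _ b _ hab
      rw [(Ga_hasDerivAt_y F.egV F.egH F.dV s a).deriv, (Ga_hasDerivAt_y F.egV F.egH F.dV s b).deriv]
      exact (F.H_mono s).monotone hab
  have hm : IsLocalMin (fun y => Ga V0 s y - x * y) (Yf H0 s x) → True := fun _ => trivial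
  set y0 := Yf H0 s x with hy0
  have hd := Ga_hasDerivAt_y F.egV F.egH F.dV s y0
  rw [F.Y_eq s hx] at hd
  have key : Ga V0 s y0 + x * (y - y0) ≤ Ga V0 s y := by
    rcases lt_trichotomy y y0 with h | h | h
    · have := hcv.slope_le_of_hasDerivAt (mem_univ _) (mem_univ _) h hd
      rw [slope_def_field, div_le_iff₀ (by linarith)] at this
      nlinarith
    · rw [h]; simp
    · have := hcv.le_slope_of_hasDerivAt (mem_univ _) (mem_univ _) h hd
      rw [slope_def_field, le_div_iff₀ (by linarith)] at this
      nlinarith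
  unfold Wf
  rw [← hy0]
  linarith

end FL

lemma hodograph {ρ ρ' : ℝ → ℝ} {C : ℝ} (hC : 0 < C)
    (hd : ∀ x, 0 < x → HasDerivAt ρ (ρ' x) x) (hc' : ContinuousOn ρ' (Ioi 0))
    (hpos : ∀ x, 0 < x → 0 < ρ x) (hb' : ∀ x, 0 < x → |ρ' x| ≤ C) (hb : ∀ x, 0 < x → ρ x ≤ C * x) :
    ∃ V0 H0 h0 k0 : ℝ → ℝ, FL V0 H0 h0 k0 C (Ioi 0) ∧ (∀ y, 0 < H0 y) ∧ (∀ y, h0 y = ρ (H0 y)) ∧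
      (∀ y, k0 y = ρ' (H0 y) * h0 y) := by
  set g : ℝ → ℝ := fun η => Real.exp η / ρ (Real.exp η) with hg
  have hgc : Continuous g := by
    refine continuous_iff_continuousAt.2 fun η => ?_
    have h1 : ContinuousAt (fun η => ρ (Real.exp η)) η :=
      ContinuousAt.comp (g := ρ) (hd _ (Real.exp_pos η)).continuousAt Real.continuous_exp.continuousAt
    exact Real.continuous_exp.continuousAt.div h1 (hpos _ (Real.exp_pos η)).ne'
  have hg1 : ∀ η, 1 / C ≤ g η := fun η => by
    have h2 := hpos _ (Real.exp_pos η)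
    rw [hg, div_le_div_iff₀ hC h2]
    have := hb _ (Real.exp_pos η)
    linarith
  have hg0 : ∀ η, 0 < g η := fun η => lt_of_lt_of_le (by positivity) (hg1 η)
  set U : ℝ → ℝ := fun ξ => ∫ t in (0:ℝ)..ξ, g t with hU
  have dU : ∀ ξ, HasDerivAt U (g ξ) ξ := fun ξ =>
    intervalIntegral.integral_hasDerivAt_right (hgc.intervalIntegrable _ _)
      (hgc.stronglyMeasurableAtFilter _ _) hgc.continuousAt
  have Umono : StrictMono U := strictMono_of_hasDerivAt_pos dU hg0
  have Ucont : Continuous U := continuous_iff_continuousAt.2 fun y => (dU y).continuousAt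
  have hmono2 : Monotone (fun ξ => U ξ - ξ / C) := by
    refine monotone_of_hasDerivAt_nonneg (f' := fun ξ => g ξ - 1 / C)
      (fun ξ => (dU ξ).sub ((hasDerivAt_id ξ).div_const C)) (fun ξ => ?_)
    have := hg1 ξ
    simp only [Pi.zero_apply]
    linarith
  have hU0 : U 0 = 0 := by simp [hU]
  have Usurj : Function.Surjective U := by
    refine Ucont.surjective ?_ ?_
    · refine Filter.tendsto_atTop_mono' _ (f₁ := fun ξ => ξ / C) ?_ (Filter.tendsto_id.atTop_div_const hC)
      filter_upwards [Filter.eventually_ge_atTop 0] with ξ hξ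
      have := hmono2 hξ
      simp only [hU0, zero_div] at this
      linarith
    · refine Filter.tendsto_atBot_mono' _ (f₁ := fun ξ => ξ / C) ?_ (Filter.tendsto_id.atBot_div_const hC)
      filter_upwards [Filter.eventually_le_atBot 0] with ξ hξ
      have := hmono2 hξ
      simp only [hU0, zero_div] at this
      linarith
  set e := Umono.orderIsoOfSurjective U Usurj with he
  set L : ℝ → ℝ := fun y => e.symm y with hL
  have hUL : ∀ y, U (L y) = y := fun y => e.apply_symm_apply y
  have dL : ∀ y, HasDerivAt L (g (L y))⁻¹ y := fun y =>
    HasDerivAt.of_local_left_inverse (f := U) (OrderIso.continuous e.symm).continuousAt (dU (L y))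
      (hg0 _).ne' (Filter.Eventually.of_forall hUL)
  set H0 : ℝ → ℝ := fun y => Real.exp (L y) with hH0
  have H0pos : ∀ y, 0 < H0 y := fun y => Real.exp_pos _
  have dH : ∀ y, HasDerivAt H0 (ρ (H0 y)) y := fun y => by
    refine (dL y).exp.congr_deriv ?_
    have := hpos _ (H0pos y)
    simp only [hg, hH0] at this ⊢
    field_simp
  have dh : ∀ y, HasDerivAt (fun y => ρ (H0 y)) (ρ' (H0 y) * ρ (H0 y)) y := fun y =>
    (hd _ (H0pos y)).comp y (dH y)
  have H0c : Continuous H0 := continuous_iff_continuousAt.2 fun y => (dH y).continuousAt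
  have egH : EG H0 := by
    have := log_growth dH H0pos (C := C) (fun y => by
      rw [abs_of_pos (hpos _ (H0pos y))]; exact hb _ (H0pos y)) 0
    refine ⟨H0c, H0 0, C, (H0pos 0).le, hC.le, fun y => ?_⟩
    rw [abs_of_pos (H0pos y)]
    simpa using (this y).1
  refine ⟨fun y => ∫ t in (0:ℝ)..y, H0 t, H0, fun y => ρ (H0 y), fun y => ρ' (H0 y) * ρ (H0 y),
    ⟨hC.le, ?_, dH, dh, ?_, fun y => hpos _ (H0pos y), ?_, isOpen_Ioi, ?_⟩, H0pos, fun _ => rfl,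
    fun _ => rfl⟩
  · exact fun y => intervalIntegral.integral_hasDerivAt_right (H0c.intervalIntegrable _ _)
      (H0c.stronglyMeasurableAtFilter _ _) H0c.continuousAt
  · have h1 : Continuous (fun y => ρ' (H0 y)) := by
      rw [← continuousOn_univ]
      exact hc'.comp H0c.continuousOn fun y _ => H0pos y
    exact h1.mul (continuous_iff_continuousAt.2 fun y => (dh y).continuousAt)
  · intro y
    have h1 := hpos _ (H0pos y)
    rw [abs_mul, abs_of_pos h1]
    gcongr
    exact hb' _ (H0pos y)
  · intro s x hx
    have hx0 : 0 < x := hx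
    have lg := fun y v => log_growth dH H0pos (C := C) (fun y => by
      rw [abs_of_pos (hpos _ (H0pos y))]; exact hb _ (H0pos y)) y v
    have H0surj : ∀ x, 0 < x → ∃ y, H0 y = x := fun x hx => ⟨U (Real.log x), by
      have : L (U (Real.log x)) = Real.log x := e.symm_apply_apply _
      simp only [hH0, this, Real.exp_log hx]⟩
    set N1 := ∫ z, Real.exp ((C * |s|) * |z|) ∂gam with hN1
    set N2 := ∫ z, Real.exp (-(C * |s|) * |z|) ∂gam with hN2
    have p1 : 0 < N1 := by
      exact MeasureTheory.integral_exp_pos (integrable_exp_abs _)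
    have p2 : 0 < N2 := by
      exact MeasureTheory.integral_exp_pos (integrable_exp_abs _)
    have b1 : ∀ y, Ga H0 s y ≤ H0 y * N1 := fun y => by
      unfold Ga
      rw [← MeasureTheory.integral_const_mul]
      refine MeasureTheory.integral_mono (egH.integrable s y) ((integrable_exp_abs _).const_mul _) fun z => ?_
      refine (lg y (s * z)).1.trans (le_of_eq ?_)
      rw [abs_mul, mul_assoc C]
    have b2 : ∀ y, H0 y * N2 ≤ Ga H0 s y := fun y => by
      unfold Ga
      rw [← MeasureTheory.integral_const_mul]
      refine MeasureTheory.integral_mono ((integrable_exp_abs _).const_mul _) (egH.integrable s y) fun z => ?_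
      refine le_trans (le_of_eq ?_) (lg y (s * z)).2
      rw [abs_mul, neg_mul, mul_assoc C]
    obtain ⟨y1, hy1⟩ := H0surj (x / N1) (by positivity)
    obtain ⟨y2, hy2⟩ := H0surj (x / N2) (by positivity)
    have c1 := b1 y1
    have c2 := b2 y2
    rw [hy1, div_mul_cancel₀ _ p1.ne'] at c1
    rw [hy2, div_mul_cancel₀ _ p2.ne'] at c2
    have hGc : Continuous (fun y => Ga H0 s y) :=
      egH.continuous_Ga.comp (by fun_prop : Continuous fun y : ℝ => (s, y))
    exact mem_range_of_exists_le_of_exists_ge hGc ⟨y1, c1⟩ ⟨y2, c2⟩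

lemma maxprin {X : Type*} [TopologicalSpace X] {K : Set X} (hK : IsCompact K) {a b ε : ℝ}
    {D : ℝ → X → ℝ}
    (hc : ContinuousOn (fun p : ℝ × X => D p.1 p.2) (Icc a b ×ˢ K))
    (h0 : ∀ x ∈ K, D a x ≤ ε)
    (hmax : ∀ t ∈ Ioc a b, ∀ x ∈ K, ε < D t x → (∀ z ∈ K, D t z ≤ D t x) →
      ∃ Dt ≤ 0, HasDerivWithinAt (fun σ => D σ x) Dt (Iic t) t) :
    ∀ t ∈ Icc a b, ∀ x ∈ K, D t x ≤ ε := by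
  intro t1 ht1 x1 hx1
  by_contra hcon
  push Not at hcon
  have hab : a ≤ b := ht1.1.trans ht1.2
  set η := (D t1 x1 - ε) / (2 * (b - a + 1)) with hη
  have hη0 : 0 < η := div_pos (by linarith) (by linarith)
  have hη1 : η * (b - a) < D t1 x1 - ε := by
    have : η * (2 * (b - a + 1)) = D t1 x1 - ε := by
      rw [hη]; field_simp [show b - a + 1 ≠ 0 by linarith]
    nlinarith
  have hcG : ContinuousOn (fun p : ℝ × X => D p.1 p.2 - η * (p.1 - a)) (Icc a b ×ˢ K) :=
    hc.sub (by fun_prop)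
  obtain ⟨⟨t, x⟩, ⟨ht, hx⟩, hm⟩ := (isCompact_Icc.prod hK).exists_isMaxOn ⟨(t1, x1), ht1, hx1⟩ hcG
  have hm' : ∀ t' ∈ Icc a b, ∀ x' ∈ K, D t' x' - η * (t' - a) ≤ D t x - η * (t - a) :=
    fun t' h1 x' h2 => hm (show (t', x') ∈ Icc a b ×ˢ K from ⟨h1, h2⟩)
  simp only at ht hx
  have h1 := hm' t1 ht1 x1 hx1
  have h2 : η * (t1 - a) ≤ η * (b - a) := by gcongr; exact ht1.2
  have h3 : ε < D t x := by
    have : 0 ≤ η * (t - a) := mul_nonneg hη0.le (by linarith [ht.1])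
    linarith
  have hat : a < t := by
    rcases eq_or_lt_of_le ht.1 with h | h
    · rw [← h] at h3
      exact absurd (h0 x hx) (not_le.2 h3)
    · exact h
  obtain ⟨Dt, hDt, hder⟩ := hmax t ⟨hat, ht.2⟩ x hx h3 (fun z hz => by
    have := hm' t ht z hz
    linarith)
  rw [hasDerivWithinAt_iff_tendsto_slope] at hder
  have hne : (nhdsWithin t (Iic t \ {t})).NeBot := by
    rw [Iic_diff_right]; infer_instance
  have : η ≤ Dt := by
    refine ge_of_tendsto hder ?_
    rw [Iic_diff_right]
    have hev : Ioo a t ∈ nhdsWithin t (Iio t) := Ioo_mem_nhdsLT hat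
    filter_upwards [hev] with σ hσ
    have h5 := hm' σ ⟨hσ.1.le, (hσ.2.le).trans ht.2⟩ x hx
    rw [slope_def_field, le_div_iff_of_neg (by linarith [hσ.2])]
    nlinarith
  linarith

lemma sdt {f g : ℝ → ℝ} {x d : ℝ} (hm : IsLocalMax f x)
    (hf : ∀ᶠ y in nhds x, HasDerivAt f (g y) y) (hg : HasDerivAt g d x) : d ≤ 0 := by
  by_contra hd
  push Not at hd
  have e1 : deriv f =ᶠ[nhds x] g := hf.mono fun y hy => hy.deriv
  have e2 : deriv (deriv f) x = d := by rw [e1.deriv_eq]; exact hg.deriv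
  have hmin : IsLocalMin f x := isLocalMin_of_deriv_deriv_pos (by rw [e2]; exact hd) hm.deriv_eq_zero
    hf.self_of_nhds.continuousAt
  have e3 : f =ᶠ[nhds x] fun _ => f x := by
    filter_upwards [hm, hmin] with y h1 h2
    exact le_antisymm h1 h2
  have e4 : deriv f =ᶠ[nhds x] fun _ => 0 := by
    have := e3.deriv
    simpa using this
  have e5 : deriv (deriv f) x = 0 := by rw [e4.deriv_eq]; simp
  linarith

/-- Pointwise positive solution of the rescaled fast diffusion equation. -/
structure Sol (Θ : ℝ) (P Px : ℝ → ℝ → ℝ) : Prop where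
  hΘ : 0 < Θ
  cont : Continuous (fun p : ℝ × ℝ => P p.1 p.2)
  pos : ∀ θ x, 0 < x → 0 < P θ x
  zero : ∀ θ, P θ 0 = 0
  dx : ∀ θ ∈ Icc 0 Θ, ∀ x, 0 < x → HasDerivAt (P θ) (Px θ x) x
  cx : ∀ θ ∈ Icc 0 Θ, ContinuousOn (Px θ) (Ioi 0)
  pde : ∀ θ ∈ Ioc 0 Θ, ∀ x, 0 < x → ∃ d, HasDerivAt (Px θ) d x ∧
    HasDerivWithinAt (fun σ => P σ x) (P θ x ^ 2 * d / 2) (Iic θ) θ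

/-- change of time -/
lemma comp_sq {f : ℝ → ℝ} {θ0 s d : ℝ} (hs : 0 < s)
    (h : HasDerivWithinAt f d (Iic (θ0 + s ^ 2)) (θ0 + s ^ 2)) :
    HasDerivWithinAt (fun σ => f (θ0 + σ ^ 2)) (d * (2 * s)) (Iic s) s := by
  have h1 : HasDerivAt (fun σ : ℝ => θ0 + σ ^ 2) (2 * s) s := by
    simpa using (hasDerivAt_pow 2 s).const_add θ0
  have h2 : HasDerivWithinAt (fun σ => f (θ0 + σ ^ 2)) (d * (2 * s)) (Icc 0 s) s := by
    refine HasDerivWithinAt.comp s (h₂ := f) h h1.hasDerivWithinAt ?_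
    intro σ hσ
    have : σ ^ 2 ≤ s ^ 2 := pow_le_pow_left₀ hσ.1 hσ.2 2
    simp only [mem_Iic]
    linarith
  exact h2.mono_of_mem_nhdsWithin (Icc_mem_nhdsLE hs)

lemma cmpSol {Θ : ℝ} {P Px : ℝ → ℝ → ℝ} (S : Sol Θ P Px) {V0 H0 h0 k0 : ℝ → ℝ} {C : ℝ}
    (F : FL V0 H0 h0 k0 C (Ioi 0)) {θ0 a b h ε : ℝ} (hθ0 : 0 ≤ θ0) (hh : 0 < h) (hθ1 : θ0 + h ^ 2 ≤ Θ)
    (ha : 0 < a) 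
    (hinit : ∀ x ∈ Icc a b, ε * (P θ0 x - rf H0 h0 0 x) ≤ 0)
    (hba : ∀ s ∈ Icc 0 h, ε * (P (θ0 + s ^ 2) a - rf H0 h0 s a) ≤ 0)
    (hbb : ∀ s ∈ Icc 0 h, ε * (P (θ0 + s ^ 2) b - rf H0 h0 s b) ≤ 0) :
    ∀ s ∈ Icc 0 h, ∀ x ∈ Icc a b, ε * (P (θ0 + s ^ 2) x - rf H0 h0 s x) ≤ 0 := by
  obtain ⟨M0, hM0, hM⟩ := F.rxx_bound h
  have hcP : ContinuousOn (fun p : ℝ × ℝ => P (θ0 + p.1 ^ 2) p.2) (Icc 0 h ×ˢ Icc a b) :=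
    (S.cont.comp (by fun_prop : Continuous fun p : ℝ × ℝ => (θ0 + p.1 ^ 2, p.2))).continuousOn
  have hcr : ContinuousOn (fun p : ℝ × ℝ => rf H0 h0 p.1 p.2) (Icc 0 h ×ˢ Icc a b) :=
    fun p hp => (F.r_cont p.1 (show p.2 ∈ Ioi 0 from ha.trans_le hp.2.1)).continuousWithinAt
  obtain ⟨M1, hM1⟩ := (isCompact_Icc.prod isCompact_Icc).exists_bound_of_continuousOn
    (hcP.div hcr (fun p _ => (F.r_pos p.1 p.2).ne'))
  set M := M0 * (M1 + 1) with hMdef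
  have key := maxprin (X := ℝ) (K := Icc a b) isCompact_Icc (a := 0) (b := h) (ε := 0)
    (D := fun s x => ε * (P (θ0 + s ^ 2) x - rf H0 h0 s x) * Real.exp (-M * s))
    (by
      refine (continuousOn_const.mul (hcP.sub hcr)).mul ?_
      fun_prop)
    (by
      intro x hx
      have := hinit x hx
      simpa using this)
    (by
      intro s hs x hx hpos hmax
      have hx0 : 0 < x := ha.trans_le hx.1
      have hexp := Real.exp_pos (-M * s)
      have hpos' : 0 < ε * (P (θ0 + s ^ 2) x - rf H0 h0 s x) := pos_of_mul_pos_left hpos hexp.le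
      have hxa : x ≠ a := by
        rintro rfl
        exact absurd (hba s ⟨hs.1.le, hs.2⟩) (not_le.2 hpos')
      have hxb : x ≠ b := by
        rintro rfl
        exact absurd (hbb s ⟨hs.1.le, hs.2⟩) (not_le.2 hpos')
      have hxin : x ∈ Ioo a b := ⟨lt_of_le_of_ne hx.1 (Ne.symm hxa), lt_of_le_of_ne hx.2 hxb⟩
      have hs2 : s ^ 2 ≤ h ^ 2 := pow_le_pow_left₀ hs.1.le hs.2 2
      have hs2' : 0 < s ^ 2 := pow_pos hs.1 2
      have hθ : θ0 + s ^ 2 ∈ Ioc 0 Θ := ⟨by linarith, by linarith⟩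
      obtain ⟨d, hd1, hd2⟩ := S.pde _ hθ x hx0
      have hloc : IsLocalMax (fun z => ε * (P (θ0 + s ^ 2) z - rf H0 h0 s z)) x := by
        filter_upwards [Icc_mem_nhds hxin.1 hxin.2] with z hz
        exact le_of_mul_le_mul_right (hmax z hz) hexp
      have hI : ∀ᶠ z in nhds x, z ∈ Ioi (0:ℝ) := Ioi_mem_nhds hx0
      have h2 := sdt hloc (g := fun z => ε * (Px (θ0 + s ^ 2) z - rxf H0 h0 k0 s z)) (by
        filter_upwards [hI] with z hz
        exact ((S.dx _ ⟨hθ.1.le, hθ.2⟩ z hz).sub (F.r_x s hz)).const_mul ε)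
        ((hd1.sub (F.r_xx hs.1.ne' hx0)).const_mul ε)
      have hu := comp_sq hs.1 hd2
      have hr := (F.r_s hs.1.ne' (show x ∈ Ioi 0 from hx0)).hasDerivWithinAt (s := Iic s)
      have he : HasDerivWithinAt (fun s => Real.exp (-M * s)) (Real.exp (-M * s) * (-M * 1)) (Iic s) s :=
        (((hasDerivAt_id s).const_mul (-M)).exp).hasDerivWithinAt
      refine ⟨_, ?_, ((hu.sub hr).const_mul ε).mul he⟩
      set u := P (θ0 + s ^ 2) x with hu_def
      set r := rf H0 h0 s x with hr_def
      set rxx := FL.rxxf H0 h0 k0 s x with hrxx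
      have hupos : 0 < u := S.pos _ _ hx0
      have hrpos : 0 < r := F.r_pos s x
      have hb := hM s hs.1 hs.2 x
      rw [← hr_def, ← hrxx] at hb
      have hq : u / r ≤ M1 := by
        have := hM1 (s, x) ⟨⟨hs.1.le, hs.2⟩, hx⟩
        exact (le_abs_self _).trans this
      have hq1 : (u + r) * (s * rxx) ≤ M := by
        have e : (u + r) * (s * rxx) = (u / r + 1) * (s * r * rxx) := by field_simp
        rw [e, hMdef, mul_comm M0]
        have : 0 < u / r := by positivity
        calc (u / r + 1) * (s * r * rxx) ≤ (u / r + 1) * M0 := by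
              gcongr
              exact (le_abs_self _).trans hb
          _ ≤ (M1 + 1) * M0 := by gcongr
      have e : ε * (u ^ 2 * d / 2 * (2 * s) - s * r ^ 2 * rxx) * Real.exp (-M * s) +
          ε * (u - r) * (Real.exp (-M * s) * (-M * 1)) =
          Real.exp (-M * s) * (s * u ^ 2 * (ε * (d - rxx)) + (ε * (u - r)) * ((u + r) * (s * rxx) - M)) := by
        ring
      refine e.le.trans ?_
      refine mul_nonpos_of_nonneg_of_nonpos hexp.le ?_
      have t1 : s * u ^ 2 * (ε * (d - rxx)) ≤ 0 :=
        mul_nonpos_of_nonneg_of_nonpos (mul_nonneg hs.1.le (by positivity)) h2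
      have t2 : (ε * (u - r)) * ((u + r) * (s * rxx) - M) ≤ 0 :=
        mul_nonpos_of_nonneg_of_nonpos hpos'.le (by linarith)
      linarith)
  intro s hs x hx
  have := key s hs x hx
  exact nonpos_of_mul_nonpos_left this (Real.exp_pos _)

lemma FL.r_zero {V0 H0 h0 k0 ρ : ℝ → ℝ} {C : ℝ} {I : Set ℝ} (F : FL V0 H0 h0 k0 C I)
    (hρ : ∀ y, h0 y = ρ (H0 y)) {x : ℝ} (hx : x ∈ I) : rf H0 h0 0 x = ρ x := by
  unfold rf
  rw [Ga_zero, hρ, ← Ga_zero H0, F.Y_eq 0 hx]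

lemma barrier {f f' : ℝ → ℝ} (hd : ∀ x, 0 < x → HasDerivAt f (f' x) x)
    (hc : ContinuousOn f' (Ioi 0)) (hpos : ∀ x, 0 < x → 0 < f x) {p w N : ℝ} (hp : 0 < p) (hpw : p < w)
    (hN : 0 < N) : ∃ V0 H0 h0 k0 : ℝ → ℝ, ∃ C : ℝ, FL V0 H0 h0 k0 C (Ioi 0) ∧
      (∀ x ∈ Icc p w, rf H0 h0 0 x = f x) ∧
      (∀ x ∈ Icc (p / 2) (w + p / 2), ∃ z ∈ Icc (0:ℝ) 1, rf H0 h0 0 x = z * f x + (1 - z) * (N * x)) ∧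
      rf H0 h0 0 (p / 2) = N * (p / 2) ∧ rf H0 h0 0 (w + p / 2) = N * (w + p / 2) := by
  let ζ : ContDiffBump ((p + w) / 2 : ℝ) := ⟨(w - p) / 2, (w - p) / 2 + p / 2, by linarith, by linarith⟩
  have hζ1 : ∀ x ∈ Icc p w, ζ x = 1 := fun x hx => ζ.one_of_mem_closedBall (by
    rw [Metric.mem_closedBall, Real.dist_eq, abs_le]
    show -((w - p) / 2) ≤ _ ∧ _ ≤ (w - p) / 2
    constructor <;> linarith [hx.1, hx.2])
  have hζ0 : ∀ x, x ≤ p / 2 ∨ w + p / 2 ≤ x → ζ x = 0 := fun x hx => ζ.zero_of_le_dist (by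
    rw [Real.dist_eq]
    show (w - p) / 2 + p / 2 ≤ _
    rcases hx with hx | hx
    · have := neg_abs_le (x - (p + w) / 2); linarith
    · have := le_abs_self (x - (p + w) / 2); linarith)
  have hζd : ∀ x, HasDerivAt ζ (deriv ζ x) x := fun x =>
    ((ζ.contDiff (n := 1)).differentiable (by norm_num) x).hasDerivAt
  have hζc : Continuous (deriv ζ) := (ζ.contDiff (n := 1)).continuous_deriv (by norm_num)
  have hζd0 : ∀ x, x ≤ p / 2 ∨ w + p / 2 ≤ x → deriv ζ x = 0 := fun x hx => by
    have : IsLocalMin ζ x := Filter.Eventually.of_forall fun y => by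
      rw [hζ0 x hx]; exact ζ.nonneg
    exact this.deriv_eq_zero
  set ρ : ℝ → ℝ := fun x => ζ x * f x + (1 - ζ x) * (N * x) with hρ
  set ρ' : ℝ → ℝ := fun x => (deriv ζ x * f x + ζ x * f' x) + (-deriv ζ x * (N * x) + (1 - ζ x) * N) with hρ'
  have dρ : ∀ x, 0 < x → HasDerivAt ρ (ρ' x) x := fun x hx => by
    have h1 := (hζd x).mul (hd x hx)
    have h2 := ((hζd x).const_sub 1).mul ((hasDerivAt_id x).const_mul N)
    refine (h1.add h2).congr_deriv ?_
    simp only [hρ', id]; ring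
  have cf : ContinuousOn f (Ioi 0) := fun x hx => (hd x hx).continuousAt.continuousWithinAt
  have cζ : Continuous ζ := ζ.continuous
  have cρ' : ContinuousOn ρ' (Ioi 0) := by
    refine ContinuousOn.add (ContinuousOn.add ?_ ?_) ?_
    · exact hζc.continuousOn.mul cf
    · exact cζ.continuousOn.mul hc
    · fun_prop
  have hsub : Icc (p / 2) (w + p / 2) ⊆ Ioi 0 := fun x hx => lt_of_lt_of_le (by linarith) hx.1
  obtain ⟨C1, hC1⟩ := isCompact_Icc.exists_bound_of_continuousOn (cρ'.mono hsub)
  have cq : ContinuousOn (fun x => ρ x / x) (Icc (p / 2) (w + p / 2)) := by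
    refine ContinuousOn.div ?_ continuousOn_id fun x hx => (hsub hx).ne'
    exact fun x hx => (dρ x (hsub hx)).continuousAt.continuousWithinAt
  obtain ⟨C2, hC2⟩ := isCompact_Icc.exists_bound_of_continuousOn cq
  set C := max N (max C1 C2) with hC
  have hC0 : 0 < C := lt_max_of_lt_left hN
  have hρpos : ∀ x, 0 < x → 0 < ρ x := fun x hx => by
    have h1 := hpos x hx
    have h2 : 0 ≤ ζ x := ζ.nonneg
    have h3 : ζ x ≤ 1 := ζ.le_one
    have h4 : 0 < N * x := by positivity
    simp only [hρ]
    rcases h2.eq_or_lt with h | h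
    · rw [← h]; linarith
    · have : 0 ≤ (1 - ζ x) * (N * x) := mul_nonneg (by linarith) h4.le
      have : 0 < ζ x * f x := by positivity
      linarith
  obtain ⟨V0, H0, h0, k0, F, -, hh, -⟩ := hodograph hC0 dρ cρ' hρpos
    (fun x hx => by
      by_cases h : x ∈ Icc (p / 2) (w + p / 2)
      · exact (hC1 x h).trans ((le_max_left _ _).trans (le_max_right _ _))
      · have h' : x ≤ p / 2 ∨ w + p / 2 ≤ x := by
          by_contra hcon
          push Not at hcon
          exact h ⟨hcon.1.le, hcon.2.le⟩
        simp only [hρ', hζ0 x h', hζd0 x h']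
        simp only [zero_mul, neg_zero, sub_zero, one_mul, zero_add, add_zero]
        rw [abs_of_pos hN]
        exact le_max_left _ _)
    (fun x hx => by
      by_cases h : x ∈ Icc (p / 2) (w + p / 2)
      · rw [← div_le_iff₀ hx]
        exact (le_abs_self _).trans ((hC2 x h).trans ((le_max_right _ _).trans (le_max_right _ _)))
      · have h' : x ≤ p / 2 ∨ w + p / 2 ≤ x := by
          by_contra hcon
          push Not at hcon
          exact h ⟨hcon.1.le, hcon.2.le⟩
        simp only [hρ, hζ0 x h']
        simp only [zero_mul, sub_zero, one_mul, zero_add]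
        gcongr
        exact le_max_left _ _)
  refine ⟨V0, H0, h0, k0, C, F, fun x hx => ?_, fun x hx => ?_, ?_, ?_⟩
  · rw [F.r_zero hh (show x ∈ Ioi 0 from hp.trans_le hx.1)]
    simp [hρ, hζ1 x hx]
  · rw [F.r_zero hh (hsub hx)]
    exact ⟨ζ x, ⟨ζ.nonneg, ζ.le_one⟩, rfl⟩
  · rw [F.r_zero hh (show p / 2 ∈ Ioi 0 from by simp [hp])]
    simp [hρ, hζ0 (p / 2) (Or.inl le_rfl)]
  · rw [F.r_zero hh (show w + p / 2 ∈ Ioi 0 from by simp only [mem_Ioi]; linarith)]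
    simp [hρ, hζ0 (w + p / 2) (Or.inr le_rfl)]

/-- three-point second difference -/
def tri (p q w : ℝ) (h : ℝ → ℝ) : ℝ := (w - q) * h p - (w - p) * h q + (q - p) * h w

lemma tri_nonneg {p q w : ℝ} (hpq : p < q) (hqw : q < w) {f g : ℝ → ℝ} 
    (hf : ∀ x ∈ Icc p w, HasDerivAt f (g x) x) (hg : MonotoneOn g (Icc p w)) : 0 ≤ tri p q w f := by
  have hcv : ConvexOn ℝ (Icc p w) f := by
    refine MonotoneOn.convexOn_of_deriv (convex_Icc p w) ?_ ?_ ?_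
    · exact fun x hx => (hf x hx).continuousAt.continuousWithinAt
    · intro x hx
      exact (hf x (interior_subset hx)).differentiableAt.differentiableWithinAt
    · intro x hx y hy hxy
      rw [(hf x (interior_subset hx)).deriv, (hf y (interior_subset hy)).deriv]
      exact hg (interior_subset hx) (interior_subset hy) hxy
  have := hcv.secant_mono_aux1 (x := p) (y := q) (z := w) ⟨le_rfl, by linarith⟩ ⟨by linarith, le_rfl⟩ hpq hqw
  unfold tri
  linarith

lemma tri_mono {p q w : ℝ} (hpq : p < q) (hqw : q < w) {f1 f2 g1 g2 d1 d2 : ℝ → ℝ}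
    (hf1 : ∀ x ∈ Icc p w, HasDerivAt f1 (g1 x) x) (hg1 : ∀ x ∈ Icc p w, HasDerivAt g1 (d1 x) x)
    (hf2 : ∀ x ∈ Icc p w, HasDerivAt f2 (g2 x) x) (hg2 : ∀ x ∈ Icc p w, HasDerivAt g2 (d2 x) x)
    (h : ∀ x ∈ Icc p w, d1 x ≤ d2 x) : tri p q w f1 ≤ tri p q w f2 := by
  have : MonotoneOn (fun x => g2 x - g1 x) (Icc p w) := by
    refine monotoneOn_of_deriv_nonneg (convex_Icc p w) ?_ ?_ ?_
    · exact fun x hx => ((hg2 x hx).sub (hg1 x hx)).continuousAt.continuousWithinAt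
    · intro x hx
      have hx := interior_subset hx
      exact ((hg2 x hx).sub (hg1 x hx)).differentiableAt.differentiableWithinAt
    · intro x hx
      have hx := interior_subset hx
      have e : deriv (fun x => g2 x - g1 x) x = d2 x - d1 x := ((hg2 x hx).sub (hg1 x hx)).deriv
      rw [e]
      linarith [h x hx]
  have key := tri_nonneg hpq hqw (f := fun x => f2 x - f1 x) (fun x hx => (hf2 x hx).sub (hf1 x hx)) this
  unfold tri at *
  linarith

lemma FL.tri_der {V0 H0 h0 k0 : ℝ → ℝ} {C : ℝ} {I : Set ℝ} (F : FL V0 H0 h0 k0 C I) {p q w : ℝ}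
    (hp : p ∈ I) (hq : q ∈ I) (hw : w ∈ I) {δ : ℝ} (hδ : 0 < δ) :
    ∃ s0 > 0, ∀ s ∈ Icc 0 s0, |tri p q w (Wf V0 H0 s) - tri p q w (Wf V0 H0 0) +
      s ^ 2 / 2 * tri p q w (rf H0 h0 0)| ≤ δ * s ^ 2 := by
  have hc : ∀ x ∈ I, Continuous (fun s => rf H0 h0 s x) := fun x hx =>
    continuous_iff_continuousAt.2 fun s =>
      ContinuousAt.comp (g := fun p : ℝ × ℝ => rf H0 h0 p.1 p.2) (f := fun s : ℝ => (s, x)) (F.r_cont s hx)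
        (by fun_prop : Continuous fun s : ℝ => (s, x)).continuousAt
  have hct : Continuous (fun s => tri p q w (rf H0 h0 s)) := by
    unfold tri
    exact (((hc p hp).const_mul _).sub ((hc q hq).const_mul _)).add ((hc w hw).const_mul _)
  obtain ⟨s1, hs1, hs⟩ := Metric.continuous_iff.1 hct 0 δ hδ
  refine ⟨s1 / 2, by linarith, fun s hs' => ?_⟩
  set G : ℝ → ℝ := fun s => tri p q w (Wf V0 H0 s) + s ^ 2 / 2 * tri p q w (rf H0 h0 0) with hG
  have hGd : ∀ s, HasDerivAt G (-(s * (tri p q w (rf H0 h0 s) - tri p q w (rf H0 h0 0)))) s := fun s => by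
    have h1 := (((F.W_s s hp).const_mul (w - q)).sub ((F.W_s s hq).const_mul (w - p))).add
      ((F.W_s s hw).const_mul (q - p))
    have h2 := ((hasDerivAt_pow 2 s).div_const 2).mul_const (tri p q w (rf H0 h0 0))
    refine (h1.add h2).congr_deriv ?_
    unfold tri
    norm_num
    ring
  have := Convex.norm_image_sub_le_of_norm_hasDerivWithin_le (s := Icc 0 s) (f := G) (C := s * δ)
    (fun x _ => (hGd x).hasDerivWithinAt) (fun x hx => by
      rw [norm_neg, norm_mul, Real.norm_eq_abs, abs_of_nonneg hx.1]
      have h3 := hs x (by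
        rw [Real.dist_eq, sub_zero, abs_of_nonneg hx.1]
        linarith [hx.2, hs'.2])
      rw [dist_eq_norm] at h3
      exact mul_le_mul hx.2 h3.le (norm_nonneg _) hs'.1) (convex_Icc 0 s)
    (left_mem_Icc.2 hs'.1) (right_mem_Icc.2 hs'.1)
  simp only [hG, Real.norm_eq_abs, sub_zero, abs_of_nonneg hs'.1] at this
  convert this using 1
  · congr 1; ring
  · ring

/-- first antiderivative of 1/P -/
noncomputable def E1 (P : ℝ → ℝ → ℝ) (θ x : ℝ) : ℝ := ∫ t in (1:ℝ)..x, 1 / P θ t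
/-- second antiderivative of 1/P -/
noncomputable def E2 (P : ℝ → ℝ → ℝ) (θ x : ℝ) : ℝ := ∫ t in (1:ℝ)..x, E1 P θ t

lemma hasDerivAt_integral_pos {f : ℝ → ℝ} (hf : ContinuousOn f (Ioi 0)) {x : ℝ} (hx : 0 < x) :
    HasDerivAt (fun x => ∫ t in (1:ℝ)..x, f t) (f x) x := by
  refine intervalIntegral.integral_hasDerivAt_right ?_ ?_ (hf.continuousAt (Ioi_mem_nhds hx))
  · refine (hf.mono ?_).intervalIntegrable
    intro t ht
    rcases mem_uIcc.1 ht with h | h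
    · exact lt_of_lt_of_le one_pos h.1
    · exact lt_of_lt_of_le hx h.1
  · exact hf.stronglyMeasurableAtFilter isOpen_Ioi x hx

section
variable {Θ : ℝ} {P Px : ℝ → ℝ → ℝ}

lemma Sol.cP (S : Sol Θ P Px) (θ : ℝ) : Continuous (P θ) :=
  S.cont.comp (by fun_prop : Continuous fun x : ℝ => (θ, x))

lemma Sol.cPt (S : Sol Θ P Px) (x : ℝ) : Continuous (fun θ => P θ x) :=
  S.cont.comp (by fun_prop : Continuous fun θ : ℝ => (θ, x))

lemma Sol.E1_d (S : Sol Θ P Px) (θ : ℝ) {x : ℝ} (hx : 0 < x) :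
    HasDerivAt (E1 P θ) (1 / P θ x) x :=
  hasDerivAt_integral_pos (f := fun t => 1 / P θ t)
    (continuousOn_const.div (S.cP θ).continuousOn fun t ht => (S.pos θ t ht).ne') hx

lemma Sol.E2_d (S : Sol Θ P Px) (θ : ℝ) {x : ℝ} (hx : 0 < x) :
    HasDerivAt (E2 P θ) (E1 P θ x) x :=
  hasDerivAt_integral_pos (f := E1 P θ)
    (fun t ht => (S.E1_d θ ht).continuousAt.continuousWithinAt) hx

lemma Sol.one_side (S : Sol Θ P Px) {θ0 p q w : ℝ} (hθ0 : θ0 ∈ Ico 0 Θ) (hp : 0 < p) (hpq : p < q)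
    (hqw : q < w) {ε : ℝ} (hε : ε = 1 ∨ ε = -1) {δ : ℝ} (hδ : 0 < δ) :
    ∃ s0 > 0, ∀ s ∈ Icc 0 s0, -δ * s ^ 2 ≤ 
      ε * (tri p q w (E2 P (θ0 + s ^ 2)) - tri p q w (E2 P θ0) + s ^ 2 / 2 * tri p q w (P θ0)) := by
  have hpw := hpq.trans hqw
  have hsub : ∀ x ∈ Icc (p / 2) (w + p / 2), 0 < x := fun x hx => lt_of_lt_of_le (by linarith) hx.1
  obtain ⟨N, hN0, hN⟩ : ∃ N : ℝ, 0 < N ∧ ∀ x ∈ Icc (p / 2) (w + p / 2), ε * (P θ0 x - N * x) < 0 := by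
    have hc : ContinuousOn (fun x => P θ0 x / x) (Icc (p / 2) (w + p / 2)) :=
      (S.cP θ0).continuousOn.div continuousOn_id fun x hx => (hsub x hx).ne'
    rcases hε with rfl | rfl
    · obtain ⟨N, hN⟩ := isCompact_Icc.exists_bound_of_continuousOn hc
      refine ⟨|N| + 1, by positivity, fun x hx => ?_⟩
      have h1 := (le_abs_self _).trans (hN x hx)
      have hx0 := hsub x hx
      have h2 : P θ0 x / x < |N| + 1 := by linarith [le_abs_self N]
      rw [div_lt_iff₀ hx0] at h2
      linarith
    · obtain ⟨x0, hx0, hm⟩ := isCompact_Icc.exists_isMinOn ⟨p, by constructor <;> linarith⟩ hc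
      have h0 : 0 < P θ0 x0 / x0 := div_pos (S.pos _ _ (hsub x0 hx0)) (hsub x0 hx0)
      refine ⟨P θ0 x0 / x0 / 2, by positivity, fun x hx => ?_⟩
      have h1 : P θ0 x0 / x0 ≤ P θ0 x / x := hm hx
      have h2 : P θ0 x0 / x0 / 2 < P θ0 x / x := by linarith
      rw [lt_div_iff₀ (hsub x hx)] at h2
      linarith
  have hθI : θ0 ∈ Icc 0 Θ := ⟨hθ0.1, hθ0.2.le⟩
  obtain ⟨V0, H0, h0, k0, C, F, hF1, hF2, hF3, hF4⟩ := barrier (S.dx θ0 hθI) (S.cx θ0 hθI)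
    (S.pos θ0) hp hpw hN0
  have hbd : ∀ x ∈ Icc (p / 2) (w + p / 2), rf H0 h0 0 x = N * x →
      ∃ h > 0, ∀ s ∈ Icc 0 h, ε * (P (θ0 + s ^ 2) x - rf H0 h0 s x) ≤ 0 := by
    intro x hx he
    have h1 : ContinuousAt (fun s => ε * (P (θ0 + s ^ 2) x - rf H0 h0 s x)) 0 := by
      refine continuousAt_const.mul (ContinuousAt.sub ?_ ?_)
      · exact ((S.cPt x).comp (by fun_prop : Continuous fun s : ℝ => θ0 + s ^ 2)).continuousAt
      · exact ContinuousAt.comp (g := fun p : ℝ × ℝ => rf H0 h0 p.1 p.2) (f := fun s : ℝ => (s, x))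
          (F.r_cont 0 (hsub x hx)) (by fun_prop : Continuous fun s : ℝ => (s, x)).continuousAt
    have h2 := h1.eventually_lt (continuousAt_const (y := (0:ℝ))) (by
      simp only [ne_eq, OfNat.ofNat_ne_zero, not_false_eq_true, zero_pow, add_zero]
      rw [he]; exact hN x hx)
    obtain ⟨h, hh, h3⟩ := Metric.eventually_nhds_iff.1 h2
    refine ⟨h / 2, by linarith, fun s hs => (h3 ?_).le⟩
    rw [Real.dist_eq, sub_zero, abs_of_nonneg hs.1]
    linarith [hs.2]
  obtain ⟨h1, hh1, hb1⟩ := hbd (p / 2) ⟨le_rfl, by linarith⟩ hF3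
  obtain ⟨h2, hh2, hb2⟩ := hbd (w + p / 2) ⟨by linarith, le_rfl⟩ hF4
  obtain ⟨h4, hh4, hb4⟩ := F.tri_der (show p ∈ Ioi 0 from hp) (show q ∈ Ioi 0 from hp.trans hpq)
    (show w ∈ Ioi 0 from hp.trans hpw) hδ
  set h3 := √(Θ - θ0) with hh3
  have h3pos : 0 < h3 := Real.sqrt_pos.2 (by linarith [hθ0.2])
  set h := min h3 (min h1 h2) with hhd
  have hhpos : 0 < h := lt_min h3pos (lt_min hh1 hh2)
  have hhsq : θ0 + h ^ 2 ≤ Θ := by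
    have : h ^ 2 ≤ h3 ^ 2 := pow_le_pow_left₀ hhpos.le (min_le_left _ _) 2
    rw [hh3, Real.sq_sqrt (by linarith [hθ0.2])] at this
    linarith
  have hl1 : h ≤ h1 := (min_le_right _ _).trans (min_le_left _ _)
  have hl2 : h ≤ h2 := (min_le_right _ _).trans (min_le_right _ _)
  have hc := cmpSol S F hθ0.1 hhpos hhsq (ε := ε) (a := p / 2) (b := w + p / 2) (by linarith)
    (fun x hx => by
      obtain ⟨z, hz, hzz⟩ := hF2 x hx
      rw [hzz]
      have := hN x hx
      have e : ε * (P θ0 x - (z * P θ0 x + (1 - z) * (N * x))) = (1 - z) * (ε * (P θ0 x - N * x)) := by ring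
      rw [e]
      exact mul_nonpos_of_nonneg_of_nonpos (by linarith [hz.2]) this.le)
    (fun s hs => hb1 s ⟨hs.1, hs.2.trans hl1⟩) (fun s hs => hb2 s ⟨hs.1, hs.2.trans hl2⟩)
  have hin : ∀ x ∈ Icc p w, x ∈ Icc (p / 2) (w + p / 2) := fun x hx =>
    ⟨by linarith [hx.1], by linarith [hx.2]⟩
  have hW0 : tri p q w (Wf V0 H0 0) = tri p q w (E2 P θ0) := by
    have e : ∀ x ∈ Icc p w, 1 / rf H0 h0 0 x = 1 / P θ0 x := fun x hx => by rw [hF1 x hx]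
    refine le_antisymm ?_ ?_
    · exact tri_mono hpq hqw (fun x hx => F.W_x 0 (hsub x (hin x hx)))
        (fun x hx => F.Y_x 0 (hsub x (hin x hx))) (fun x hx => S.E2_d _ (hsub x (hin x hx)))
        (fun x hx => S.E1_d _ (hsub x (hin x hx))) (fun x hx => (e x hx).le)
    · exact tri_mono hpq hqw (fun x hx => S.E2_d _ (hsub x (hin x hx)))
        (fun x hx => S.E1_d _ (hsub x (hin x hx))) (fun x hx => F.W_x 0 (hsub x (hin x hx)))
        (fun x hx => F.Y_x 0 (hsub x (hin x hx))) (fun x hx => (e x hx).ge)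
  have hr0 : tri p q w (rf H0 h0 0) = tri p q w (P θ0) := by
    unfold tri
    rw [hF1 p ⟨le_rfl, hpw.le⟩, hF1 q ⟨hpq.le, hqw.le⟩, hF1 w ⟨hpw.le, le_rfl⟩]
  refine ⟨min h h4, lt_min hhpos hh4, fun s hs => ?_⟩
  have hs1 : s ∈ Icc 0 h := ⟨hs.1, hs.2.trans (min_le_left _ _)⟩
  have k1 := hb4 s ⟨hs.1, hs.2.trans (min_le_right _ _)⟩
  rw [hW0, hr0, abs_le] at k1
  have k2 : 0 ≤ ε * (tri p q w (E2 P (θ0 + s ^ 2)) - tri p q w (Wf V0 H0 s)) := by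
    rcases hε with rfl | rfl
    · have := tri_mono hpq hqw (fun x hx => F.W_x s (hsub x (hin x hx)))
        (fun x hx => F.Y_x s (hsub x (hin x hx))) (fun x hx => S.E2_d (θ0 + s ^ 2) (hsub x (hin x hx)))
        (fun x hx => S.E1_d (θ0 + s ^ 2) (hsub x (hin x hx))) (fun x hx => by
          have := hc s hs1 x (hin x hx)
          exact one_div_le_one_div_of_le (S.pos _ _ (hsub x (hin x hx))) (by linarith))
      linarith
    · have := tri_mono hpq hqw (fun x hx => S.E2_d (θ0 + s ^ 2) (hsub x (hin x hx)))
        (fun x hx => S.E1_d (θ0 + s ^ 2) (hsub x (hin x hx))) (fun x hx => F.W_x s (hsub x (hin x hx)))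
        (fun x hx => F.Y_x s (hsub x (hin x hx))) (fun x hx => by
          have := hc s hs1 x (hin x hx)
          exact one_div_le_one_div_of_le (F.r_pos _ _) (by linarith))
      linarith
  rcases hε with rfl | rfl <;> linarith [k1.1, k1.2]

lemma Sol.right_der (S : Sol Θ P Px) {θ0 p q w : ℝ} (hθ0 : θ0 ∈ Ico 0 Θ) (hp : 0 < p) (hpq : p < q)
    (hqw : q < w) : HasDerivWithinAt (fun θ => tri p q w (E2 P θ)) (-(1 / 2) * tri p q w (P θ0))
      (Ioi θ0) θ0 := by
  rw [hasDerivWithinAt_iff_isLittleO, Asymptotics.isLittleO_iff]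
  intro δ hδ
  obtain ⟨s1, hs1, k1⟩ := S.one_side hθ0 hp hpq hqw (Or.inl rfl) hδ
  obtain ⟨s2, hs2, k2⟩ := S.one_side hθ0 hp hpq hqw (Or.inr rfl) hδ
  set s0 := min s1 s2 with hs0
  have hs0p : 0 < s0 := lt_min hs1 hs2
  have hev : Ioo θ0 (θ0 + s0 ^ 2) ∈ nhdsWithin θ0 (Ioi θ0) := Ioo_mem_nhdsGT (by
    have := pow_pos hs0p 2; linarith)
  filter_upwards [hev] with θ hθ
  have hle : √(θ - θ0) ≤ s0 := by
    rw [Real.sqrt_le_left hs0p.le]; linarith [hθ.2]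
  have hsq : √(θ - θ0) ^ 2 = θ - θ0 := Real.sq_sqrt (by linarith [hθ.1])
  have a1 := k1 (√(θ - θ0)) ⟨Real.sqrt_nonneg _, hle.trans (min_le_left _ _)⟩
  have a2 := k2 (√(θ - θ0)) ⟨Real.sqrt_nonneg _, hle.trans (min_le_right _ _)⟩
  rw [hsq, add_sub_cancel] at a1 a2
  rw [Real.norm_eq_abs, Real.norm_eq_abs, abs_of_pos (by linarith [hθ.1] : 0 < θ - θ0), abs_le, smul_eq_mul]
  constructor <;> linarith

end

section
variable {Θ : ℝ} {P Px : ℝ → ℝ → ℝ}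

lemma Sol.E2_cont (S : Sol Θ P Px) {x : ℝ} (hx : 0 < x) : Continuous (fun θ => E2 P θ x) := by
  set m := min 1 x with hm
  have hm0 : 0 < m := lt_min one_pos hx
  have hf : Continuous (Function.uncurry fun θ t : ℝ => 1 / P θ (max t m)) := by
    refine continuous_const.div ?_ ?_
    · exact S.cont.comp (by fun_prop : Continuous fun p : ℝ × ℝ => (p.1, max p.2 m))
    · intro p
      exact (S.pos _ _ (lt_max_of_lt_right hm0)).ne'
  have hf1 : Continuous (fun p : ℝ × ℝ => ∫ u in (1:ℝ)..p.2, 1 / P p.1 (max u m)) := by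
    refine intervalIntegral.continuous_parametric_intervalIntegral_of_continuous
      (f := fun (p : ℝ × ℝ) u => 1 / P p.1 (max u m)) ?_ continuous_snd
    exact hf.comp (by fun_prop : Continuous fun q : (ℝ × ℝ) × ℝ => (q.1.1, q.2))
  have hf2 : Continuous (fun θ : ℝ => ∫ t in (1:ℝ)..x, ∫ u in (1:ℝ)..t, 1 / P θ (max u m)) :=
    intervalIntegral.continuous_parametric_intervalIntegral_of_continuous
      (f := fun (θ : ℝ) t => ∫ u in (1:ℝ)..t, 1 / P θ (max u m)) hf1 continuous_const
  have e : (fun θ => E2 P θ x) = (fun θ : ℝ => ∫ t in (1:ℝ)..x, ∫ u in (1:ℝ)..t, 1 / P θ (max u m)) := by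
    funext θ
    unfold E2 E1
    refine intervalIntegral.integral_congr fun t ht => ?_
    refine intervalIntegral.integral_congr fun u hu => ?_
    have ht' : m ≤ t := ht.1.trans' (by simp [hm])
    have hu' : m ≤ u := hu.1.trans' (le_min (min_le_left _ _) ht')
    simp only [max_eq_left hu']
  rw [e]; exact hf2

end

/-- potential of a solution -/
structure Wd (Θ : ℝ) (P Px W Y : ℝ → ℝ → ℝ) : Prop extends Sol Θ P Px where
  wx : ∀ θ ∈ Icc 0 Θ, ∀ x, 0 < x → HasDerivAt (W θ) (Y θ x) x
  yx : ∀ θ ∈ Icc 0 Θ, ∀ x, 0 < x → HasDerivAt (Y θ) (1 / P θ x) x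
  wt : ∀ θ x, HasDerivAt (fun σ => W σ x) (-(1/2) * P θ x) θ
  wc : ContinuousOn (fun p : ℝ × ℝ => W p.1 p.2) (univ ×ˢ Ioi 0)

lemma Sol.exists_W {Θ : ℝ} {P Px : ℝ → ℝ → ℝ} (S : Sol Θ P Px) {W0 Y0 : ℝ → ℝ}
    (hW : ∀ x, 0 < x → HasDerivAt W0 (Y0 x) x) (hY : ∀ x, 0 < x → HasDerivAt Y0 (1 / P 0 x) x) :
    ∃ W Y, Wd Θ P Px W Y ∧ ∀ x, W 0 x = W0 x := by
  set W : ℝ → ℝ → ℝ := fun θ x => W0 x - 1 / 2 * ∫ σ in (0:ℝ)..θ, P σ x with hWd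
  have hWt : ∀ θ x, HasDerivAt (fun σ => W σ x) (-(1/2) * P θ x) θ := fun θ x => by
    have h := ((S.cPt x).integral_hasStrictDerivAt 0 θ).hasDerivAt
    refine ((h.const_mul (1/2)).const_sub (W0 x)).congr_deriv ?_
    ring
  have hWc : ContinuousOn (fun p : ℝ × ℝ => W p.1 p.2) (univ ×ˢ Ioi 0) := by
    refine ContinuousOn.sub ?_ ?_
    · intro p hp
      exact ((hW p.2 hp.2).continuousAt.comp continuousAt_snd).continuousWithinAt
    · refine (continuous_const.mul ?_).continuousOn
      refine intervalIntegral.continuous_parametric_intervalIntegral_of_continuous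
        (f := fun (p : ℝ × ℝ) σ => P σ p.2) ?_ continuous_fst
      exact S.cont.comp (by fun_prop : Continuous fun q : (ℝ × ℝ) × ℝ => (q.2, q.1.2))
  have hW0 : ∀ x, W 0 x = W0 x := fun x => by simp [hWd]
  have htri : ∀ p q w, 0 < p → p < q → q < w → ∀ θ ∈ Icc 0 Θ, tri p q w (E2 P θ) = tri p q w (W θ) := by
    intro p q w hp hpq hqw θ hθ
    have hq := hp.trans hpq
    have hw := hq.trans hqw
    have key := constant_of_has_deriv_right_zero (f := fun θ => tri p q w (E2 P θ) - tri p q w (W θ))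
      (a := 0) (b := Θ) (by
        have c1 : ∀ x, Continuous (fun θ => W θ x) := fun x =>
          continuous_iff_continuousAt.2 fun θ => (hWt θ x).continuousAt
        have c2 := S.E2_cont hp
        have c3 := S.E2_cont hq
        have c4 := S.E2_cont hw
        have := c1 p
        have := c1 q
        have := c1 w
        unfold tri
        fun_prop)
      (by
        intro θ hθ
        have h1 := S.right_der hθ hp hpq hqw
        have h2 := ((((hWt θ p).const_mul (w - q)).sub ((hWt θ q).const_mul (w - p))).add
          ((hWt θ w).const_mul (q - p))).hasDerivWithinAt (s := Ici θ)
        refine ((h1.Ici_of_Ioi).sub h2).congr_deriv ?_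
        unfold tri
        ring)
    have k := key θ hθ
    have h0 : tri p q w (E2 P 0) = tri p q w (W 0) := by
      have hs : ∀ x ∈ Icc p w, 0 < x := fun x hx => hp.trans_le hx.1
      have : W 0 = W0 := funext hW0
      rw [this]
      refine le_antisymm ?_ ?_
      · exact tri_mono hpq hqw (fun x hx => S.E2_d 0 (hs x hx)) (fun x hx => S.E1_d 0 (hs x hx))
          (fun x hx => hW x (hs x hx)) (fun x hx => hY x (hs x hx)) fun x hx => le_rfl
      · exact tri_mono hpq hqw (fun x hx => hW x (hs x hx)) (fun x hx => hY x (hs x hx))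
          (fun x hx => S.E2_d 0 (hs x hx)) (fun x hx => S.E1_d 0 (hs x hx)) fun x hx => le_rfl
    linarith
  set c : ℝ → ℝ := fun θ => (W θ 2 - E2 P θ 2) - (W θ 1 - E2 P θ 1) with hc
  set Y : ℝ → ℝ → ℝ := fun θ x => E1 P θ x + c θ with hYd
  refine ⟨W, Y, ⟨S, ?_, ?_, hWt, hWc⟩, hW0⟩
  · intro θ hθ x hx
    have hlin : ∀ z, 0 < z → W θ z = E2 P θ z + (W θ 1 - E2 P θ 1) + (z - 1) * c θ := by
      intro z hz
      have key : ∀ p q w, 0 < p → p < q → q < w → tri p q w (E2 P θ) = tri p q w (W θ) :=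
        fun p q w h1 h2 h3 => htri p q w h1 h2 h3 θ hθ
      simp only [tri] at key
      simp only [hc]
      rcases lt_trichotomy z 1 with h | h | h
      · have := key z 1 2 hz h (by norm_num)
        linarith
      · subst h; ring
      · rcases lt_trichotomy z 2 with h' | h' | h'
        · have := key 1 z 2 one_pos h h'
          linarith
        · subst h'; ring
        · have := key 1 2 z one_pos (by norm_num) h'
          linarith
    have h1 := ((S.E2_d θ hx).add_const (W θ 1 - E2 P θ 1)).add
      (((hasDerivAt_id x).sub_const 1).mul_const (c θ))
    refine (h1.congr_of_eventuallyEq ?_).congr_deriv ?_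
    · filter_upwards [Ioi_mem_nhds hx] with z hz
      rw [hlin z hz]; rfl
    · simp [hYd]
  · intro θ hθ x hx
    exact (S.E1_d θ hx).add_const _

/-- moments of tilted finite measure -/
noncomputable def Mo (S : Finset ℝ) (c : ℝ → ℝ) (κ : ℝ) (k : ℕ) (y : ℝ) : ℝ :=
  ∑ x ∈ S, x ^ k * (c x * Real.exp (x * y / κ))

section
variable {S : Finset ℝ} {c : ℝ → ℝ} {κ : ℝ}

lemma Mo_d (k : ℕ) (y : ℝ) : HasDerivAt (Mo S c κ k) (Mo S c κ (k + 1) y / κ) y := by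
  unfold Mo
  rw [Finset.sum_div]
  refine HasDerivAt.fun_sum fun x _ => ?_
  have h := (((((hasDerivAt_id y).const_mul x).div_const κ).exp).const_mul (c x)).const_mul (x ^ k)
  refine h.congr_deriv ?_
  simp only [id]
  ring

lemma Mo_pos (hc : ∀ x, 0 < c x) (hS : S.Nonempty) (y : ℝ) : 0 < Mo S c κ 0 y := by
  unfold Mo
  refine Finset.sum_pos (fun x _ => ?_) hS
  have := hc x
  positivity

lemma Mo_two (m y : ℝ) : ∑ x ∈ S, (x - m) ^ 2 * (c x * Real.exp (x * y / κ)) =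
    Mo S c κ 2 y - 2 * m * Mo S c κ 1 y + m ^ 2 * Mo S c κ 0 y := by
  simp only [Mo, Finset.mul_sum, ← Finset.sum_sub_distrib, ← Finset.sum_add_distrib]
  exact Finset.sum_congr rfl fun x _ => by ring

lemma Mo_three (m y : ℝ) : ∑ x ∈ S, (x - m) ^ 3 * (c x * Real.exp (x * y / κ)) =
    Mo S c κ 3 y - 3 * m * Mo S c κ 2 y + 3 * m ^ 2 * Mo S c κ 1 y - m ^ 3 * Mo S c κ 0 y := by
  simp only [Mo, Finset.mul_sum, ← Finset.sum_sub_distrib, ← Finset.sum_add_distrib]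
  exact Finset.sum_congr rfl fun x _ => by ring

lemma Mo_ab (α β y : ℝ) : ∑ x ∈ S, (x - α) * (β - x) * (c x * Real.exp (x * y / κ)) =
    (α + β) * Mo S c κ 1 y - Mo S c κ 2 y - α * β * Mo S c κ 0 y := by
  simp only [Mo, Finset.mul_sum, ← Finset.sum_sub_distrib, ← Finset.sum_add_distrib]
  exact Finset.sum_congr rfl fun x _ => by ring

lemma Mo_lin (α y : ℝ) : ∑ x ∈ S, (x - α) * (c x * Real.exp (x * y / κ)) =
    Mo S c κ 1 y - α * Mo S c κ 0 y := by
  simp only [Mo, Finset.mul_sum, ← Finset.sum_sub_distrib, ← Finset.sum_add_distrib]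
  exact Finset.sum_congr rfl fun x _ => by ring

end

lemma Ga_linear (a b s y : ℝ) : Ga (fun y => a * y + b) s y = a * y + b := by
  have h1 : EG (fun y => a * y + b) := by
    have : EG (fun _ : ℝ => a) := ⟨continuous_const, |a|, 0, abs_nonneg _, le_rfl, fun y => by simp⟩
    exact this.antideriv fun y => by simpa using ((hasDerivAt_id y).const_mul a).add_const b
  have hz : ∫ z, z ∂gam = 0 := by
    unfold gam
    exact ProbabilityTheory.integral_id_gaussianReal
  have hzi : MeasureTheory.Integrable (fun z : ℝ => z) gam := by
    have : EG (fun y : ℝ => y) := by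
      have : EG (fun _ : ℝ => (1:ℝ)) := ⟨continuous_const, 1, 0, zero_le_one, le_rfl, fun y => by simp⟩
      exact this.antideriv fun y => hasDerivAt_id y
    simpa using this.integrable 1 0
  unfold Ga
  have e : (fun z => a * (y + s * z) + b) = fun z => (a * y + b) + (a * s) * z := by funext z; ring
  rw [e, MeasureTheory.integral_add (MeasureTheory.integrable_const _) (hzi.const_mul _),
    MeasureTheory.integral_const_mul, hz]
  simp

lemma surj_of_lines {V H : ℝ → ℝ} {α β b : ℝ} (hV : EG V) (hH : EG H) (hd : ∀ y, HasDerivAt V (H y) y)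
    (h1 : ∀ y, α * y - b ≤ V y) (h2 : ∀ y, β * y - b ≤ V y) {s x : ℝ} (hx : x ∈ Ioo α β) :
    ∃ y, Ga H s y = x := by
  have hc : Continuous (Ga H s) := hH.continuous_Ga.comp (by fun_prop : Continuous fun y : ℝ => (s, y))
  have hlin : ∀ a : ℝ, EG (fun y => a * y - b) := fun a => by
    have : EG (fun _ : ℝ => a) := ⟨continuous_const, |a|, 0, abs_nonneg _, le_rfl, fun y => by simp⟩
    exact this.antideriv fun y => by simpa using ((hasDerivAt_id y).const_mul a).sub_const b
  have l1 : ∀ a, (∀ y, a * y - b ≤ V y) → ∀ y, a * y - b ≤ Ga V s y := fun a h y => by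
    have := Ga_mono (hlin a) hV h s y
    have e := Ga_linear a (-b) s y
    simp only [← sub_eq_add_neg] at e
    linarith
  have hdG := fun y => Ga_hasDerivAt_y hV hH hd s y
  -- G y = Ga V s y - x y is monotone if Ga H s ≥ x
  refine mem_range_of_exists_le_of_exists_ge hc ?_ ?_
  · by_contra hcon
    push Not at hcon
    have hm : Monotone (fun y => Ga V s y - x * y) := monotone_of_hasDerivAt_nonneg
      (f' := fun y => Ga H s y - x) (fun y => by
        exact ((hdG y).sub ((hasDerivAt_id y).const_mul x)).congr_deriv (by simp)) (fun y => sub_nonneg.2 (hcon y).le)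
    set y0 := -((|Ga V s 0| + |b| + 1) / (x - α)) with hy0
    have hxa : 0 < x - α := by linarith [hx.1]
    have hneg : y0 ≤ 0 := by rw [hy0]; simp only [Left.neg_nonpos_iff]; positivity
    have := hm hneg
    simp only [mul_zero, sub_zero] at this
    have k := l1 α h1 y0
    have e : (x - α) * y0 = -(|Ga V s 0| + |b| + 1) := by rw [hy0]; field_simp
    have := le_abs_self (Ga V s 0)
    have := le_abs_self b
    nlinarith
  · by_contra hcon
    push Not at hcon
    have hm : Monotone (fun y => x * y - Ga V s y) := monotone_of_hasDerivAt_nonneg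
      (f' := fun y => x - Ga H s y) (fun y => by
        exact (((hasDerivAt_id y).const_mul x).sub (hdG y)).congr_deriv (by simp)) (fun y => sub_nonneg.2 (hcon y).le)
    set y0 := ((|Ga V s 0| + |b| + 1) / (β - x)) with hy0
    have hxa : 0 < β - x := by linarith [hx.2]
    have hneg : 0 ≤ y0 := by rw [hy0]; positivity
    have := hm hneg
    simp only [mul_zero, zero_sub] at this
    have k := l1 β h2 y0
    have e : (β - x) * y0 = (|Ga V s 0| + |b| + 1) := by rw [hy0]; field_simp
    have := le_abs_self (Ga V s 0)
    have := le_abs_self b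
    nlinarith

lemma lse {S : Finset ℝ} {c : ℝ → ℝ} {κ α β : ℝ} (hκ : 0 < κ) (hc : ∀ x, 0 < c x) (hα : α ∈ S) (hβ : β ∈ S)
    (hαβ : α < β) (hS : ∀ x ∈ S, x ∈ Icc α β) :
    ∃ V0 H0 h0 k0 C, FL V0 H0 h0 k0 C (Ioo α β) ∧ (∀ y, V0 y = κ * Real.log (Mo S c κ 0 y)) ∧
      (∀ y, H0 y ∈ Ioo α β) ∧ (∀ y, h0 y ≤ C * (H0 y - α)) ∧ (∀ y, h0 y ≤ C * (β - H0 y)) := by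
  set M := Mo S c κ with hM
  have hp : ∀ y, 0 < M 0 y := Mo_pos hc ⟨α, hα⟩
  have hw : ∀ x y, 0 < c x * Real.exp (x * y / κ) := fun x y => by have := hc x; positivity
  set H0 : ℝ → ℝ := fun y => M 1 y / M 0 y with hH0
  set h0 : ℝ → ℝ := fun y => (M 2 y / M 0 y - (M 1 y / M 0 y) ^ 2) / κ with hh0
  set k0 : ℝ → ℝ := fun y => (M 3 y / M 0 y - 3 * (M 1 y / M 0 y) * (M 2 y / M 0 y) + 2 * (M 1 y / M 0 y) ^ 3) / κ ^ 2 with hk0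
  have dM : ∀ k y, HasDerivAt (M k) (M (k + 1) y / κ) y := fun k y => Mo_d k y
  have dH : ∀ y, HasDerivAt H0 (h0 y) y := fun y => by
    refine ((dM 1 y).div (dM 0 y) (hp y).ne').congr_deriv ?_
    have := (hp y).ne'
    simp only [hh0]
    field_simp
  have dh : ∀ y, HasDerivAt h0 (k0 y) y := fun y => by
    have a1 := (dM 2 y).div (dM 0 y) (hp y).ne'
    have a2 := ((dM 1 y).div (dM 0 y) (hp y).ne').pow 2
    refine ((a1.sub a2).div_const κ).congr_deriv ?_
    have := (hp y).ne'
    simp only [hk0, Pi.div_apply, Nat.add_one_sub_one, pow_one, Nat.cast_ofNat, Nat.reduceAdd, Nat.reduceSub]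
    field_simp
    ring
  have hin : ∀ y, H0 y ∈ Ioo α β := fun y => by
    constructor
    · have : 0 < ∑ x ∈ S, (x - α) * (c x * Real.exp (x * y / κ)) :=
        Finset.sum_pos' (fun x hx => mul_nonneg (by linarith [(hS x hx).1]) (hw x y).le)
          ⟨β, hβ, mul_pos (by linarith) (hw β y)⟩
      rw [Mo_lin] at this
      simp only [hH0]
      rw [lt_div_iff₀ (hp y)]
      linarith
    · have : 0 < ∑ x ∈ S, (β - x) * (c x * Real.exp (x * y / κ)) :=
        Finset.sum_pos' (fun x hx => mul_nonneg (by linarith [(hS x hx).2]) (hw x y).le)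
          ⟨α, hα, mul_pos (by linarith) (hw α y)⟩
      have e := Mo_lin (S := S) (c := c) (κ := κ) β y
      have e2 : ∑ x ∈ S, (x - β) * (c x * Real.exp (x * y / κ)) = - ∑ x ∈ S, (β - x) * (c x * Real.exp (x * y / κ)) := by
        rw [← Finset.sum_neg_distrib]; exact Finset.sum_congr rfl fun x _ => by ring
      simp only [hH0]
      rw [div_lt_iff₀ (hp y)]
      linarith
  have eh : ∀ y, h0 y * (κ * M 0 y) = ∑ x ∈ S, (x - H0 y) ^ 2 * (c x * Real.exp (x * y / κ)) := fun y => by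
    rw [Mo_two]
    have := (hp y).ne'
    simp only [hh0, hH0, ← hM]
    field_simp
    ring
  have ek : ∀ y, k0 y * (κ ^ 2 * M 0 y) = ∑ x ∈ S, (x - H0 y) ^ 3 * (c x * Real.exp (x * y / κ)) := fun y => by
    rw [Mo_three]
    have := (hp y).ne'
    simp only [hk0, hH0, ← hM]
    field_simp
    ring
  have hpos : ∀ y, 0 < h0 y := fun y => by
    have : 0 < h0 y * (κ * M 0 y) := by
      rw [eh]
      refine Finset.sum_pos' (fun x hx => mul_nonneg (sq_nonneg _) (hw x y).le)
          ⟨β, hβ, mul_pos (pow_pos (by linarith [(hin y).2]) 2) (hw β y)⟩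
    exact pos_of_mul_pos_left this (mul_pos hκ (hp y)).le
  have hbd : ∀ y, |k0 y| ≤ (β - α) / κ * h0 y := fun y => by
    have hq : 0 < κ ^ 2 * M 0 y := mul_pos (pow_pos hκ 2) (hp y)
    rw [← mul_le_mul_iff_left₀ hq]
    have : |k0 y| * (κ ^ 2 * M 0 y) = |k0 y * (κ ^ 2 * M 0 y)| := by rw [abs_mul, abs_of_pos hq]
    rw [this, ek]
    have e : (β - α) / κ * h0 y * (κ ^ 2 * M 0 y) = (β - α) * (h0 y * (κ * M 0 y)) := by field_simp
    rw [e, eh, Finset.mul_sum]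
    refine (Finset.abs_sum_le_sum_abs _ _).trans (Finset.sum_le_sum fun x hx => ?_)
    rw [abs_mul, abs_of_pos (hw x y), ← mul_assoc (β - α)]
    refine mul_le_mul_of_nonneg_right ?_ (hw x y).le
    rw [pow_succ', abs_mul, abs_of_nonneg (sq_nonneg (x - H0 y))]
    refine mul_le_mul_of_nonneg_right ?_ (sq_nonneg _)
    rw [abs_le]
    constructor <;> linarith [(hS x hx).1, (hS x hx).2, (hin y).1, (hin y).2]
  have hab : ∀ y, h0 y * κ ≤ (H0 y - α) * (β - H0 y) := fun y => by
    have : 0 ≤ ∑ x ∈ S, (x - α) * (β - x) * (c x * Real.exp (x * y / κ)) :=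
      Finset.sum_nonneg fun x hx => mul_nonneg (mul_nonneg (by linarith [(hS x hx).1]) (by linarith [(hS x hx).2])) (hw x y).le
    rw [Mo_ab] at this
    have e : ((H0 y - α) * (β - H0 y) - h0 y * κ) * M 0 y = (α + β) * M 1 y - M 2 y - α * β * M 0 y := by
      have := (hp y).ne'
      simp only [hh0, hH0]
      field_simp
      ring
    have := nonneg_of_mul_nonneg_left (e ▸ this) (hp y)
    linarith
  have cH : Continuous H0 := continuous_iff_continuousAt.2 fun y => (dH y).continuousAt
  have egH : EG H0 := ⟨cH, |α| + |β|, 0, by positivity, le_rfl, fun y => by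
    simp only [zero_mul, Real.exp_zero, mul_one]
    rw [abs_le]
    have := hin y
    constructor
    · linarith [this.1, neg_abs_le α, abs_nonneg β]
    · linarith [this.2, le_abs_self β, abs_nonneg α]⟩
  have dV : ∀ y, HasDerivAt (fun y => κ * Real.log (M 0 y)) (H0 y) y := fun y => by
    refine (((dM 0 y).log (hp y).ne').const_mul κ).congr_deriv ?_
    have := (hp y).ne'
    simp only [hH0]
    field_simp
  have egV := egH.antideriv dV
  set b := |κ * Real.log (c α)| + |κ * Real.log (c β)| with hb
  have hline : ∀ x ∈ S, ∀ y, x * y + κ * Real.log (c x) ≤ κ * Real.log (M 0 y) := fun x hx y => by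
    have h1 : c x * Real.exp (x * y / κ) ≤ M 0 y := by
      have := Finset.single_le_sum (f := fun x => x ^ 0 * (c x * Real.exp (x * y / κ))) (s := S)
        (fun x _ => by simpa using (hw x y).le) hx
      simpa [hM, Mo] using this
    have h2 := Real.log_le_log (hw x y) h1
    rw [Real.log_mul (hc x).ne' (Real.exp_pos _).ne', Real.log_exp] at h2
    have h3 := mul_le_mul_of_nonneg_left h2 hκ.le
    have : κ * (Real.log (c x) + x * y / κ) = x * y + κ * Real.log (c x) := by field_simp; ring
    linarith
  have hα' : ∀ y, α * y - b ≤ κ * Real.log (M 0 y) := fun y => by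
    have := hline α hα y
    have := neg_abs_le (κ * Real.log (c α))
    have := abs_nonneg (κ * Real.log (c β))
    linarith
  have hβ' : ∀ y, β * y - b ≤ κ * Real.log (M 0 y) := fun y => by
    have := hline β hβ y
    have := neg_abs_le (κ * Real.log (c β))
    have := abs_nonneg (κ * Real.log (c α))
    linarith
  have hdiv : 0 ≤ (β - α) / κ := div_nonneg (by linarith) hκ.le
  refine ⟨fun y => κ * Real.log (M 0 y), H0, h0, k0, (β - α) / κ, ⟨hdiv, dV, dH, dh, ?_, hpos, hbd, isOpen_Ioo, ?_⟩,
    fun y => rfl, hin, fun y => ?_, fun y => ?_⟩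
  · have cM : ∀ k, Continuous (M k) := fun k => continuous_iff_continuousAt.2 fun y => (dM k y).continuousAt
    have c0 : ∀ k, Continuous (fun y => M k y / M 0 y) := fun k => (cM k).div (cM 0) fun y => (hp y).ne'
    have := c0 1
    have := c0 2
    have := c0 3
    simp only [hk0]
    fun_prop
  · intro s x hx
    exact surj_of_lines egV egH dV hα' hβ' hx
  · have := hab y
    rw [div_mul_eq_mul_div, le_div_iff₀ hκ]
    nlinarith [(hin y).1, (hin y).2]
  · have := hab y
    rw [div_mul_eq_mul_div, le_div_iff₀ hκ]
    nlinarith [(hin y).1, (hin y).2]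

section
variable {Θ : ℝ} {P Px W Y : ℝ → ℝ → ℝ}

lemma Wd.Y_mono (D : Wd Θ P Px W Y) {θ : ℝ} (hθ : θ ∈ Icc 0 Θ) : MonotoneOn (Y θ) (Ioi 0) := by
  refine monotoneOn_of_deriv_nonneg (convex_Ioi 0) ?_ ?_ ?_
  · exact fun x hx => (D.yx θ hθ x hx).continuousAt.continuousWithinAt
  · intro x hx
    exact (D.yx θ hθ x (interior_subset hx)).differentiableAt.differentiableWithinAt
  · intro x hx
    rw [(D.yx θ hθ x (interior_subset hx)).deriv]
    exact (one_div_pos.2 (D.pos θ x (interior_subset hx))).le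

lemma Wd.conv (D : Wd Θ P Px W Y) {θ : ℝ} (hθ : θ ∈ Icc 0 Θ) {x z : ℝ} (hx : 0 < x) (hz : 0 < z) :
    z * Y θ x - W θ z ≤ x * Y θ x - W θ x := by
  have hcv : ConvexOn ℝ (Ioi 0) (W θ) := by
    refine MonotoneOn.convexOn_of_deriv (convex_Ioi 0) ?_ ?_ ?_
    · exact fun x hx => (D.wx θ hθ x hx).continuousAt.continuousWithinAt
    · intro x hx
      exact (D.wx θ hθ x (interior_subset hx)).differentiableAt.differentiableWithinAt
    · intro x hx y hy hxy
      rw [(D.wx θ hθ x (interior_subset hx)).deriv, (D.wx θ hθ y (interior_subset hy)).deriv]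
      exact D.Y_mono hθ (interior_subset hx) (interior_subset hy) hxy
  rcases lt_trichotomy x z with h | h | h
  · have := hcv.le_slope_of_hasDerivAt (show x ∈ Ioi 0 from hx) hz h (D.wx θ hθ x hx)
    rw [slope_def_field, le_div_iff₀ (by linarith)] at this
    linarith
  · subst h; exact le_rfl
  · have := hcv.slope_le_of_hasDerivAt (show z ∈ Ioi 0 from hz) hx h (D.wx θ hθ x hx)
    rw [slope_def_field, div_le_iff₀ (by linarith)] at this
    linarith

lemma Wd.anti (D : Wd Θ P Px W Y) {x : ℝ} (hx : 0 < x) : Antitone (fun θ => W θ x) :=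
  antitone_of_hasDerivAt_nonpos (fun θ => D.wt θ x) fun θ => by
    have := D.pos θ x hx
    show -(1/2) * P θ x ≤ 0
    linarith

lemma Wd.wts (D : Wd Θ P Px W Y) (θ0 s x : ℝ) :
    HasDerivAt (fun s => W (θ0 + s ^ 2) x) (-(s * P (θ0 + s ^ 2) x)) s := by
  have h1 : HasDerivAt (fun σ : ℝ => θ0 + σ ^ 2) (2 * s) s := by
    simpa using (hasDerivAt_pow 2 s).const_add θ0
  refine (HasDerivAt.comp s (D.wt (θ0 + s ^ 2) x) h1).congr_deriv ?_
  ring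

lemma Wd.sub_flow (D : Wd Θ P Px W Y) {V0 H0 h0 k0 : ℝ → ℝ} {C α β : ℝ}
    (F : FL V0 H0 h0 k0 C (Ioo α β)) (hα : 0 < α) (hl : ∀ y, h0 y ≤ C * (H0 y - α))
    (hr : ∀ y, h0 y ≤ C * (β - H0 y)) {θ0 s1 : ℝ} (hθ0 : 0 ≤ θ0) (hθ1 : θ0 + s1 ^ 2 ≤ Θ)
    (hV : ∀ y B, (∀ z, 0 < z → z * y - W θ0 z ≤ B) → V0 y ≤ B) :
    ∀ s ∈ Icc 0 s1, ∀ x ∈ Ioo α β, W (θ0 + s ^ 2) x ≤ Wf V0 H0 s x := by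
  intro s2 hs2 x2 hx2
  have hs10 : 0 ≤ s1 := hs2.1.trans hs2.2
  have hθ0' : θ0 ∈ Icc 0 Θ := ⟨hθ0, by nlinarith [sq_nonneg s1]⟩
  have hinit : ∀ x ∈ Ioo α β, W θ0 x ≤ Wf V0 H0 0 x := fun x hx => by
    have hx0 : 0 < x := hα.trans hx.1
    have h1 := F.young 0 hx (Y θ0 x)
    rw [Ga_zero] at h1
    have h2 := hV (Y θ0 x) _ (fun z hz => D.conv hθ0' hx0 hz)
    linarith
  have egc : ∀ c : ℝ, EG (fun _ : ℝ => c) := fun c =>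
    ⟨continuous_const, |c|, 0, abs_nonneg _, le_rfl, fun y => by simp⟩
  have hHlin : ∀ a b s y, Ga (fun y => a * H0 y + b) s y = a * Ga H0 s y + b := fun a b s y => by
    unfold Ga
    rw [MeasureTheory.integral_add ((F.egH.integrable s y).const_mul a) (MeasureTheory.integrable_const _),
      MeasureTheory.integral_const_mul]
    simp
  have egl : ∀ a b, EG (fun y => a * H0 y + b) := fun a b =>
    (F.egh.const_mul a).antideriv fun y => ((F.dH y).const_mul a).add_const b
  have rl : ∀ s, ∀ x ∈ Ioo α β, rf H0 h0 s x ≤ C * (x - α) := fun s x hx => by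
    have h := Ga_mono F.egh (egl C (-(C * α))) (fun y => by linarith [hl y]) s (Yf H0 s x)
    rw [hHlin, F.Y_eq s hx] at h
    unfold rf
    linarith
  have rr : ∀ s, ∀ x ∈ Ioo α β, rf H0 h0 s x ≤ C * (β - x) := fun s x hx => by
    have h := Ga_mono F.egh (egl (-C) (C * β)) (fun y => by linarith [hr y]) s (Yf H0 s x)
    rw [hHlin, F.Y_eq s hx] at h
    unfold rf
    linarith
  have hb : ∀ x ∈ Ioo α β, ∀ m, (∀ s, rf H0 h0 s x ≤ m) → ∀ s ∈ Icc 0 s1,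
      W (θ0 + s ^ 2) x - Wf V0 H0 s x ≤ s1 ^ 2 * m := fun x hx m hm s hs => by
    have h1 := D.anti (hα.trans hx.1) (show θ0 ≤ θ0 + s ^ 2 by nlinarith [sq_nonneg s])
    have h2 := hinit x hx
    have hmp : 0 < m := (F.r_pos 0 x).trans_le (hm 0)
    have h3 := Convex.norm_image_sub_le_of_norm_hasDerivWithin_le (s := Icc 0 s) (f := fun s => Wf V0 H0 s x)
      (C := s1 * m) (fun σ _ => (F.W_s σ hx).hasDerivWithinAt) (fun σ hσ => by
        rw [norm_neg, Real.norm_eq_abs, abs_of_nonneg (mul_nonneg hσ.1 (F.r_pos σ x).le)]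
        exact mul_le_mul (hσ.2.trans hs.2) (hm σ) (F.r_pos σ x).le hs10) (convex_Icc 0 s)
        (left_mem_Icc.2 hs.1) (right_mem_Icc.2 hs.1)
    rw [Real.norm_eq_abs, Real.norm_eq_abs, sub_zero, abs_of_nonneg hs.1] at h3
    have h4 := (abs_le.1 h3).1
    have h5 : s1 * m * s ≤ s1 ^ 2 * m := by nlinarith [hs.2, mul_nonneg hs10 hmp.le]
    simp only at h1
    linarith
  refine le_of_forall_pos_le_add fun ε hε => ?_
  set δ := ε / (s1 ^ 2 * C + 1) with hδ
  have hden : 0 < s1 ^ 2 * C + 1 := by have := F.hC; positivity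
  have hδ0 : 0 < δ := by positivity
  have hδ1 : s1 ^ 2 * (C * δ) ≤ ε := by
    have : δ * (s1 ^ 2 * C + 1) = ε := by rw [hδ]; field_simp
    nlinarith
  set a := min x2 (α + δ) with ha
  set b := max x2 (β - δ) with hbb
  have ha1 : α < a := lt_min hx2.1 (by linarith)
  have hb1 : b < β := max_lt hx2.2 (by linarith)
  have hax : a ≤ x2 := min_le_left _ _
  have hbx : x2 ≤ b := le_max_left _ _
  have hin : ∀ x ∈ Icc a b, x ∈ Ioo α β := fun x hx => ⟨ha1.trans_le hx.1, hx.2.trans_lt hb1⟩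
  have key := maxprin (X := ℝ) (K := Icc a b) isCompact_Icc (a := 0) (b := s1) (ε := ε)
    (D := fun s x => W (θ0 + s ^ 2) x - Wf V0 H0 s x)
    (by
      refine ContinuousOn.sub ?_ ?_
      · refine D.wc.comp (by fun_prop : Continuous fun p : ℝ × ℝ => (θ0 + p.1 ^ 2, p.2)).continuousOn ?_
        intro p hp
        exact ⟨trivial, hα.trans (hin p.2 hp.2).1⟩
      · exact fun p hp => (F.W_cont p.1 (hin p.2 hp.2)).continuousWithinAt)
    (by
      intro x hx
      have := hinit x (hin x hx)
      simp only [ne_eq, OfNat.ofNat_ne_zero, not_false_eq_true, zero_pow, add_zero]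
      linarith)
    (by
      intro s hs x hx hpos hmax
      have hx0 : 0 < x := hα.trans (hin x hx).1
      have hxa : x ≠ a := by
        intro h
        have := hb x (hin x hx) (C * δ) (fun s => (rl s x (hin x hx)).trans (by
          refine mul_le_mul_of_nonneg_left ?_ F.hC
          rw [h]
          linarith [min_le_right x2 (α + δ)])) s ⟨hs.1.le, hs.2⟩
        linarith
      have hxb : x ≠ b := by
        intro h
        have := hb x (hin x hx) (C * δ) (fun s => (rr s x (hin x hx)).trans (by
          refine mul_le_mul_of_nonneg_left ?_ F.hC
          rw [h]
          linarith [le_max_right x2 (β - δ)])) s ⟨hs.1.le, hs.2⟩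
        linarith
      have hxin : x ∈ Ioo a b := ⟨lt_of_le_of_ne hx.1 (Ne.symm hxa), lt_of_le_of_ne hx.2 hxb⟩
      have hs2 : s ^ 2 ≤ s1 ^ 2 := pow_le_pow_left₀ hs.1.le hs.2 2
      have hs2' : 0 < s ^ 2 := pow_pos hs.1 2
      have hθ : θ0 + s ^ 2 ∈ Icc 0 Θ := ⟨by linarith, by linarith⟩
      have hloc : IsLocalMax (fun z => W (θ0 + s ^ 2) z - Wf V0 H0 s z) x := by
        filter_upwards [Icc_mem_nhds hxin.1 hxin.2] with z hz
        exact hmax z hz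
      have h2 := sdt hloc (g := fun z => Y (θ0 + s ^ 2) z - Yf H0 s z) (by
        filter_upwards [Ioo_mem_nhds hxin.1 hxin.2] with z hz
        have hz' := hin z ⟨hz.1.le, hz.2.le⟩
        exact (D.wx _ hθ z (hα.trans hz'.1)).sub (F.W_x s hz'))
        ((D.yx _ hθ x hx0).sub (F.Y_x s (hin x hx)))
      refine ⟨_, ?_, ((D.wts θ0 s x).sub (F.W_s s (hin x hx))).hasDerivWithinAt⟩
      have hle : rf H0 h0 s x ≤ P (θ0 + s ^ 2) x :=
        (one_div_le_one_div (D.pos _ _ hx0) (F.r_pos s x)).1 (by linarith)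
      nlinarith [hs.1])
  have := key s2 hs2 x2 ⟨hax, hbx⟩
  linarith

/-- Lemma Sub -/
lemma Wd.sub (D : Wd Θ P Px W Y) {S : Finset ℝ} {α β : ℝ} (hα : α ∈ S) (hβ : β ∈ S)
    (hαβ : α < β) (hS0 : ∀ x ∈ S, 0 < x) {θ0 s y C : ℝ} (hθ0 : 0 ≤ θ0) (hs : 0 ≤ s) (hθ1 : θ0 + s ^ 2 ≤ Θ)
    (hC : ∀ x, 0 < x → x * y - W (θ0 + s ^ 2) x ≤ C) :
    Ga (fun y => S.sup' ⟨α, hα⟩ fun x => x * y - W θ0 x) s y ≤ C := by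
  classical
  have hne : S.Nonempty := ⟨α, hα⟩
  set a := S.min' hne with ha
  set b := S.max' hne with hb
  have haS : a ∈ S := S.min'_mem hne
  have hbS : b ∈ S := S.max'_mem hne
  have hab : a < b := lt_of_le_of_lt (S.min'_le α hα) (lt_of_lt_of_le hαβ (S.le_max' β hβ))
  have hSI : ∀ x ∈ S, x ∈ Icc a b := fun x hx => ⟨S.min'_le x hx, S.le_max' x hx⟩
  set n : ℝ := (S.card : ℝ) with hn
  have hn0 : 0 < n := by simpa [hn] using hne
  have hn1 : 1 ≤ n := by
    rw [hn]; exact_mod_cast Finset.one_le_card.2 hne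
  set m : ℝ → ℝ := fun y => S.sup' ⟨α, hα⟩ fun x => x * y - W θ0 x with hm
  have key : ∀ κ > 0, Ga m s y ≤ C + κ * Real.log n := by
    intro κ hκ
    obtain ⟨V0, H0, h0, k0, C', F, hV0, hin, hl, hr⟩ := lse (S := S) (c := fun x => Real.exp (-W θ0 x / κ) / n)
      hκ (fun x => by positivity) haS hbS hab hSI
    have hMo : ∀ y, Mo S (fun x => Real.exp (-W θ0 x / κ) / n) κ 0 y =
        (∑ x ∈ S, Real.exp ((x * y - W θ0 x) / κ)) / n := fun y => by
      unfold Mo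
      rw [Finset.sum_div]
      refine Finset.sum_congr rfl fun x _ => ?_
      have : (x * y - W θ0 x) / κ = -W θ0 x / κ + x * y / κ := by ring
      rw [this, Real.exp_add]
      ring
    have hsum : ∀ y, 0 < ∑ x ∈ S, Real.exp ((x * y - W θ0 x) / κ) := fun y =>
      Finset.sum_pos (fun x _ => Real.exp_pos _) hne
    have hVle : ∀ y B, (∀ z, 0 < z → z * y - W θ0 z ≤ B) → V0 y ≤ B := fun y B hB => by
      rw [hV0, hMo]
      have : (∑ x ∈ S, Real.exp ((x * y - W θ0 x) / κ)) / n ≤ Real.exp (B / κ) := by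
        rw [div_le_iff₀ hn0]
        calc _ ≤ ∑ x ∈ S, Real.exp (B / κ) := Finset.sum_le_sum fun x hx => by
              have := hB x (hS0 x hx)
              gcongr
          _ = Real.exp (B / κ) * n := by simp [hn, mul_comm]
      have h2 := Real.log_le_log (div_pos (hsum y) hn0) this
      rw [Real.log_exp] at h2
      have h3 := mul_le_mul_of_nonneg_left h2 hκ.le
      have : κ * (B / κ) = B := by field_simp
      linarith
    have hcmp := D.sub_flow F (hS0 a haS) hl hr hθ0 hθ1 hVle s ⟨hs, le_rfl⟩
    have hHin : Ga H0 s y ∈ Ioo a b := by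
      have egc : ∀ c : ℝ, EG (fun _ : ℝ => c) := fun c =>
        ⟨continuous_const, |c|, 0, abs_nonneg _, le_rfl, fun y => by simp⟩
      have Gc : ∀ c : ℝ, Ga (fun _ => c) s y = c := fun c => by simp [Ga]
      have hsub : ∀ p q : ℝ → ℝ, EG p → EG q → EG (fun y => p y - q y) → Ga (fun y => p y - q y) s y = Ga p s y - Ga q s y :=
        fun p q hp hq _ => MeasureTheory.integral_sub (hp.integrable s y) (hq.integrable s y)
      have e1 : EG (fun y => H0 y - a) := F.egh.antideriv fun y => (F.dH y).sub_const a
      have e2 : EG (fun y => b - H0 y) := (F.egh.const_mul (-1)).antideriv fun y => ((F.dH y).const_sub b).congr_deriv (by ring)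
      have p1 := Ga_pos e1 (fun y => by linarith [(hin y).1]) s y
      have p2 := Ga_pos e2 (fun y => by linarith [(hin y).2]) s y
      rw [hsub _ _ F.egH (egc a) e1, Gc] at p1
      rw [hsub _ _ (egc b) F.egH e2, Gc] at p2
      exact ⟨by linarith, by linarith⟩
    have h1 := hcmp _ hHin
    have h2 := hC _ ((hS0 a haS).trans hHin.1)
    have h3 : Ga V0 s y ≤ C := by
      unfold Wf at h1
      rw [F.Y_H] at h1
      linarith
    have hmV : ∀ y, m y ≤ V0 y + κ * Real.log n := fun y => by
      simp only [hm]
      refine Finset.sup'_le _ _ fun x hx => ?_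
      rw [hV0, hMo, Real.log_div (hsum y).ne' hn0.ne']
      have h4 : Real.exp ((x * y - W θ0 x) / κ) ≤ ∑ x ∈ S, Real.exp ((x * y - W θ0 x) / κ) :=
        Finset.single_le_sum (f := fun x => Real.exp ((x * y - W θ0 x) / κ)) (fun x _ => (Real.exp_pos _).le) hx
      have h5 := Real.log_le_log (Real.exp_pos _) h4
      rw [Real.log_exp, div_le_iff₀ hκ] at h5
      linarith
    have egm : EG m := by
      obtain ⟨hVc, A, B, hA, hB, hVb⟩ := F.egV
      refine ⟨?_, A + κ * Real.log n + |W θ0 α| + |α|, B + 1, ?_, by linarith, fun y => ?_⟩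
      · simp only [hm]
        exact Continuous.finset_sup'_apply _ fun x _ => by fun_prop
      · have := Real.log_nonneg hn1
        positivity
      · have hl1 : α * y - W θ0 α ≤ m y := Finset.le_sup' (fun x => x * y - W θ0 x) hα
        have hlog := Real.log_nonneg hn1
        have e1 : 1 ≤ Real.exp ((B + 1) * |y|) := Real.one_le_exp (by positivity)
        have e2 : |y| ≤ Real.exp ((B + 1) * |y|) := (abs_le_exp_abs y).trans
          (Real.exp_le_exp.2 (by nlinarith [abs_nonneg y]))
        have e3 : Real.exp (B * |y|) ≤ Real.exp ((B + 1) * |y|) := Real.exp_le_exp.2 (by nlinarith [abs_nonneg y])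
        have e4 := mul_le_mul_of_nonneg_left e3 hA
        have e5 := mul_le_mul_of_nonneg_left e1 (mul_nonneg hκ.le hlog)
        have e6 := mul_le_mul_of_nonneg_left e1 (abs_nonneg (W θ0 α))
        have e7 := mul_le_mul_of_nonneg_left e2 (abs_nonneg α)
        rw [← abs_mul] at e7
        have := hVb y
        have := hmV y
        have := le_abs_self (V0 y)
        have := neg_abs_le (α * y)
        have := le_abs_self (W θ0 α)
        have := abs_nonneg (α * y)
        have := abs_nonneg (W θ0 α)
        have e8 : 0 ≤ A * Real.exp (B * |y|) := by positivity
        have e9 : 0 ≤ κ * Real.log n := by positivity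
        have e10 : 0 ≤ |α| * Real.exp ((B + 1) * |y|) := by positivity
        rw [abs_le]
        constructor <;> nlinarith
    have egVc : EG (fun y => V0 y + κ * Real.log n) := F.egH.antideriv fun y => (F.dV y).add_const _
    have h6 := Ga_mono egm egVc hmV s y
    have h7 : Ga (fun y => V0 y + κ * Real.log n) s y = Ga V0 s y + κ * Real.log n := by
      unfold Ga
      rw [MeasureTheory.integral_add (F.egV.integrable s y) (MeasureTheory.integrable_const _)]
      simp
    linarith
  refine le_of_forall_pos_le_add fun ε hε => ?_
  have hlog := Real.log_nonneg hn1
  have := key (ε / (Real.log n + 1)) (by positivity)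
  have e : ε / (Real.log n + 1) * Real.log n ≤ ε := by
    rw [div_mul_eq_mul_div, div_le_iff₀ (by positivity)]
    nlinarith
  linarith

end

lemma EG_pp : EG (fun y : ℝ => max y 0) :=
  ⟨by fun_prop, 1, 1, zero_le_one, zero_le_one, fun y => by
    rw [one_mul, one_mul, abs_of_nonneg (le_max_right _ _)]
    exact (max_le (le_abs_self y) (abs_nonneg y)).trans (abs_le_exp_abs y)⟩

lemma tail {S k : ℝ} (hS : 0 < S) (hk : -1 ≤ k) :
    (√(2 * Real.pi))⁻¹ * Real.exp (-(k + 2) ^ 2 / (2 * S ^ 2)) / S ≤ Ga (fun y => max y 0) S (-k) := by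
  unfold Ga
  rw [integral_gam]
  set c := (√(2 * Real.pi))⁻¹ * Real.exp (-(k + 2) ^ 2 / (2 * S ^ 2)) with hc
  have hint := integrable_gam_iff (EG_pp.integrable S (-k))
  set I := Icc ((k + 1) / S) ((k + 2) / S) with hI
  have h1 : ∫ z, I.indicator (fun _ => c) z ≤ ∫ z, phi z * max (-k + S * z) 0 := by
    refine MeasureTheory.integral_mono ?_ hint ?_
    · exact (MeasureTheory.integrable_indicator_iff measurableSet_Icc).2
        (MeasureTheory.integrableOn_const (by simp))
    · intro z
      have hphi : 0 ≤ phi z := by rw [phi_eq]; positivity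
      by_cases hz : z ∈ I
      · simp only [indicator_of_mem hz]
        have hz1 : k + 1 ≤ S * z := by have := hz.1; rw [div_le_iff₀ hS] at this; linarith
        have hz2 : S * z ≤ k + 2 := by have := hz.2; rw [le_div_iff₀ hS] at this; linarith
        have hm : 1 ≤ max (-k + S * z) 0 := le_max_of_le_left (by linarith)
        have hcp : c ≤ phi z := by
          rw [phi_eq, hc]
          have : -(k + 2) ^ 2 / (2 * S ^ 2) ≤ -z ^ 2 / 2 := by
            rw [div_le_div_iff₀ (by positivity) (by norm_num)]
            nlinarith [mul_self_nonneg (S * z)]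
          gcongr
        nlinarith
      · simp only [indicator_of_notMem hz]
        positivity
  rw [MeasureTheory.integral_indicator_const _ measurableSet_Icc] at h1
  refine le_trans (le_of_eq ?_) h1
  rw [MeasureTheory.measureReal_def, Real.volume_Icc, ENNReal.toReal_ofReal, smul_eq_mul]
  · field_simp; ring
  · rw [← sub_div]; exact div_nonneg (by linarith) hS.le

section
variable {Θ : ℝ} {P Px W Y : ℝ → ℝ → ℝ}

lemma Wd.lower (D : Wd Θ P Px W Y) {V0 H0 h0 k0 : ℝ → ℝ} {C : ℝ}
    (F : FL V0 H0 h0 k0 C (Ioi 0)) (hH : ∀ y, 0 < H0 y) (h0W : ∀ x, 0 < x → W 0 x = Wf V0 H0 0 x)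
    {s x : ℝ} (hs : 0 ≤ s) (hsΘ : s ^ 2 ≤ Θ) (hx : 0 < x) : W (s ^ 2) x ≤ Wf V0 H0 s x := by
  classical
  have hθ : s ^ 2 ∈ Icc 0 Θ := ⟨by positivity, hsΘ⟩
  set y := Y (s ^ 2) x with hy
  set S : ℕ → Finset ℝ := fun n => {1, 2} ∪ (Finset.range n).image (fun k => Real.exp (TopologicalSpace.denseSeq ℝ k)) with hS
  have h1S : ∀ n, (1:ℝ) ∈ S n := fun n => by simp [hS]
  have h2S : ∀ n, (2:ℝ) ∈ S n := fun n => by simp [hS]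
  have hS0 : ∀ n, ∀ z ∈ S n, 0 < z := fun n z hz => by
    simp only [hS, Finset.mem_union, Finset.mem_insert, Finset.mem_singleton, Finset.mem_image] at hz
    rcases hz with (h | h) | ⟨k, -, h⟩
    · rw [h]; norm_num
    · rw [h]; norm_num
    · rw [← h]; exact Real.exp_pos _
  have hSm : Monotone S := fun n m hnm => by
    simp only [hS]
    exact Finset.union_subset_union subset_rfl (Finset.image_subset_image (Finset.range_mono hnm))
  set m : ℕ → ℝ → ℝ := fun n v => (S n).sup' ⟨1, h1S n⟩ fun z => z * v - W 0 z with hm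
  have hmle : ∀ n v, m n v ≤ V0 v := fun n v => Finset.sup'_le _ _ fun z hz => by
    have := F.young 0 (show z ∈ Ioi 0 from hS0 n z hz) v
    rw [Ga_zero] at this
    rw [h0W z (hS0 n z hz)]
    exact this
  have hmge : ∀ n, ∀ z ∈ S n, ∀ v, z * v - W 0 z ≤ m n v := fun n z hz v =>
    Finset.le_sup' (fun z => z * v - W 0 z) hz
  have hmc : ∀ n, Continuous (m n) := fun n => Continuous.finset_sup'_apply _ fun x _ => by fun_prop
  have hb : ∀ n, Ga (m n) s y ≤ x * y - W (s ^ 2) x := fun n => by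
    refine D.sub (h1S n) (h2S n) (by norm_num) (hS0 n) le_rfl hs (by linarith) (fun z hz => ?_)
    rw [zero_add]
    exact D.conv hθ hx hz
  have egl : EG (fun v => 1 * v - W 0 1) := by
    have : EG (fun _ : ℝ => (1:ℝ)) := ⟨continuous_const, 1, 0, zero_le_one, le_rfl, fun y => by simp⟩
    exact this.antideriv fun y => (((hasDerivAt_id y).const_mul 1).sub_const _).congr_deriv (by simp)
  have hmi : ∀ n, MeasureTheory.Integrable (fun z => m n (y + s * z)) gam := fun n => by
    refine MeasureTheory.Integrable.mono' (((F.egV.integrable s y).abs).add ((egl.integrable s y).abs))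
      ((hmc n).comp (by fun_prop)).aestronglyMeasurable (Filter.Eventually.of_forall fun z => ?_)
    have a1 := hmle n (y + s * z)
    have a2 := hmge n 1 (h1S n) (y + s * z)
    simp only [Real.norm_eq_abs, Pi.add_apply]
    rw [abs_le]
    constructor
    · linarith [neg_abs_le (1 * (y + s * z) - W 0 1), abs_nonneg (V0 (y + s * z))]
    · linarith [le_abs_self (V0 (y + s * z)), abs_nonneg (1 * (y + s * z) - W 0 1)]
  have hlim : ∀ v, Filter.Tendsto (fun n => m n v) Filter.atTop (nhds (V0 v)) := fun v => by
    rw [Metric.tendsto_atTop]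
    intro ε hε
    have hx0 := hH v
    have hYv : Yf H0 0 (H0 v) = v := by have := F.Y_H 0 v; rwa [Ga_zero] at this
    have e0 : H0 v * v - W 0 (H0 v) = V0 v := by
      rw [h0W _ hx0]; unfold Wf; rw [hYv, Ga_zero]; ring
    have hc : ContinuousAt (fun t => Real.exp t * v - W 0 (Real.exp t)) (Real.log (H0 v)) := by
      refine ContinuousAt.sub (by fun_prop) ?_
      refine ContinuousAt.comp (g := W 0) ?_ Real.continuous_exp.continuousAt
      rw [Real.exp_log hx0]
      exact (D.wx 0 ⟨le_rfl, D.hΘ.le⟩ _ hx0).continuousAt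
    have hev := (Metric.continuousAt_iff.1 hc) ε hε
    obtain ⟨δ, hδ, hev⟩ := hev
    obtain ⟨k, hk⟩ := (TopologicalSpace.denseRange_denseSeq ℝ).exists_dist_lt (Real.log (H0 v)) hδ
    have hk2 := hev (by rw [dist_comm]; exact hk)
    rw [Real.exp_log hx0, e0, Real.dist_eq] at hk2
    refine ⟨k + 1, fun n hn => ?_⟩
    have a1 := hmge n (Real.exp (TopologicalSpace.denseSeq ℝ k)) (by
      simp only [hS, Finset.mem_union, Finset.mem_image]
      exact Or.inr ⟨k, Finset.mem_range.2 (by omega), rfl⟩) v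
    have a2 := hmle n v
    rw [Real.dist_eq, abs_lt]
    have := (abs_lt.1 hk2).1
    constructor <;> linarith
  have hT := MeasureTheory.integral_tendsto_of_tendsto_of_monotone hmi (F.egV.integrable s y)
    (Filter.Eventually.of_forall fun z n k hnk => by
      exact Finset.sup'_mono _ (hSm hnk) _)
    (Filter.Eventually.of_forall fun z => hlim (y + s * z))
  have hfin : Ga V0 s y ≤ x * y - W (s ^ 2) x := le_of_tendsto hT (Filter.Eventually.of_forall hb)
  have := F.young s (show x ∈ Ioi 0 from hx) y
  linarith

/-- Growth estimate, from two slopes. -/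
lemma Wd.grow (D : Wd Θ P Px W Y) {θ L : ℝ} (hθ : 0 ≤ θ) (hθ' : θ < Θ) (hL : 1 < L) :
    (L - 1) * Ga (fun y => max y 0) (√(Θ - θ)) (-((W θ L - W θ 1) / (L - 1) - Y Θ 1)) ≤ W 0 1 - W Θ 1 := by
  set q := (W θ L - W θ 1) / (L - 1) with hq
  have hqe : (L - 1) * q = W θ L - W θ 1 := by rw [hq]; field_simp [show L - 1 ≠ 0 by linarith]
  have hsq : √(Θ - θ) ^ 2 = Θ - θ := Real.sq_sqrt (by linarith)
  set S := √(Θ - θ) with hS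
  have hθS : θ + S ^ 2 = Θ := by rw [hsq]; ring
  have h := D.sub (S := {1, L}) (α := 1) (β := L) (by simp) (by simp) hL (by
    intro z hz
    simp only [Finset.mem_insert, Finset.mem_singleton] at hz
    rcases hz with h | h <;> rw [h] <;> linarith) hθ (Real.sqrt_nonneg _) (hθS.le) (y := Y Θ 1)
    (C := 1 * Y Θ 1 - W Θ 1) (fun z hz => by
      rw [← hS, hθS]
      exact D.conv ⟨D.hΘ.le, le_rfl⟩ one_pos hz)
  have e : (fun v => ({1, L} : Finset ℝ).sup' ⟨1, by simp⟩ fun x => x * v - W θ x) =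
      fun v => (1 * v + -W θ 1) + (L - 1) * max (v - q) 0 := by
    funext v
    have e1 : ({1, L} : Finset ℝ).sup' ⟨1, by simp⟩ (fun x => x * v - W θ x) = max (1 * v - W θ 1) (L * v - W θ L) := by
      rw [Finset.sup'_insert (Finset.singleton_nonempty L)]; simp
    rw [e1]
    rcases le_total v q with hv | hv
    · rw [max_eq_right (by linarith : v - q ≤ 0), max_eq_left]
      · ring
      · nlinarith
    · rw [max_eq_left (by linarith : 0 ≤ v - q), max_eq_right]
      · linarith
      · nlinarith
  rw [e] at h
  have e2 : Ga (fun v => (1 * v + -W θ 1) + (L - 1) * max (v - q) 0) S (Y Θ 1) =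
      (1 * Y Θ 1 + -W θ 1) + (L - 1) * Ga (fun y => max y 0) S (-(q - Y Θ 1)) := by
    have i1 : MeasureTheory.Integrable (fun z => 1 * (Y Θ 1 + S * z) + -W θ 1) gam := by
      have egl : EG (fun v => 1 * v + - W θ 1) := by
        have : EG (fun _ : ℝ => (1:ℝ)) := ⟨continuous_const, 1, 0, zero_le_one, le_rfl, fun y => by simp⟩
        exact this.antideriv fun y => (((hasDerivAt_id y).const_mul 1).add_const _).congr_deriv (by simp)
      exact egl.integrable S _
    have i2 := (EG_pp.integrable S (-(q - Y Θ 1))).const_mul (L - 1)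
    have l := Ga_linear 1 (-W θ 1) S (Y Θ 1)
    unfold Ga at l ⊢
    rw [← l, ← MeasureTheory.integral_const_mul, ← MeasureTheory.integral_add i1 i2]
    congr 1
    funext z
    beta_reduce
    rw [show Y Θ 1 + S * z - q = -(q - Y Θ 1) + S * z by ring]
  rw [e2] at h
  have := D.anti one_pos hθ
  simp only at this
  linarith

end

/-- Tychonoff barrier -/
noncomputable def Ups (Θ' θ y : ℝ) : ℝ := (√(Θ' - θ))⁻¹ * Real.exp (y ^ 2 / (2 * (Θ' - θ)))

lemma Ups_pos {Θ' θ y : ℝ} (h : θ < Θ') : 0 < Ups Θ' θ y := by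
  unfold Ups
  have : 0 < √(Θ' - θ) := Real.sqrt_pos.2 (by linarith)
  positivity

lemma Ups_ge {Θ' θ y : ℝ} (h : θ < Θ') (h0 : 0 ≤ θ) : (√Θ')⁻¹ * Real.exp (y ^ 2 / (2 * Θ')) ≤ Ups Θ' θ y := by
  unfold Ups
  have h1 : 0 < √(Θ' - θ) := Real.sqrt_pos.2 (by linarith)
  have h2 : √(Θ' - θ) ≤ √Θ' := Real.sqrt_le_sqrt (by linarith)
  have h3 : y ^ 2 / (2 * Θ') ≤ y ^ 2 / (2 * (Θ' - θ)) :=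
    div_le_div_of_nonneg_left (sq_nonneg y) (by linarith) (by linarith)
  gcongr

lemma quad {A B E : ℝ} (hA : 0 < A) (hB : 0 ≤ B) (hE : 0 ≤ E) {y : ℝ} (h1 : 1 ≤ y) (h2 : (B + E) / A ≤ y) :
    B * y + E ≤ A * y ^ 2 := by
  rw [div_le_iff₀ hA] at h2
  nlinarith

lemma beat {Θ Θ' Θ2 C2 b ε : ℝ} (h2 : Θ2 < Θ') (h1 : Θ' < Θ) (h0 : 0 < Θ2) (hC : 0 < C2) (hε : 0 < ε) :
    ∃ Y0 : ℝ, ∀ y, Y0 ≤ y → ∀ θ ∈ Icc 0 Θ2, C2 * Real.exp (y + (y + b) ^ 2 / (2 * (Θ - θ))) ≤ ε * Ups Θ' θ y := by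
  have hΘ' : 0 < √Θ' := Real.sqrt_pos.2 (by linarith)
  set E := |Real.log (C2 * √Θ' / ε)| + b ^ 2 / (2 * (Θ - Θ2)) with hE
  set B := 1 + |b| / (Θ - Θ2) with hB
  set A := (Θ - Θ') / (2 * Θ ^ 2) with hA
  have t0 : 0 < Θ - Θ2 := by linarith
  have hA0 : 0 < A := div_pos (by linarith) (by have : 0 < Θ := by linarith
                                                positivity)
  have hB0 : 0 ≤ B := by positivity
  have hE0 : 0 ≤ E := by positivity
  refine ⟨max 1 ((B + E) / A), fun y hy θ hθ => ?_⟩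
  have hy1 : 1 ≤ y := (le_max_left _ _).trans hy
  have hq := quad hA0 hB0 hE0 hy1 ((le_max_right _ _).trans hy)
  have ht : 0 < Θ - θ := by linarith [hθ.2]
  have ht' : 0 < Θ' - θ := by linarith [hθ.2]
  have key : Real.log (C2 * √Θ' / ε) + (y + (y + b) ^ 2 / (2 * (Θ - θ))) ≤ y ^ 2 / (2 * (Θ' - θ)) := by
    have e1 : y ^ 2 / (2 * (Θ' - θ)) - (y + b) ^ 2 / (2 * (Θ - θ)) =
        y ^ 2 * ((Θ - Θ') / (2 * (Θ - θ) * (Θ' - θ))) - (b * y / (Θ - θ) + b ^ 2 / (2 * (Θ - θ))) := by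
      field_simp
      ring
    have e2 : A ≤ (Θ - Θ') / (2 * (Θ - θ) * (Θ' - θ)) := by
      rw [hA]
      refine div_le_div_of_nonneg_left (by linarith) (by positivity) ?_
      nlinarith [hθ.1]
    have e3 : b * y / (Θ - θ) ≤ |b| / (Θ - Θ2) * y := by
      rw [div_mul_eq_mul_div]
      calc b * y / (Θ - θ) ≤ |b| * y / (Θ - θ) := by
            gcongr; exact le_abs_self b
        _ ≤ |b| * y / (Θ - Θ2) := div_le_div_of_nonneg_left (by positivity) t0 (by linarith [hθ.2])
    have e4 : b ^ 2 / (2 * (Θ - θ)) ≤ b ^ 2 / (2 * (Θ - Θ2)) :=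
      div_le_div_of_nonneg_left (sq_nonneg b) (by linarith) (by linarith [hθ.2])
    have e5 := mul_le_mul_of_nonneg_left e2 (sq_nonneg y)
    have e6 := le_abs_self (Real.log (C2 * √Θ' / ε))
    have e7 : B * y = y + |b| / (Θ - Θ2) * y := by rw [hB]; ring
    linarith
  have hpos : 0 < C2 * √Θ' / ε := by positivity
  have h3 := Real.exp_le_exp.2 key
  rw [Real.exp_add, Real.exp_log hpos] at h3
  have h4 : (√Θ')⁻¹ ≤ (√(Θ' - θ))⁻¹ := by
    have : 0 < √(Θ' - θ) := Real.sqrt_pos.2 ht'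
    exact inv_anti₀ this (Real.sqrt_le_sqrt (by linarith [hθ.1]))
  unfold Ups
  calc C2 * Real.exp (y + (y + b) ^ 2 / (2 * (Θ - θ))) =
        ε * ((√Θ')⁻¹ * (C2 * √Θ' / ε * Real.exp (y + (y + b) ^ 2 / (2 * (Θ - θ))))) := by field_simp
    _ ≤ ε * ((√(Θ' - θ))⁻¹ * Real.exp (y ^ 2 / (2 * (Θ' - θ)))) := by gcongr

section
variable {Θ : ℝ} {P Px W Y : ℝ → ℝ → ℝ}

lemma FL.V_ge {V0 H0 h0 k0 : ℝ → ℝ} {C : ℝ} {I : Set ℝ}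
    (F : FL V0 H0 h0 k0 C I) {s : ℝ} (hs : 0 ≤ s) (y : ℝ) : V0 y ≤ Ga V0 s y := by
  have hd : ∀ s, HasDerivAt (fun s => Ga V0 s y) (s * Ga h0 s y) s := fun s => by
    have := Ga_hasDerivAt_s F.egV F.egH F.dV s y
    rwa [stein F.egH F.egh F.dH] at this
  have hm : MonotoneOn (fun s => Ga V0 s y) (Ici 0) := by
    refine monotoneOn_of_deriv_nonneg (convex_Ici 0) ?_ ?_ ?_
    · exact fun s _ => (hd s).continuousAt.continuousWithinAt
    · exact fun s _ => (hd s).differentiableAt.differentiableWithinAt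
    · intro s hs
      rw [(hd s).deriv]
      exact mul_nonneg (interior_subset hs) (F.Bpos s y).le
  have := hm (mem_Ici.2 le_rfl) hs hs
  simpa [Ga_zero] using this

lemma Wd.atL (D : Wd Θ P Px W Y) {V0 H0 h0 k0 : ℝ → ℝ} {C : ℝ}
    (F : FL V0 H0 h0 k0 C (Ioi 0)) (h0W : ∀ x, 0 < x → W 0 x = Wf V0 H0 0 x)
    {Θ' Θ2 ε : ℝ} (h2 : Θ2 < Θ') (h1 : Θ' < Θ) (h0 : 0 < Θ2) (hε : 0 < ε) (L1 : ℝ) :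
    ∃ L, L1 ≤ L ∧ 1 < L ∧ ∀ s, 0 ≤ s → s ^ 2 ≤ Θ2 → ∀ y, L * y - W (s ^ 2) L - Ga V0 s y ≤ ε * Ups Θ' (s ^ 2) y := by
  set C1 := W 0 1 - W Θ 1 with hC1
  have hC10 : 0 ≤ C1 := by have := D.anti one_pos D.hΘ.le; simp only at this; linarith
  set ys := Y Θ 1 with hys
  have hΘ : 0 < Θ := D.hΘ
  have sΘ : 0 < √Θ := Real.sqrt_pos.2 hΘ
  have spi : 0 < √(2 * Real.pi) := Real.sqrt_pos.2 (by positivity)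
  set C2 := (C1 + 1) * √(2 * Real.pi) * √Θ with hC2
  have hC20 : 0 < C2 := by positivity
  obtain ⟨Y0, hY0⟩ := beat (b := 2 - ys) h2 h1 h0 hC20 hε
  set B := max (W 0 2 - W Θ 1) 0 with hB
  set Q := max (max (B + 1) (ys - 1)) (max Y0 0) with hQ
  have hQ1 : B + 1 ≤ Q := (le_max_left _ _).trans (le_max_left _ _)
  have hQ2 : ys - 1 ≤ Q := (le_max_right _ _).trans (le_max_left _ _)
  have hQ3 : Y0 ≤ Q := (le_max_left _ _).trans (le_max_right _ _)
  have hQ4 : 0 ≤ Q := (le_max_right _ _).trans (le_max_right _ _)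
  set E := Real.exp ((Q - ys + 2) ^ 2 / (2 * (Θ - Θ2))) with hE
  have hE0 : 0 < E := Real.exp_pos _
  set L := max L1 (max 2 (C1 + 2 + C2 * E)) with hL
  have hL1 : 2 ≤ L := (le_max_left _ _).trans (le_max_right _ _)
  have hL2 : C1 + 2 + C2 * E ≤ L := (le_max_right _ _).trans (le_max_right _ _)
  have hCE : 0 < C2 * E := by positivity
  refine ⟨L, le_max_left _ _, by linarith, fun s hs hsθ y => ?_⟩
  have hθ : s ^ 2 ∈ Icc 0 Θ2 := ⟨by positivity, hsθ⟩
  set θ := s ^ 2 with hθd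
  have hg := D.grow hθ.1 (by linarith : θ < Θ) (by linarith : 1 < L)
  set q := (W θ L - W θ 1) / (L - 1) with hq
  have hqe : (L - 1) * q = W θ L - W θ 1 := by rw [hq]; field_simp [show L - 1 ≠ 0 by linarith]
  have hS : 0 < √(Θ - θ) := Real.sqrt_pos.2 (by linarith)
  have hSsq : √(Θ - θ) ^ 2 = Θ - θ := Real.sq_sqrt (by linarith)
  have hSle : √(Θ - θ) ≤ √Θ := Real.sqrt_le_sqrt (by linarith [hθ.1])
  -- consequence of the tail estimate
  have hcons : ∀ k, -1 ≤ k → (L - 1) * Ga (fun y => max y 0) (√(Θ - θ)) (-k) ≤ C1 →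
      L - 1 ≤ C2 * Real.exp ((k + 2) ^ 2 / (2 * (Θ - θ))) := fun k hk hh => by
    have ht := tail hS hk
    rw [hSsq] at ht
    have hL0 : 0 ≤ L - 1 := by linarith
    have h5 := (mul_le_mul_of_nonneg_left ht hL0).trans hh
    have h6 : Real.exp (-(k + 2) ^ 2 / (2 * (Θ - θ))) = (Real.exp ((k + 2) ^ 2 / (2 * (Θ - θ))))⁻¹ := by
      rw [← Real.exp_neg]; congr 1; ring
    rw [h6] at h5
    set X := Real.exp ((k + 2) ^ 2 / (2 * (Θ - θ))) with hX
    have hX0 : 0 < X := Real.exp_pos _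
    have e : (L - 1) * ((√(2 * Real.pi))⁻¹ * X⁻¹ / √(Θ - θ)) = (L - 1) / (√(2 * Real.pi) * X * √(Θ - θ)) := by
      field_simp
    rw [e, div_le_iff₀ (by positivity)] at h5
    calc L - 1 ≤ C1 * (√(2 * Real.pi) * X * √(Θ - θ)) := h5
      _ ≤ (C1 + 1) * (√(2 * Real.pi) * X * √Θ) := by gcongr; linarith
      _ = C2 * X := by rw [hC2]; ring
  have hQq : Q ≤ q := by
    by_contra hcon
    push Not at hcon
    have hmono : Ga (fun y => max y 0) (√(Θ - θ)) (-(Q - ys)) ≤ Ga (fun y => max y 0) (√(Θ - θ)) (-(q - ys)) := by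
      refine MeasureTheory.integral_mono (EG_pp.integrable _ _) (EG_pp.integrable _ _) fun z => ?_
      exact max_le_max (by linarith) le_rfl
    have h5 := hcons (Q - ys) (by linarith) ((mul_le_mul_of_nonneg_left hmono (by linarith)).trans hg)
    have h6 : Real.exp ((Q - ys + 2) ^ 2 / (2 * (Θ - θ))) ≤ E := by
      rw [hE]
      refine Real.exp_le_exp.2 (div_le_div_of_nonneg_left (sq_nonneg _) (by linarith) (by linarith [hθ.2]))
    have h7 := mul_le_mul_of_nonneg_left h6 hC20.le
    linarith
  have hV := F.V_ge hs y
  have v1 := F.young 0 (mem_Ioi.2 one_pos) y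
  have v2 := F.young 0 (mem_Ioi.2 two_pos) y
  rw [Ga_zero, ← h0W 1 one_pos] at v1
  rw [Ga_zero, ← h0W 2 two_pos] at v2
  have hW1 := D.anti one_pos (by linarith [hθ.2] : θ ≤ Θ)
  simp only at hW1
  have hU := Ups_pos (y := y) (by linarith [hθ.2] : θ < Θ')
  have hBl := le_max_left (W 0 2 - W Θ 1) 0
  have hB0 := le_max_right (W 0 2 - W Θ 1) 0
  rw [← hB] at hBl hB0
  have hεU : 0 < ε * Ups Θ' θ y := by positivity
  have e0 : L * y - W θ L - Ga V0 s y = (L - 1) * (y - q) + (y - W θ 1 - Ga V0 s y) := by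
    linarith
  rw [e0]
  rcases lt_or_ge y B with hy | hy
  · have : (L - 1) * (y - q) ≤ (L - 1) * (-1) := mul_le_mul_of_nonneg_left (by linarith) (by linarith)
    linarith
  · rcases le_or_gt y q with hyq | hyq
    · have : (L - 1) * (y - q) ≤ 0 := mul_nonpos_of_nonneg_of_nonpos (by linarith) (by linarith)
      linarith
    · have hk := hcons (q - ys) (by linarith) hg
      have hk2 : Real.exp ((q - ys + 2) ^ 2 / (2 * (Θ - θ))) ≤ Real.exp ((y + (2 - ys)) ^ 2 / (2 * (Θ - θ))) := by
        have : 0 < Θ - θ := by linarith [hθ.2]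
        refine Real.exp_le_exp.2 (div_le_div_of_nonneg_right ?_ (by linarith))
        exact pow_le_pow_left₀ (by linarith) (by linarith) 2
      have hb := hY0 y (by linarith) θ hθ
      have hye : y - q ≤ Real.exp y := by
        have := Real.add_one_le_exp y
        linarith
      have : (L - 1) * (y - q) ≤ C2 * Real.exp (y + (y + (2 - ys)) ^ 2 / (2 * (Θ - θ))) := by
        rw [Real.exp_add]
        calc (L - 1) * (y - q) ≤ (C2 * Real.exp ((y + (2 - ys)) ^ 2 / (2 * (Θ - θ)))) * Real.exp y := by
              refine mul_le_mul (hk.trans ?_) hye (by linarith) (by positivity)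
              exact mul_le_mul_of_nonneg_left hk2 hC20.le
          _ = _ := by ring
      linarith

end

lemma Ups_y {Θ' θ : ℝ} (h : θ < Θ') (y : ℝ) :
    HasDerivAt (Ups Θ' θ) (y / (Θ' - θ) * Ups Θ' θ y) y := by
  have ht : Θ' - θ ≠ 0 := by linarith
  have h1 : HasDerivAt (fun y : ℝ => y ^ 2 / (2 * (Θ' - θ))) (2 * y / (2 * (Θ' - θ))) y :=
    ((hasDerivAt_pow 2 y).div_const _).congr_deriv (by simp)
  refine ((h1.exp).const_mul ((√(Θ' - θ))⁻¹)).congr_deriv ?_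
  unfold Ups
  field_simp

lemma Ups_yy {Θ' θ : ℝ} (h : θ < Θ') (y : ℝ) :
    HasDerivAt (fun y => y / (Θ' - θ) * Ups Θ' θ y)
      ((1 / (Θ' - θ) + y ^ 2 / (Θ' - θ) ^ 2) * Ups Θ' θ y) y := by
  have ht : Θ' - θ ≠ 0 := by linarith
  refine (((hasDerivAt_id y).div_const (Θ' - θ)).mul (Ups_y h y)).congr_deriv ?_
  simp only [id]
  field_simp

lemma Ups_s {Θ' s : ℝ} (h : s ^ 2 < Θ') (y : ℝ) :
    HasDerivAt (fun s => Ups Θ' (s ^ 2) y)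
      (s * ((1 / (Θ' - s ^ 2) + y ^ 2 / (Θ' - s ^ 2) ^ 2) * Ups Θ' (s ^ 2) y)) s := by
  have ht : 0 < Θ' - s ^ 2 := by linarith
  have hq : 0 < √(Θ' - s ^ 2) := Real.sqrt_pos.2 ht
  have h0 : HasDerivAt (fun s : ℝ => Θ' - s ^ 2) (-(2 * s)) s :=
    ((hasDerivAt_pow 2 s).const_sub Θ').congr_deriv (by simp)
  have h1 := (h0.sqrt ht.ne').inv hq.ne'
  have h2 := ((hasDerivAt_const s (y ^ 2)).div (h0.const_mul 2) (by positivity)).exp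
  refine (h1.mul h2).congr_deriv ?_
  unfold Ups
  simp only [Pi.inv_apply, Pi.div_apply]
  have hsq : Θ' - s ^ 2 = √(Θ' - s ^ 2) ^ 2 := (Real.sq_sqrt ht.le).symm
  set q := √(Θ' - s ^ 2)
  rw [hsq]
  field_simp
  ring

lemma Ups_cont {Θ' Θ2 : ℝ} (h : Θ2 < Θ') :
    ContinuousOn (fun p : ℝ × ℝ => Ups Θ' p.1 p.2) (Iic Θ2 ×ˢ univ) := by
  unfold Ups
  have h0 : ∀ p ∈ Iic Θ2 ×ˢ (univ : Set ℝ), 0 < Θ' - p.1 := fun p hp => by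
    have := hp.1
    simp only [mem_Iic] at this
    linarith
  refine ContinuousOn.mul (ContinuousOn.inv₀ (by fun_prop) fun p hp => (Real.sqrt_pos.2 (h0 p hp)).ne') ?_
  refine Real.continuous_exp.comp_continuousOn (ContinuousOn.div (by fun_prop) (by fun_prop) fun p hp => ?_)
  have := h0 p hp
  positivity

section
variable {Θ : ℝ} {P Px W Y : ℝ → ℝ → ℝ}

lemma Sol.small (S : Sol Θ P Px) {η : ℝ} (hη : 0 < η) :
    ∃ a0 > 0, ∀ a, 0 < a → a ≤ a0 → ∀ σ ∈ Icc 0 Θ, P σ a ≤ η := by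
  have hu := (isCompact_Icc (a := (0:ℝ)) (b := Θ)).prod (isCompact_Icc (a := (0:ℝ)) (b := 1))
    |>.uniformContinuousOn_of_continuous S.cont.continuousOn
  rw [Metric.uniformContinuousOn_iff] at hu
  obtain ⟨δ, hδ, hu⟩ := hu η hη
  refine ⟨min 1 (δ / 2), by positivity, fun a ha ha0 σ hσ => ?_⟩
  have h1 := ha0.trans (min_le_left _ _)
  have h2 := ha0.trans (min_le_right _ _)
  have := hu (σ, a) ⟨hσ, ha.le, h1⟩ (σ, 0) ⟨hσ, le_rfl, zero_le_one⟩ (by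
    rw [Prod.dist_eq]
    simp only [dist_self, Real.dist_eq, sub_zero, abs_of_pos ha]
    rw [max_eq_right ha.le]
    linarith)
  simp only [S.zero, Real.dist_eq, sub_zero] at this
  exact (le_abs_self _).trans this.le

lemma Wd.inter (D : Wd Θ P Px W Y) {V0 H0 h0 k0 : ℝ → ℝ} {C : ℝ}
    (F : FL V0 H0 h0 k0 C (Ioi 0)) {Θ' s x y ε : ℝ} (hs' : s ^ 2 ≤ Θ) (h : s ^ 2 < Θ') (hε : 0 < ε)
    (hx : 0 < x)
    (hm : IsLocalMax (fun p : ℝ × ℝ => p.1 * p.2 - W (s ^ 2) p.1 - Ga V0 s p.2 - ε * Ups Θ' (s ^ 2) p.2) (x, y)) :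
    P (s ^ 2) x ≤ Ga h0 s y + ε * ((1 / (Θ' - s ^ 2) + y ^ 2 / (Θ' - s ^ 2) ^ 2) * Ups Θ' (s ^ 2) y) := by
  have hθ : s ^ 2 ∈ Icc 0 Θ := ⟨sq_nonneg s, hs'⟩
  have ht : 0 < Θ' - s ^ 2 := by linarith
  set r := Ga h0 s y + ε * ((1 / (Θ' - s ^ 2) + y ^ 2 / (Θ' - s ^ 2) ^ 2) * Ups Θ' (s ^ 2) y) with hr
  have hU := Ups_pos (y := y) h
  have hr0 : 0 < r := by
    have := F.Bpos s y
    positivity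
  have hl1 : ∀ τ : ℝ, HasDerivAt (fun τ : ℝ => x + τ) 1 τ := fun τ => (hasDerivAt_id τ).const_add x
  have hl2 : ∀ τ : ℝ, HasDerivAt (fun τ : ℝ => y + τ / r) (1 / r) τ := fun τ =>
    ((hasDerivAt_id τ).div_const r).const_add y
  have hcur : ContinuousAt (fun τ : ℝ => ((x + τ, y + τ / r) : ℝ × ℝ)) 0 := by
    have : r ≠ 0 := hr0.ne'
    fun_prop
  have hm' : IsLocalMax (fun τ : ℝ => (x + τ) * (y + τ / r) - W (s ^ 2) (x + τ) - Ga V0 s (y + τ / r) -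
      ε * Ups Θ' (s ^ 2) (y + τ / r)) 0 := by
    have e : ((x + (0:ℝ), y + (0:ℝ) / r) : ℝ × ℝ) = (x, y) := by simp
    have := hcur.eventually (p := fun q => q.1 * q.2 - W (s ^ 2) q.1 - Ga V0 s q.2 - ε * Ups Θ' (s ^ 2) q.2 ≤
      x * y - W (s ^ 2) x - Ga V0 s y - ε * Ups Θ' (s ^ 2) y) (by
        beta_reduce
        rw [e]
        exact hm)
    refine this.mono fun τ hτ => ?_
    simpa using hτ
  have key := sdt hm' (g := fun τ => (1 * (y + τ / r) + (x + τ) * (1 / r)) - Y (s ^ 2) (x + τ) * 1 -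
      Ga H0 s (y + τ / r) * (1 / r) -
      ε * ((y + τ / r) / (Θ' - s ^ 2) * Ups Θ' (s ^ 2) (y + τ / r) * (1 / r)))
    (d := (1 * (1 / r) + 1 * (1 / r)) - 1 / P (s ^ 2) (x + 0) * 1 * 1 - Ga h0 s (y + 0 / r) * (1 / r) * (1 / r) -
      ε * ((1 / (Θ' - s ^ 2) + (y + 0 / r) ^ 2 / (Θ' - s ^ 2) ^ 2) * Ups Θ' (s ^ 2) (y + 0 / r) * (1 / r) * (1 / r)))
    (by
      have : ∀ᶠ τ : ℝ in nhds 0, 0 < x + τ := by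
        have : ContinuousAt (fun τ : ℝ => x + τ) 0 := by fun_prop
        exact this.eventually (lt_mem_nhds (by simpa using hx))
      filter_upwards [this] with τ hτ
      refine (((hl1 τ).mul (hl2 τ)).sub ?_).sub ?_ |>.sub ?_
      · exact HasDerivAt.comp τ (D.wx _ hθ _ hτ) (hl1 τ)
      · exact HasDerivAt.comp τ (Ga_hasDerivAt_y F.egV F.egH F.dV s (y + τ / r)) (hl2 τ)
      · exact (HasDerivAt.comp τ (Ups_y h (y + τ / r)) (hl2 τ)).const_mul ε)
    (by
      refine ((((hl2 0).const_mul 1).add ((hl1 0).mul_const (1 / r))).sub ?_).sub ?_ |>.sub ?_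
      · exact (HasDerivAt.comp (0:ℝ) (D.yx _ hθ (x + 0) (by simpa using hx)) (hl1 0)).mul_const 1
      · exact (HasDerivAt.comp (0:ℝ) (F.H_y s (y + 0 / r)) (hl2 0)).mul_const _
      · exact ((HasDerivAt.comp (0:ℝ) (Ups_yy h (y + 0 / r)) (hl2 0)).mul_const _).const_mul ε)
  simp only [add_zero, zero_div, mul_one, one_mul] at key
  have hP := D.pos (s ^ 2) x hx
  have e2 : Ga h0 s y * (1 / r) * (1 / r) +
      ε * ((1 / (Θ' - s ^ 2) + y ^ 2 / (Θ' - s ^ 2) ^ 2) * Ups Θ' (s ^ 2) y * (1 / r) * (1 / r)) = 1 / r := by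
    have : r * (1 / r) * (1 / r) = 1 / r := by field_simp
    linear_combination this - (1 / r) * (1 / r) * hr
  have h3 : 1 / r ≤ 1 / P (s ^ 2) x := by linarith
  exact (one_div_le_one_div hr0 hP).1 h3
end

section
variable {Θ : ℝ} {P Px W Y : ℝ → ℝ → ℝ}

lemma Wd.upper_eps (D : Wd Θ P Px W Y) {V0 H0 h0 k0 : ℝ → ℝ} {C : ℝ}
    (F : FL V0 H0 h0 k0 C (Ioi 0)) (h0W : ∀ x, 0 < x → W 0 x = Wf V0 H0 0 x)
    {Θ' Θ2 ε η : ℝ} (h2 : Θ2 < Θ') (h1 : Θ' < Θ) (hp2 : 0 < Θ2) (hε : 0 < ε) (hη : 0 < η)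
    {s1 x1 y1 : ℝ} (hs1 : 0 ≤ s1) (hs1' : s1 ^ 2 ≤ Θ2) (hx1 : 0 < x1) :
    x1 * y1 - W (s1 ^ 2) x1 - Ga V0 s1 y1 - ε * Ups Θ' (s1 ^ 2) y1 ≤ η := by
  have yng : ∀ x, 0 < x → ∀ y, x * y - W 0 x ≤ V0 y := fun x hx y => by
    have := F.young 0 (mem_Ioi.2 hx) y
    rwa [Ga_zero, ← h0W x hx] at this
  have hΘ' : 0 < √Θ' := Real.sqrt_pos.2 (by linarith)
  have hΘ'0 : 0 < Θ' := by linarith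
  -- the left end
  obtain ⟨a0, ha0, hsm⟩ := D.small (show 0 < η / Θ by have := D.hΘ; positivity)
  set a := min a0 x1 with ha
  have hapos : 0 < a := lt_min ha0 hx1
  have hleft : ∀ s, 0 ≤ s → s ^ 2 ≤ Θ2 → ∀ y, a * y - W (s ^ 2) a - Ga V0 s y ≤ η := by
    intro s hs hs' y
    have hV := F.V_ge hs y
    have hy := yng a hapos y
    have h3 := Convex.norm_image_sub_le_of_norm_hasDerivWithin_le (s := Icc 0 (s ^ 2)) (f := fun θ => W θ a)
      (C := η / Θ) (fun σ _ => (D.wt σ a).hasDerivWithinAt) (fun σ hσ => by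
        have hp := D.pos σ a hapos
        rw [Real.norm_eq_abs, abs_le]
        have := hsm a hapos (min_le_left _ _) σ ⟨hσ.1, by linarith [hσ.2]⟩
        constructor <;> linarith) (convex_Icc 0 _)
        (left_mem_Icc.2 (sq_nonneg s)) (right_mem_Icc.2 (sq_nonneg s))
    rw [Real.norm_eq_abs, Real.norm_eq_abs, sub_zero, abs_of_nonneg (sq_nonneg s)] at h3
    have h4 := (abs_le.1 h3).1
    have h5 : η / Θ * s ^ 2 ≤ η := by
      have hT := D.hΘ
      rw [div_mul_eq_mul_div, div_le_iff₀ hT]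
      nlinarith
    linarith
  -- the right end
  obtain ⟨L, hL1, hL, hright⟩ := D.atL F h0W h2 h1 hp2 hε x1
  -- the ends in y
  obtain ⟨M, hM⟩ := ((isCompact_Icc (a := (0:ℝ)) (b := Θ2)).prod (isCompact_Icc (a := a) (b := L))).exists_bound_of_continuousOn
    (f := fun p : ℝ × ℝ => W p.1 p.2) (D.wc.mono (by
      intro p hp
      exact ⟨trivial, hapos.trans_le hp.2.1⟩))
  have hM' : ∀ s, 0 ≤ s → s ^ 2 ≤ Θ2 → ∀ x ∈ Icc a L, |W (s ^ 2) x| ≤ M := fun s hs hs' x hx =>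
    hM (s ^ 2, x) ⟨⟨sq_nonneg s, hs'⟩, hx⟩
  have hM0 : 0 ≤ M := by
    have := hM' 0 le_rfl (by simpa using hp2.le) a ⟨le_rfl, (min_le_right _ _).trans hL1⟩
    exact (abs_nonneg _).trans this
  set A := ε * (√Θ')⁻¹ / (2 * Θ') with hA
  have hA0 : 0 < A := by positivity
  set N := max (max 1 ((L + 1 + (M + |W 0 1|)) / A)) (|y1| + 1) with hN
  have hN1 : 1 ≤ N := (le_max_left _ _).trans (le_max_left _ _)
  have hNq := quad hA0 (show 0 ≤ L + 1 by linarith) (show 0 ≤ M + |W 0 1| by positivity) hN1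
    ((le_max_right _ _).trans (le_max_left _ _))
  have hside : ∀ s, 0 ≤ s → s ^ 2 ≤ Θ2 → ∀ x ∈ Icc a L, ∀ y, |y| = N →
      x * y - W (s ^ 2) x - Ga V0 s y ≤ ε * Ups Θ' (s ^ 2) y := by
    intro s hs hs' x hx y hy
    have hV := F.V_ge hs y
    have hy1 := yng 1 one_pos y
    have hW := (abs_le.1 (hM' s hs hs' x hx)).1
    have hxy : x * y ≤ L * N := by
      calc x * y ≤ |x * y| := le_abs_self _
        _ = x * N := by rw [abs_mul, hy, abs_of_pos (hapos.trans_le hx.1)]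
        _ ≤ L * N := by gcongr; exact hx.2
    have hyN : -N ≤ y := by rw [← hy]; exact neg_abs_le y
    have hw1 := neg_abs_le (W 0 1)
    have hw2 := le_abs_self (W 0 1)
    have hU := Ups_ge (Θ' := Θ') (θ := s ^ 2) (y := y) (by linarith) (sq_nonneg s)
    have hex : N ^ 2 / (2 * Θ') ≤ Real.exp (y ^ 2 / (2 * Θ')) := by
      rw [← sq_abs y, hy]
      linarith [Real.add_one_le_exp (N ^ 2 / (2 * Θ'))]
    have h6 : A * N ^ 2 ≤ ε * Ups Θ' (s ^ 2) y := by
      calc A * N ^ 2 = ε * ((√Θ')⁻¹ * (N ^ 2 / (2 * Θ'))) := by rw [hA]; ring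
        _ ≤ ε * ((√Θ')⁻¹ * Real.exp (y ^ 2 / (2 * Θ'))) := by gcongr
        _ ≤ _ := by gcongr
    linarith
  have hss : ∀ s ∈ Icc 0 (√Θ2), s ^ 2 ≤ Θ2 := fun s hs => by
    rw [← Real.sq_sqrt hp2.le]
    exact pow_le_pow_left₀ hs.1 hs.2 2
  have hUp : ∀ s, s ^ 2 ≤ Θ2 → ∀ y, 0 < ε * Ups Θ' (s ^ 2) y := fun s hs y =>
    mul_pos hε (Ups_pos (by linarith))
  have key := maxprin (X := ℝ × ℝ) (K := Icc a L ×ˢ Icc (-N) N) (isCompact_Icc.prod isCompact_Icc) (a := 0)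
    (b := √Θ2) (ε := η)
    (D := fun s p => p.1 * p.2 - W (s ^ 2) p.1 - Ga V0 s p.2 - ε * Ups Θ' (s ^ 2) p.2)
    (by
      refine ((ContinuousOn.sub (by fun_prop) ?_).sub ?_).sub (ContinuousOn.mul (by fun_prop) ?_)
      · refine D.wc.comp (by fun_prop : Continuous fun p : ℝ × ℝ × ℝ => (p.1 ^ 2, p.2.1)).continuousOn ?_
        intro p hp
        exact ⟨trivial, hapos.trans_le hp.2.1.1⟩
      · exact (F.egV.continuous_Ga.comp (by fun_prop : Continuous fun p : ℝ × ℝ × ℝ => (p.1, p.2.2))).continuousOn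
      · refine (Ups_cont h2).comp (by fun_prop : Continuous fun p : ℝ × ℝ × ℝ => (p.1 ^ 2, p.2.2)).continuousOn ?_
        intro p hp
        exact ⟨hss p.1 hp.1, trivial⟩)
    (by
      intro p hp
      have h3 := yng p.1 (hapos.trans_le hp.1.1) p.2
      have h4 := hUp 0 (by simpa using hp2.le) p.2
      simp only [ne_eq, OfNat.ofNat_ne_zero, not_false_eq_true, zero_pow, Ga_zero] at h4 ⊢
      linarith)
    (by
      rintro s hs ⟨x, y⟩ hp hpos hmax
      simp only at hpos
      have hx := hp.1
      have hy := hp.2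
      simp only at hx hy
      have hs2 := hss s ⟨hs.1.le, hs.2⟩
      have hx0 : 0 < x := hapos.trans_le hx.1
      have hu := hUp s hs2 y
      have hxa : a ≠ x := by
        rintro h
        have := hleft s hs.1.le hs2 y
        rw [h] at this
        linarith
      have hxL : x ≠ L := by
        rintro h
        have := hright s hs.1.le hs2 y
        rw [← h] at this
        linarith
      have hyN : y ≠ N := by
        rintro h
        have := hside s hs.1.le hs2 x hx y (by rw [h, abs_of_pos (by linarith)])
        linarith
      have hyN' : -N ≠ y := by
        rintro h
        have := hside s hs.1.le hs2 x hx y (by rw [← h, abs_neg, abs_of_pos (by linarith)])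
        linarith
      have hnh : Icc a L ×ˢ Icc (-N) N ∈ nhds (x, y) :=
        prod_mem_nhds (Icc_mem_nhds (lt_of_le_of_ne hx.1 hxa) (lt_of_le_of_ne hx.2 hxL))
          (Icc_mem_nhds (lt_of_le_of_ne hy.1 hyN') (lt_of_le_of_ne hy.2 hyN))
      have hP := D.inter F (Θ' := Θ') (s := s) (x := x) (y := y) (ε := ε) (by linarith) (by linarith) hε hx0
        (Filter.mem_of_superset hnh fun q hq => hmax q hq)
      have d1 := D.wts 0 s x
      simp only [zero_add] at d1
      have d2 : HasDerivAt (fun s => Ga V0 s y) (s * Ga h0 s y) s := by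
        have := Ga_hasDerivAt_s F.egV F.egH F.dV s y
        rwa [stein F.egH F.egh F.dH] at this
      have d3 := (Ups_s (Θ' := Θ') (s := s) (by linarith) y).const_mul ε
      refine ⟨_, ?_, (((d1.const_sub (x * y)).sub d2).sub d3).hasDerivWithinAt⟩
      have := mul_le_mul_of_nonneg_left hP hs.1.le
      linarith)
  refine key s1 ⟨hs1, Real.le_sqrt_of_sq_le hs1'⟩ (x1, y1) ⟨⟨min_le_right _ _, hL1⟩, ?_⟩
  have h3 : |y1| ≤ N := by
    have := le_max_right (max 1 ((L + 1 + (M + |W 0 1|)) / A)) (|y1| + 1)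
    linarith
  exact abs_le.1 h3

lemma Wd.eqW (D : Wd Θ P Px W Y) {V0 H0 h0 k0 : ℝ → ℝ} {C : ℝ}
    (F : FL V0 H0 h0 k0 C (Ioi 0)) (hH : ∀ y, 0 < H0 y) (h0W : ∀ x, 0 < x → W 0 x = Wf V0 H0 0 x)
    {s x : ℝ} (hs : 0 ≤ s) (hsΘ : s ^ 2 ≤ Θ) (hx : 0 < x) : W (s ^ 2) x = Wf V0 H0 s x := by
  refine le_antisymm (D.lower F hH h0W hs hsΘ hx) ?_
  have main : ∀ s, 0 ≤ s → s ^ 2 < Θ → Wf V0 H0 s x ≤ W (s ^ 2) x := by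
    intro s hs hsΘ
    set Θ2 := s ^ 2 + (Θ - s ^ 2) / 3 with h2
    set Θ' := s ^ 2 + 2 * (Θ - s ^ 2) / 3 with h3
    have hsq := sq_nonneg s
    set y := Yf H0 s x with hy
    have h4 : ∀ ε > 0, x * y - W (s ^ 2) x - Ga V0 s y ≤ ε := by
      intro ε hε
      have hU := Ups_pos (Θ' := Θ') (θ := s ^ 2) (y := y) (by linarith)
      have := D.upper_eps F h0W (Θ' := Θ') (Θ2 := Θ2) (ε := ε / 2 / Ups Θ' (s ^ 2) y) (η := ε / 2) (by linarith)
        (by linarith) (by linarith) (by positivity) (by positivity) (y1 := y) hs (by linarith) hx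
      rw [div_mul_cancel₀ _ hU.ne'] at this
      linarith
    have h5 : x * y - W (s ^ 2) x - Ga V0 s y ≤ 0 := le_of_forall_pos_le_add fun ε hε => by linarith [h4 ε hε]
    show x * y - Ga V0 s y ≤ W (s ^ 2) x
    linarith
  rcases hsΘ.lt_or_eq with h | h
  · exact main s hs h
  · have hs0 : 0 < s := by
      rcases hs.lt_or_eq with h' | h'
      · exact h'
      · rw [← h'] at h
        have := D.hΘ
        norm_num at h
        linarith
    have c1 : Filter.Tendsto (fun σ => Wf V0 H0 σ x) (nhdsWithin s (Iio s)) (nhds (Wf V0 H0 s x)) :=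
      (F.W_s s (mem_Ioi.2 hx)).continuousAt.continuousWithinAt
    have c2 : Filter.Tendsto (fun σ => W (0 + σ ^ 2) x) (nhdsWithin s (Iio s)) (nhds (W (0 + s ^ 2) x)) :=
      (D.wts 0 s x).continuousAt.continuousWithinAt
    simp only [zero_add] at c2
    refine le_of_tendsto_of_tendsto c1 c2 ?_
    filter_upwards [Ioo_mem_nhdsLT hs0] with σ hσ
    refine main σ hσ.1.le ?_
    rw [← h]
    exact pow_lt_pow_left₀ hσ.2 hσ.1.le (by norm_num)

lemma Wd.eqP (D : Wd Θ P Px W Y) {V0 H0 h0 k0 : ℝ → ℝ} {C : ℝ}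
    (F : FL V0 H0 h0 k0 C (Ioi 0)) (hH : ∀ y, 0 < H0 y) (h0W : ∀ x, 0 < x → W 0 x = Wf V0 H0 0 x)
    {s x : ℝ} (hs : 0 ≤ s) (hsΘ : s ^ 2 ≤ Θ) (hx : 0 < x) : P (s ^ 2) x = rf H0 h0 s x := by
  have hθ : s ^ 2 ∈ Icc 0 Θ := ⟨sq_nonneg s, hsΘ⟩
  have e1 : ∀ z, 0 < z → Y (s ^ 2) z = Yf H0 s z := fun z hz => by
    refine (D.wx _ hθ z hz).unique ((F.W_x s (mem_Ioi.2 hz)).congr_of_eventuallyEq ?_)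
    filter_upwards [Ioi_mem_nhds hz] with w hw
    exact D.eqW F hH h0W hs hsΘ hw
  have e2 : 1 / P (s ^ 2) x = 1 / rf H0 h0 s x := by
    refine (D.yx _ hθ x hx).unique ((F.Y_x s (mem_Ioi.2 hx)).congr_of_eventuallyEq ?_)
    filter_upwards [Ioi_mem_nhds hx] with w hw
    exact e1 w hw
  simpa using e2
end

section
variable {ι : Type*}

/-- bounded families on the half line -/
def Bd (g : ι → ℝ → ℝ) : Prop := ∃ M, ∀ s x, 0 < x → |g s x| ≤ M

/-- `g' = r ∂ₓ g` -/
def isD (r g g' : ι → ℝ → ℝ) : Prop := ∀ s x, 0 < x → HasDerivAt (g s) (g' s x / r s x) x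

/-- families which are bounded together with `n` derivatives `r ∂ₓ` -/
def Cl (r : ι → ℝ → ℝ) : ℕ → (ι → ℝ → ℝ) → Prop
  | 0, g => Bd g
  | n + 1, g => Bd g ∧ ∃ g', isD r g g' ∧ Cl r n g'

variable {r : ι → ℝ → ℝ}

lemma Cl.bd : ∀ {n : ℕ} {g : ι → ℝ → ℝ}, Cl r n g → Bd g
  | 0, _, h => h
  | _ + 1, _, h => h.1

lemma Cl.down : ∀ {n : ℕ} {g : ι → ℝ → ℝ}, Cl r (n + 1) g → Cl r n g
  | 0, _, h => h.1
  | _ + 1, _, ⟨h1, g', h2, h3⟩ => ⟨h1, g', h2, h3.down⟩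

lemma Cl.mono {n m : ℕ} {g : ι → ℝ → ℝ} (h : Cl r n g) (hm : m ≤ n) : Cl r m g := by
  induction n, hm using Nat.le_induction with
  | base => exact h
  | succ k _ ih => exact ih h.down

lemma Bd.add {f g : ι → ℝ → ℝ} (hf : Bd f) (hg : Bd g) : Bd (fun s x => f s x + g s x) := by
  obtain ⟨M, hM⟩ := hf
  obtain ⟨N, hN⟩ := hg
  exact ⟨M + N, fun s x hx => (abs_add_le _ _).trans (add_le_add (hM s x hx) (hN s x hx))⟩

lemma Bd.mul {f g : ι → ℝ → ℝ} (hf : Bd f) (hg : Bd g) : Bd (fun s x => f s x * g s x) := by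
  obtain ⟨M, hM⟩ := hf
  obtain ⟨N, hN⟩ := hg
  exact ⟨M * N, fun s x hx => by
    rw [abs_mul]
    exact mul_le_mul (hM s x hx) (hN s x hx) (abs_nonneg _) ((abs_nonneg _).trans (hM s x hx))⟩

lemma Cl.add : ∀ {n : ℕ} {f g : ι → ℝ → ℝ}, Cl r n f → Cl r n g → Cl r n (fun s x => f s x + g s x)
  | 0, _, _, hf, hg => Bd.add hf hg
  | _ + 1, _, _, ⟨hf, f', df, cf⟩, ⟨hg, g', dg, cg⟩ =>
    ⟨hf.add hg, _, fun s x hx => ((df s x hx).add (dg s x hx)).congr_deriv (add_div _ _ _).symm, cf.add cg⟩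

lemma Cl.mul : ∀ {n : ℕ} {f g : ι → ℝ → ℝ}, Cl r n f → Cl r n g → Cl r n (fun s x => f s x * g s x)
  | 0, _, _, hf, hg => Bd.mul hf hg
  | n + 1, f, g, hf, hg => by
    have hf' := hf.down
    have hg' := hg.down
    obtain ⟨bf, f', df, cf⟩ := hf
    obtain ⟨bg, g', dg, cg⟩ := hg
    refine ⟨bf.mul bg, fun s x => f' s x * g s x + f s x * g' s x, fun s x hx => ?_, (cf.mul hg').add (hf'.mul cg)⟩
    refine ((df s x hx).mul (dg s x hx)).congr_deriv ?_
    ring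

lemma Cl.const (c : ℝ) : ∀ n : ℕ, Cl r n (fun _ _ => c)
  | 0 => ⟨|c|, fun _ _ _ => le_rfl⟩
  | n + 1 => ⟨⟨|c|, fun _ _ _ => le_rfl⟩, fun _ _ => 0, fun s x _ => by
      rw [zero_div]; exact hasDerivAt_const x c, Cl.const 0 n⟩

lemma Cl.congr : ∀ {n : ℕ} {f g : ι → ℝ → ℝ}, Cl r n f → (∀ s x, 0 < x → g s x = f s x) → Cl r n g
  | 0, f, g, ⟨M, hM⟩, h => ⟨M, fun s x hx => by rw [h s x hx]; exact hM s x hx⟩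
  | n + 1, f, g, ⟨⟨M, hM⟩, f', df, cf⟩, h => ⟨⟨M, fun s x hx => by rw [h s x hx]; exact hM s x hx⟩, f',
      fun s x hx => (df s x hx).congr_of_eventuallyEq (by
        filter_upwards [Ioi_mem_nhds hx] with z hz
        exact h s z hz), cf⟩

lemma Cl.D {n : ℕ} {g : ι → ℝ → ℝ} (hr : ∀ s x, 0 < x → 0 < r s x) (h : Cl r (n + 1) g) :
    Cl r n (fun s x => r s x * deriv (g s) x) := by
  obtain ⟨_, g', dg, cg⟩ := h
  refine cg.congr fun s x hx => ?_
  rw [(dg s x hx).deriv, mul_div_cancel₀ _ (hr s x hx).ne']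

end

/-- the iterated derivatives `(ρ ∂)^k ρ'` -/
noncomputable def dk (ρ : ℝ → ℝ) : ℕ → ℝ → ℝ
  | 0 => deriv ρ
  | n + 1 => fun x => ρ x * deriv (dk ρ n) x

lemma dk_smooth {ρ : ℝ → ℝ} (hρ : ContDiffOn ℝ 7 ρ (Ioi 0)) : ∀ j m : ℕ, j + m ≤ 6 →
    ContDiffOn ℝ m (dk ρ j) (Ioi 0)
  | 0, m, h => hρ.deriv_of_isOpen isOpen_Ioi (by exact_mod_cast (by omega : m + 1 ≤ 7))
  | j + 1, m, h => by
    have h1 := dk_smooth hρ j (m + 1) (by omega)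
    refine ContDiffOn.mul (hρ.of_le (by exact_mod_cast (by omega : m ≤ 7))) (h1.deriv_of_isOpen isOpen_Ioi ?_)
    exact_mod_cast le_rfl

lemma dk_der {ρ : ℝ → ℝ} (hρ : ContDiffOn ℝ 7 ρ (Ioi 0)) (hpos : ∀ x, 0 < x → 0 < ρ x) {j : ℕ} (hj : j ≤ 5) {x : ℝ}
    (hx : 0 < x) : HasDerivAt (dk ρ j) (dk ρ (j + 1) x / ρ x) x := by
  have h1 := (dk_smooth hρ j 1 (by omega)).differentiableOn (by norm_num)
  have h2 := (h1.differentiableAt (Ioi_mem_nhds hx)).hasDerivAt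
  refine h2.congr_deriv ?_
  show _ = ρ x * deriv (dk ρ j) x / ρ x
  rw [mul_div_cancel_left₀ _ (hpos x hx).ne']

lemma dk_Cl {ρ : ℝ → ℝ} (hρ : ContDiffOn ℝ 7 ρ (Ioi 0)) (hpos : ∀ x, 0 < x → 0 < ρ x) {N : ℕ} (hN : N ≤ 6)
    (hb : ∀ k ≤ N, Bd (fun _ : Unit => dk ρ k)) : ∀ n j : ℕ, j + n ≤ N →
    Cl (fun _ : Unit => ρ) n (fun _ => dk ρ j)
  | 0, j, h => hb j (by omega)
  | n + 1, j, h => ⟨hb j (by omega), fun _ => dk ρ (j + 1), fun _ x hx => dk_der hρ hpos (by omega) hx,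
      dk_Cl hρ hpos hN hb n (j + 1) (by omega)⟩

lemma dk_step {ρ : ℝ → ℝ} (hρ : ContDiffOn ℝ 7 ρ (Ioi 0)) (hpos : ∀ x, 0 < x → 0 < ρ x) {n : ℕ} (hn : n ≤ 5)
    (hb : ∀ k ≤ n, Bd (fun _ : Unit => dk ρ k)) {K : ℝ}
    (hK : ∀ x, 0 < x → |iteratedDeriv (n + 2) (fun y => ρ y ^ (n + 2)) x| ≤ K) :
    Bd (fun _ : Unit => dk ρ (n + 1)) := by
  have hd : ∀ x, 0 < x → HasDerivAt ρ (dk ρ 0 x) x := fun x hx =>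
    ((hρ.differentiableOn (by norm_num)).differentiableAt (Ioi_mem_nhds hx)).hasDerivAt
  have main : ∀ j ≤ n + 1, ∃ m : Unit → ℝ → ℝ, Cl (fun _ : Unit => ρ) (n + 1 - j) m ∧ ∀ x, 0 < x →
      iteratedDeriv (j + 1) (fun y => ρ y ^ (n + 2)) x = ((n + 2 : ℝ) * dk ρ j x + m () x) * ρ x ^ (n + 1 - j) := by
    intro j
    induction j with
    | zero =>
      intro _
      refine ⟨fun _ _ => 0, Cl.const 0 _, fun x hx => ?_⟩
      rw [zero_add, iteratedDeriv_one]
      refine ((hd x hx).pow (n + 2)).deriv.trans ?_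
      push_cast
      try simp only [Nat.sub_zero, Nat.add_succ_sub_one]
      ring
    | succ j ih =>
      intro hj
      obtain ⟨m, hm, hm'⟩ := ih (by omega)
      obtain ⟨k, hk⟩ : ∃ k, n = j + k := ⟨n - j, by omega⟩
      have e1 : n + 1 - j = k + 1 := by omega
      have e2 : n + 1 - (j + 1) = k := by omega
      rw [e1] at hm hm'
      rw [e2]
      have hmd := hm.down
      obtain ⟨_, m', dm, cm⟩ := hm
      have c0 := dk_Cl hρ hpos (by omega) hb k 0 (by omega)
      have cj := dk_Cl hρ hpos (by omega) hb k j (by omega)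
      refine ⟨fun s x => m' s x + ((k + 1 : ℝ) * dk ρ 0 x) * ((n + 2 : ℝ) * dk ρ j x + m s x),
        cm.add (((Cl.const _ _).mul c0).mul (((Cl.const _ _).mul cj).add hmd)), fun x hx => ?_⟩
      rw [iteratedDeriv_succ]
      have hder := (((dk_der hρ hpos (j := j) (by omega) hx).const_mul (n + 2 : ℝ)).add (dm () x hx)).mul
        ((hd x hx).pow (k + 1))
      have hev : iteratedDeriv (j + 1) (fun y => ρ y ^ (n + 2)) =ᶠ[nhds x]
          fun x => ((n + 2 : ℝ) * dk ρ j x + m () x) * ρ x ^ (k + 1) := by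
        filter_upwards [Ioi_mem_nhds hx] with z hz
        exact hm' z hz
      rw [hev.deriv_eq]
      refine hder.deriv.trans ?_
      have := (hpos x hx).ne'
      simp only [Pi.add_apply, Pi.pow_apply]
      push_cast
      try simp only [Nat.add_sub_cancel]
      field_simp
      ring
  obtain ⟨m, hmc, hm'⟩ := main (n + 1) le_rfl
  obtain ⟨M, hM⟩ := hmc.bd
  refine ⟨(K + M) / (n + 2), fun _ x hx => ?_⟩
  have h1 := hK x hx
  have h2 := hM () x hx
  rw [hm' x hx, Nat.sub_self, pow_zero, mul_one] at h1
  rw [le_div_iff₀ (by positivity)]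
  have h3 : |dk ρ (n + 1) x| * (n + 2) = |((n + 2 : ℝ) * dk ρ (n + 1) x + m () x) - m () x| := by
    rw [add_sub_cancel_right, abs_mul, abs_of_nonneg (by positivity : (0:ℝ) ≤ n + 2), mul_comm]
  rw [h3]
  exact (abs_sub _ _).trans (add_le_add h1 h2)

lemma first_bound {ρ : ℝ → ℝ} (hρ : ContDiffOn ℝ 7 ρ (Ici 0)) (hz : ρ 0 = 0) (hm : StrictMonoOn ρ (Ici 0)) {K : ℝ}
    (hK0 : 0 < K) (hK : ∀ x, 0 < x → |iteratedDeriv 2 (fun y => ρ y ^ 2) x| ≤ K) :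
    ∃ C, 0 < C ∧ (∀ x, 0 < x → |deriv ρ x| ≤ C) ∧ ∀ x, 0 < x → ρ x ≤ C * x := by
  have hρ' : ContDiffOn ℝ 7 ρ (Ioi 0) := hρ.mono Ioi_subset_Ici_self
  have hpos : ∀ x, 0 < x → 0 < ρ x := fun x hx => by
    have := hm (mem_Ici.2 le_rfl) (mem_Ici.2 hx.le) hx
    rwa [hz] at this
  have hd : ∀ x, 0 < x → HasDerivAt ρ (deriv ρ x) x := fun x hx =>
    ((hρ'.differentiableOn (by norm_num)).differentiableAt (Ioi_mem_nhds hx)).hasDerivAt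
  have hdn : ∀ x, 0 < x → 0 ≤ deriv ρ x := fun x hx => by
    rw [← derivWithin_of_mem_nhds (Ici_mem_nhds hx)]
    exact hm.monotoneOn.derivWithin_nonneg
  -- near zero
  obtain ⟨M, hM⟩ := (isCompact_Icc (a := (0:ℝ)) (b := 1)).exists_bound_of_continuousOn
    ((hρ.continuousOn_derivWithin (uniqueDiffOn_Ici 0) (by norm_num)).mono Icc_subset_Ici_self)
  have hM1 : ∀ x, 0 < x → x ≤ 1 → |deriv ρ x| ≤ M := fun x hx hx1 => by
    rw [← derivWithin_of_mem_nhds (Ici_mem_nhds hx)]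
    exact hM x ⟨hx.le, hx1⟩
  set f : ℝ → ℝ := fun y => ρ y ^ 2 with hf
  set f' : ℝ → ℝ := fun y => 2 * ρ y * deriv ρ y with hf'
  have df : ∀ x, 0 < x → HasDerivAt f (f' x) x := fun x hx => ((hd x hx).pow 2).congr_deriv (by simp [hf'])
  have hdd : ContDiffOn ℝ 6 (deriv ρ) (Ioi 0) := hρ'.deriv_of_isOpen isOpen_Ioi (by norm_num)
  have df' : ∀ x, 0 < x → HasDerivAt f' (iteratedDeriv 2 f x) x := fun x hx => by
    have h1 : DifferentiableAt ℝ f' x := (((hd x hx).differentiableAt.const_mul 2).mul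
      ((hdd.differentiableOn (by norm_num)).differentiableAt (Ioi_mem_nhds hx)))
    have e : deriv f =ᶠ[nhds x] f' := by
      filter_upwards [Ioi_mem_nhds hx] with z hz
      exact (df z hz).deriv
    rw [iteratedDeriv_succ, iteratedDeriv_one, e.deriv_eq]
    exact h1.hasDerivAt
  have lip : ∀ x z, 0 < x → 0 < z → |f' z - f' x| ≤ K * |z - x| := fun x z hx hz =>
    Convex.norm_image_sub_le_of_norm_hasDerivWithin_le (s := Ioi 0) (f := f')
      (fun σ hσ => (df' σ hσ).hasDerivWithinAt) (fun σ hσ => hK σ hσ) (convex_Ioi 0) hx hz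
  have f'n : ∀ x, 0 < x → 0 ≤ f' x := fun x hx => by
    have := hpos x hx
    have := hdn x hx
    positivity
  set K1 := f' 1 + K with hK1
  set K2 := 2 * K1 + K with hK2
  have h11 := f'n 1 one_pos
  have hK2p : 0 < K2 := by linarith
  have big : ∀ x, 1 ≤ x → deriv ρ x ^ 2 ≤ K2 := by
    intro x hx1
    have hx : 0 < x := by linarith
    have h1 : f' x ≤ K1 * x := by
      have := (abs_le.1 (lip 1 x one_pos hx)).2
      rw [abs_of_nonneg (by linarith)] at this
      nlinarith
    set h := f' x / K2 with hh
    have hh0 : 0 ≤ h := div_nonneg (f'n x hx) hK2p.le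
    have hhx : h < x := by
      rw [hh, div_lt_iff₀ hK2p]
      nlinarith
    have e : h * K2 = f' x := by rw [hh]; field_simp
    have an : AntitoneOn (fun t => f (x - t) + t * f' x - K * t ^ 2 / 2) (Icc 0 h) := by
      have dd : ∀ t ∈ Icc 0 h, HasDerivAt (fun t => f (x - t) + t * f' x - K * t ^ 2 / 2)
          (-(f' (x - t)) + f' x - K * t) t := fun t ht => by
        have h3 : HasDerivAt (fun t => x - t) (-1) t := by simpa using (hasDerivAt_id t).const_sub x
        have h4 := HasDerivAt.comp t (df (x - t) (by linarith [ht.2])) h3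
        have h5 := (h4.add ((hasDerivAt_id t).mul_const (f' x))).sub (((hasDerivAt_pow 2 t).const_mul K).div_const 2)
        refine h5.congr_deriv ?_
        push_cast
        ring
      refine antitoneOn_of_deriv_nonpos (convex_Icc 0 h) ?_ ?_ ?_
      · exact fun t ht => (dd t ht).continuousAt.continuousWithinAt
      · exact fun t ht => (dd t (interior_subset ht)).differentiableAt.differentiableWithinAt
      · intro t ht
        have ht' := interior_subset ht
        rw [(dd t ht').deriv]
        have := (abs_le.1 (lip x (x - t) hx (by linarith [ht'.2]))).1
        rw [show x - t - x = -t by ring, abs_neg, abs_of_nonneg ht'.1] at this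
        linarith
    have h6 := an (left_mem_Icc.2 hh0) (right_mem_Icc.2 hh0) hh0
    simp only [sub_zero, zero_mul, add_zero, ne_eq, OfNat.ofNat_ne_zero, not_false_eq_true, zero_pow, mul_zero,
      zero_div] at h6
    have h7 : 0 ≤ f (x - h) := sq_nonneg _
    -- `f'(x)^2 ≤ 2 K2 f(x)`
    have h8 : f' x ^ 2 ≤ 2 * K2 * f x := by
      have h9 : K * h ^ 2 ≤ K2 * h ^ 2 := mul_le_mul_of_nonneg_right (by linarith) (sq_nonneg h)
      have h10 : h * f' x = K2 * h ^ 2 := by rw [← e]; ring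
      have h12 : f' x ^ 2 = K2 * (K2 * h ^ 2) := by rw [← e]; ring
      have h13 : K2 * h ^ 2 ≤ 2 * f x := by linarith
      rw [h12]
      nlinarith
    have hp := hpos x hx
    have h14 : ρ x ^ 2 * (4 * deriv ρ x ^ 2) ≤ ρ x ^ 2 * (2 * K2) := by
      simp only [hf, hf'] at h8
      linarith
    have h15 := le_of_mul_le_mul_left h14 (by positivity)
    linarith
  set C := max M (√K2) + 1 with hC
  have hC0 : 0 < C := by
    have := le_max_right M (√K2)
    have := Real.sqrt_nonneg K2
    linarith
  have hb : ∀ x, 0 < x → |deriv ρ x| ≤ C := fun x hx => by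
    rcases le_total x 1 with h | h
    · have := hM1 x hx h
      have := le_max_left M (√K2)
      linarith
    · have h1 := Real.abs_le_sqrt (big x h)
      have := le_max_right M (√K2)
      linarith
  refine ⟨C, hC0, hb, fun x hx => ?_⟩
  obtain ⟨c, hc, hc'⟩ := exists_hasDerivAt_eq_slope ρ (deriv ρ) hx (hρ.continuousOn.mono Icc_subset_Ici_self)
    (fun z hz => hd z hz.1)
  rw [hz, sub_zero, sub_zero, eq_div_iff hx.ne'] at hc'
  rw [← hc']
  exact mul_le_mul_of_nonneg_right ((le_abs_self _).trans (hb c hc.1)) hx.le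

lemma dk_all {ρ : ℝ → ℝ} (hρ : ContDiffOn ℝ 7 ρ (Ioi 0)) (hpos : ∀ x, 0 < x → 0 < ρ x) {K C : ℝ}
    (hC : ∀ x, 0 < x → |deriv ρ x| ≤ C)
    (hK : ∀ x, 0 < x → ∀ i : ℕ, 2 ≤ i → i ≤ 7 → |iteratedDeriv i (fun y => ρ y ^ i) x| ≤ K) :
    Cl (fun _ : Unit => ρ) 6 (fun _ => deriv ρ) := by
  have h : ∀ n ≤ 6, ∀ k ≤ n, Bd (fun _ : Unit => dk ρ k) := by
    intro n
    induction n with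
    | zero =>
      intro _ k hk
      obtain rfl : k = 0 := by omega
      exact ⟨C, fun _ x hx => hC x hx⟩
    | succ n ih =>
      intro hn k hk
      have h1 := ih (by omega)
      rcases Nat.lt_or_ge k (n + 1) with h2 | h2
      · exact h1 k (by omega)
      · obtain rfl : k = n + 1 := by omega
        exact dk_step hρ hpos (by omega) h1 fun x hx => hK x hx (n + 2) (by omega) (by omega)
  exact dk_Cl hρ hpos le_rfl (h 6 le_rfl) 6 0 (by omega)

/-- coefficients of the derivatives of the flow of `ρ` -/
noncomputable def ek (ρ : ℝ → ℝ) : ℕ → ℝ → ℝ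
  | 0 => fun _ => 1
  | n + 1 => fun x => deriv ρ x * ek ρ n x + ρ x * deriv (ek ρ n) x

lemma ek_smooth {ρ : ℝ → ℝ} (hρ : ContDiffOn ℝ 7 ρ (Ioi 0)) : ∀ j m : ℕ, j + m ≤ 7 →
    ContDiffOn ℝ m (ek ρ j) (Ioi 0)
  | 0, m, h => contDiffOn_const
  | j + 1, m, h => by
    have h1 := ek_smooth hρ j (m + 1) (by omega)
    refine ContDiffOn.add (ContDiffOn.mul ?_ (ek_smooth hρ j m (by omega)))
      (ContDiffOn.mul (hρ.of_le (by exact_mod_cast (by omega : m ≤ 7))) (h1.deriv_of_isOpen isOpen_Ioi ?_))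
    · exact hρ.deriv_of_isOpen isOpen_Ioi (by exact_mod_cast (by omega : m + 1 ≤ 7))
    · exact_mod_cast le_rfl

lemma ek_Cl {ρ : ℝ → ℝ} (hpos : ∀ x, 0 < x → 0 < ρ x) (h : Cl (fun _ : Unit => ρ) 6 (fun _ => deriv ρ)) :
    ∀ k ≤ 6, Cl (fun _ : Unit => ρ) (6 - k) (fun _ => ek ρ (k + 1))
  | 0, _ => h.congr fun s x _ => by
      show deriv ρ x * 1 + ρ x * deriv (fun _ => (1:ℝ)) x = _
      simp
  | k + 1, hk => by
    have h1 := ek_Cl hpos h k (by omega)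
    obtain ⟨m, hm⟩ : ∃ m, 6 - k = m + 1 := ⟨5 - k, by omega⟩
    rw [show 6 - (k + 1) = m by omega]
    rw [hm] at h1
    exact ((h.mono (by omega)).mul h1.down).add (h1.D fun _ => hpos)

lemma exists_chain {ρ H0 h0 : ℝ → ℝ} (hρ : ContDiffOn ℝ 7 ρ (Ioi 0)) (hpos : ∀ x, 0 < x → 0 < ρ x)
    (h : Cl (fun _ : Unit => ρ) 6 (fun _ => deriv ρ)) (hH : ∀ y, 0 < H0 y) (dH : ∀ y, HasDerivAt H0 (h0 y) y)
    (hh : ∀ y, h0 y = ρ (H0 y)) :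
    ∃ Hd : ℕ → ℝ → ℝ, (∀ y, Hd 0 y = h0 y) ∧ (∀ k ≤ 6, ∀ y, HasDerivAt (Hd k) (Hd (k + 1) y) y) ∧
      (∀ k ≤ 7, Continuous (Hd k)) ∧ ∀ k ≤ 7, ∃ M, ∀ y, |Hd k y| ≤ M * h0 y := by
  have hd : ∀ x, 0 < x → HasDerivAt ρ (deriv ρ x) x := fun x hx =>
    ((hρ.differentiableOn (by norm_num)).differentiableAt (Ioi_mem_nhds hx)).hasDerivAt
  have cH : Continuous H0 := continuous_iff_continuousAt.2 fun y => (dH y).continuousAt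
  refine ⟨fun k y => ek ρ k (H0 y) * ρ (H0 y), fun y => ?_, fun k hk y => ?_, fun k hk => ?_, fun k hk => ?_⟩
  · show 1 * ρ (H0 y) = h0 y
    rw [hh, one_mul]
  · have h1 : HasDerivAt (ek ρ k) (deriv (ek ρ k) (H0 y)) (H0 y) :=
      (((ek_smooth hρ k 1 (by omega)).differentiableOn (by norm_num)).differentiableAt
        (Ioi_mem_nhds (hH y))).hasDerivAt
    refine (HasDerivAt.comp y (h1.mul (hd _ (hH y))) (dH y)).congr_deriv ?_
    show _ = (deriv ρ (H0 y) * ek ρ k (H0 y) + ρ (H0 y) * deriv (ek ρ k) (H0 y)) * ρ (H0 y)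
    rw [hh]
    ring
  · have h1 : ContinuousOn (fun x => ek ρ k x * ρ x) (Ioi 0) :=
      ((ek_smooth hρ k 0 (by omega)).continuousOn).mul hρ.continuousOn
    exact h1.comp_continuous cH hH
  · have hb : ∃ M, ∀ x, 0 < x → |ek ρ k x| ≤ M := by
      rcases k with _ | k
      · exact ⟨1, fun x _ => by show |(1:ℝ)| ≤ 1; simp⟩
      · obtain ⟨M, hM⟩ := (ek_Cl hpos h k (by omega)).bd
        exact ⟨M, fun x hx => hM () x hx⟩
    obtain ⟨M, hM⟩ := hb
    refine ⟨M, fun y => ?_⟩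
    rw [abs_mul, abs_of_pos (hpos _ (hH y)), hh]
    exact mul_le_mul_of_nonneg_right (hM _ (hH y)) (hpos _ (hH y)).le

lemma FL.final {V0 H0 h0 k0 : ℝ → ℝ} {C : ℝ} (F : FL V0 H0 h0 k0 C (Ioi 0)) {Hd : ℕ → ℝ → ℝ}
    (hd0 : ∀ y, Hd 0 y = h0 y) (hd : ∀ k ≤ 6, ∀ y, HasDerivAt (Hd k) (Hd (k + 1) y) y)
    (hc : ∀ k ≤ 7, Continuous (Hd k)) (hb : ∀ k ≤ 7, ∃ M, ∀ y, |Hd k y| ≤ M * h0 y) :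
    ∀ j ≤ 6, ∃ M, ∀ s x, 0 < x → |rf H0 h0 s x ^ j * iteratedDeriv (j + 1) (rf H0 h0 s) x| ≤ M := by
  have e0 : Hd 0 = h0 := funext hd0
  have e1 : Hd 1 = k0 := funext fun y => by
    have := hd 0 (by norm_num) y
    rw [e0] at this
    exact this.unique (F.dh y)
  have eg : ∀ k ≤ 7, EG (Hd k) := fun k hk => by
    obtain ⟨M, hM⟩ := hb k hk
    obtain ⟨_, A, B, hA, hB, hAB⟩ := F.egh
    refine ⟨hc k hk, |M| * A, B, by positivity, hB, fun y => ?_⟩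
    have h1 : M * h0 y ≤ |M| * |h0 y| := by rw [← abs_mul]; exact le_abs_self _
    calc |Hd k y| ≤ |M| * |h0 y| := (hM y).trans h1
      _ ≤ |M| * (A * Real.exp (B * |y|)) := by gcongr; exact hAB y
      _ = _ := by ring
  set b : ℕ → ℝ → ℝ → ℝ := fun k s x => Ga (Hd k) s (Yf H0 s x) / Ga h0 s (Yf H0 s x) with hbdef
  have bd : ∀ k ≤ 7, Bd (b k) := fun k hk => by
    obtain ⟨M, hM⟩ := hb k hk
    refine ⟨M, fun s x _ => ?_⟩
    have hB := F.Bpos s (Yf H0 s x)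
    simp only [hbdef]
    rw [abs_div, abs_of_pos hB, div_le_iff₀ hB, ← Ga_const_mul, abs_le]
    have h1 := Ga_mono (eg k hk) (F.egh.const_mul M) (fun y => (abs_le.1 (hM y)).2) s (Yf H0 s x)
    have h2 := Ga_mono (F.egh.const_mul (-M)) (eg k hk) (fun y => by
      have := (abs_le.1 (hM y)).1
      linarith) s (Yf H0 s x)
    rw [Ga_const_mul] at h2 ⊢
    rw [Ga_const_mul] at h1
    constructor <;> linarith
  have db : ∀ k ≤ 6, isD (rf H0 h0) (b k) (fun s x => b (k + 1) s x + (-1) * (b k s x * b 1 s x)) := by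
    intro k hk s x hx
    have hB := F.Bpos s (Yf H0 s x)
    have h1 := (Ga_hasDerivAt_y (eg k (by omega)) (eg (k + 1) (by omega)) (hd k hk) s (Yf H0 s x)).div
      (Ga_hasDerivAt_y F.egh F.egk F.dh s (Yf H0 s x)) hB.ne'
    refine (HasDerivAt.comp x h1 (F.Y_x s (mem_Ioi.2 hx))).congr_deriv ?_
    have hr : rf H0 h0 s x = Ga h0 s (Yf H0 s x) := rfl
    simp only [hbdef, e1, hr]
    field_simp
    ring
  have clb : ∀ n k, k + n ≤ 7 → Cl (rf H0 h0) n (b k) := by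
    intro n
    induction n with
    | zero => exact fun k hk => bd k (by omega)
    | succ n ih =>
      intro k hk
      exact ⟨bd k (by omega), _, db k (by omega), (ih (k + 1) (by omega)).add
        ((Cl.const _ _).mul ((ih k (by omega)).mul (ih 1 (by omega))))⟩
  have eb1 : ∀ s x, 0 < x → HasDerivAt (rf H0 h0 s) (b 1 s x) x := fun s x hx => by
    have := F.r_x s (mem_Ioi.2 hx)
    refine this.congr_deriv ?_
    simp only [hbdef, e1, rxf]
  have main : ∀ j ≤ 6, ∃ a : ℝ → ℝ → ℝ, Cl (rf H0 h0) (6 - j) a ∧ ∀ s x, 0 < x →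
      iteratedDeriv (j + 1) (rf H0 h0 s) x = a s x / rf H0 h0 s x ^ j := by
    intro j
    induction j with
    | zero =>
      intro _
      refine ⟨b 1, clb 6 1 (by norm_num), fun s x hx => ?_⟩
      rw [zero_add, iteratedDeriv_one, pow_zero, div_one, (eb1 s x hx).deriv]
    | succ j ih =>
      intro hj
      obtain ⟨a, ha, ha'⟩ := ih (by omega)
      obtain ⟨m, hm⟩ : ∃ m, 6 - j = m + 1 := ⟨5 - j, by omega⟩
      rw [hm] at ha
      rw [show 6 - (j + 1) = m by omega]
      have had := ha.down
      obtain ⟨_, a', da, ca⟩ := ha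
      refine ⟨fun s x => a' s x + (-(j:ℝ)) * (a s x * b 1 s x),
        ca.add ((Cl.const _ _).mul (had.mul (clb m 1 (by omega)))), fun s x hx => ?_⟩
      have hr := F.r_pos s x
      rw [iteratedDeriv_succ]
      have hev : iteratedDeriv (j + 1) (rf H0 h0 s) =ᶠ[nhds x] fun x => a s x / rf H0 h0 s x ^ j := by
        filter_upwards [Ioi_mem_nhds hx] with z hz
        exact ha' s z hz
      rw [hev.deriv_eq]
      refine ((da s x hx).div ((eb1 s x hx).pow j) (pow_ne_zero _ hr.ne')).deriv.trans ?_
      simp only [Pi.pow_apply]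
      rcases j with _ | j
      · simp
      · push_cast
        try simp only [Nat.add_sub_cancel]
        field_simp
        ring
  intro j hj
  obtain ⟨a, ha, ha'⟩ := main j hj
  obtain ⟨M, hM⟩ := ha.bd
  refine ⟨M, fun s x hx => ?_⟩
  rw [ha' s x hx, mul_div_cancel₀ _ (pow_ne_zero _ (F.r_pos s x).ne')]
  exact hM s x hx

/-- Derivative bounds for the risk-tolerance function: if `R` solves the fast-diffusion
equation `∂ₜR + (λ²/2) R² ∂ₓₓR = 0` with terminal data `R_U` whose powers have bounded
derivatives (`|∂ₓ⁽ⁱ⁾(R_Uⁱ)| ≤ K` for `2 ≤ i ≤ 7`), then for each `0 ≤ j ≤ 6` there is a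
constant `K_j > 0` with `|Rʲ ∂ₓ⁽ʲ⁺¹⁾R| ≤ K_j` on `[0,T) × (0,∞)`. -/
theorem risk_tolerance_derivative_bounds (T lam : ℝ) (hT : 0 < T) (hlam : 0 < lam)
    (R : ℝ → ℝ → ℝ)
    (hcont : ContinuousOn (fun p : ℝ × ℝ => R p.1 p.2) (Icc 0 T ×ˢ Ici 0))
    (hnonneg : ∀ t ∈ Icc (0 : ℝ) T, ∀ x ∈ Ici (0 : ℝ), 0 ≤ R t x)
    (hC12_t : ∀ t ∈ Ico (0 : ℝ) T, ∀ x ∈ Ioi (0 : ℝ), DifferentiableAt ℝ (fun s => R s x) t)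
    (hC12_x : ∀ t ∈ Ico (0 : ℝ) T, ∀ x ∈ Ioi (0 : ℝ), DifferentiableAt ℝ (R t) x)
    (hC12_xx : ∀ t ∈ Ico (0 : ℝ) T, ∀ x ∈ Ioi (0 : ℝ), DifferentiableAt ℝ (deriv (R t)) x)
    (hpos : ∀ t ∈ Ico (0 : ℝ) T, ∀ x ∈ Ioi (0 : ℝ), 0 < R t x)
    (hmono : ∀ t ∈ Ico (0 : ℝ) T, StrictMonoOn (R t) (Ici 0))
    (hzero : ∀ t ∈ Ico (0 : ℝ) T, R t 0 = 0)
    (hderiv_fin : ∀ t ∈ Ico (0 : ℝ) T, ∀ x ∈ Ici (0 : ℝ),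
      DifferentiableWithinAt ℝ (R t) (Ici 0) x)
    (hpde : ∀ t ∈ Ico (0 : ℝ) T, ∀ x ∈ Ioi (0 : ℝ),
      partialT R t x + lam ^ 2 / 2 * (R t x) ^ 2 * partialXX R t x = 0)
    (RU : ℝ → ℝ)
    (hterm : ∀ x ∈ Ici (0 : ℝ), R T x = RU x)
    (hRU_smooth : ContDiffOn ℝ 7 RU (Ici 0))
    (hRU_zero : RU 0 = 0)
    (hRU_mono : StrictMonoOn RU (Ici 0))
    (hRU_deriv_fin : ∀ x ∈ Ici (0 : ℝ), DifferentiableWithinAt ℝ RU (Ici 0) x)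
    (K : ℝ) (hK : 0 < K)
    (hRU_bd : ∀ x ∈ Ici (0 : ℝ), ∀ i : ℕ, 2 ≤ i → i ≤ 7 →
      |iteratedDeriv i (fun y => (RU y) ^ i) x| ≤ K) :
    ∀ j : ℕ, j ≤ 6 → ∃ Kj : ℝ, 0 < Kj ∧
      ∀ t ∈ Ico (0 : ℝ) T, ∀ x ∈ Ioi (0 : ℝ),
        |(R t x) ^ j * iteratedDeriv (j + 1) (R t) x| ≤ Kj := by
  have hl2 : 0 < lam ^ 2 := by positivity
  set Θ := lam ^ 2 * T with hΘ
  have hΘ0 : 0 < Θ := by positivity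
  have hρ : ContDiffOn ℝ 7 RU (Ioi 0) := hRU_smooth.mono Ioi_subset_Ici_self
  have hρpos : ∀ x, 0 < x → 0 < RU x := fun x hx => by
    have := hRU_mono (mem_Ici.2 le_rfl) (mem_Ici.2 hx.le) hx
    rwa [hRU_zero] at this
  have hdρ : ∀ x, 0 < x → HasDerivAt RU (deriv RU x) x := fun x hx =>
    ((hρ.differentiableOn (by norm_num)).differentiableAt (Ioi_mem_nhds hx)).hasDerivAt
  have hcρ : ContinuousOn (deriv RU) (Ioi 0) := hρ.continuousOn_deriv_of_isOpen isOpen_Ioi (by norm_num)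
  obtain ⟨C, hC0, hC1, hC2⟩ := first_bound hRU_smooth hRU_zero hRU_mono hK
    (fun x hx => hRU_bd x (mem_Ici.2 hx.le) 2 le_rfl (by norm_num))
  have hcl := dk_all hρ hρpos hC1 (fun x hx i h1 h2 => hRU_bd x (mem_Ici.2 hx.le) i h1 h2)
  obtain ⟨V0, H0, h0, k0, F, hH, hh0, hk0⟩ := hodograph hC0 hdρ hcρ hρpos hC1 hC2
  obtain ⟨Hd, c1, c2, c3, c4⟩ := exists_chain hρ hρpos hcl hH F.dH hh0
  -- the rescaled solution
  set tt : ℝ → ℝ := fun θ => T - max 0 (min θ Θ) / lam ^ 2 with htt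
  have tt_mem : ∀ θ, tt θ ∈ Icc 0 T := fun θ => by
    have h1 : max 0 (min θ Θ) ≤ Θ := max_le hΘ0.le (min_le_right _ _)
    have h2 : 0 ≤ max 0 (min θ Θ) := le_max_left _ _
    constructor
    · have : max 0 (min θ Θ) / lam ^ 2 ≤ T := by rw [div_le_iff₀ hl2]; linarith
      simp only [htt]; linarith
    · have : 0 ≤ max 0 (min θ Θ) / lam ^ 2 := by positivity
      simp only [htt]; linarith
  have tt_eq : ∀ θ ∈ Icc 0 Θ, tt θ = T - θ / lam ^ 2 := fun θ hθ => by
    simp only [htt]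
    rw [min_eq_left hθ.2, max_eq_right hθ.1]
  have tt_pos : ∀ θ ∈ Ioc 0 Θ, tt θ ∈ Ico 0 T := fun θ hθ => by
    refine ⟨(tt_mem θ).1, ?_⟩
    rw [tt_eq θ ⟨hθ.1.le, hθ.2⟩]
    have : 0 < θ / lam ^ 2 := div_pos hθ.1 hl2
    linarith
  have tt_zero : tt 0 = T := by rw [tt_eq 0 ⟨le_rfl, hΘ0.le⟩]; simp
  have ctt : Continuous tt := by simp only [htt]; fun_prop
  set P : ℝ → ℝ → ℝ := fun θ x => R (tt θ) (max x 0) with hP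
  have Pev : ∀ θ x, 0 < x → P θ =ᶠ[nhds x] R (tt θ) := fun θ x hx => by
    filter_upwards [Ioi_mem_nhds hx] with z hz
    simp only [hP]
    rw [max_eq_left (mem_Ioi.1 hz).le]
  have P_eq : ∀ θ x, 0 < x → P θ x = R (tt θ) x := fun θ x hx => (Pev θ x hx).self_of_nhds
  have RT : ∀ x, 0 < x → R T =ᶠ[nhds x] RU := fun x hx => by
    filter_upwards [Ioi_mem_nhds hx] with z hz
    exact hterm z (mem_Ici.2 (mem_Ioi.1 hz).le)
  have S : Sol Θ P (fun θ x => deriv (R (tt θ)) x) := by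
    refine ⟨hΘ0, ?_, ?_, ?_, ?_, ?_, ?_⟩
    · refine hcont.comp_continuous (by fun_prop : Continuous fun p : ℝ × ℝ => (tt p.1, max p.2 0)) ?_
      exact fun p => ⟨tt_mem p.1, mem_Ici.2 (le_max_right _ _)⟩
    · intro θ x hx
      rw [P_eq θ x hx]
      rcases (tt_mem θ).2.lt_or_eq with h | h
      · exact hpos _ ⟨(tt_mem θ).1, h⟩ x hx
      · rw [h, hterm x (mem_Ici.2 hx.le)]
        exact hρpos x hx
    · intro θ
      simp only [hP, max_self]
      rcases (tt_mem θ).2.lt_or_eq with h | h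
      · exact hzero _ ⟨(tt_mem θ).1, h⟩
      · rw [h, hterm 0 (mem_Ici.2 le_rfl), hRU_zero]
    · intro θ hθ x hx
      refine HasDerivAt.congr_of_eventuallyEq ?_ (Pev θ x hx)
      rcases hθ.1.lt_or_eq with h | h
      · exact (hC12_x _ (tt_pos θ ⟨h, hθ.2⟩) x hx).hasDerivAt
      · rw [← h, tt_zero, (RT x hx).deriv_eq]
        exact (hdρ x hx).congr_of_eventuallyEq (RT x hx)
    · intro θ hθ
      rcases hθ.1.lt_or_eq with h | h
      · exact fun x hx => (hC12_xx _ (tt_pos θ ⟨h, hθ.2⟩) x hx).continuousAt.continuousWithinAt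
      · rw [← h, tt_zero]
        exact hcρ.congr fun x hx => (RT x hx).deriv_eq
    · intro θ hθ x hx
      have ht := tt_pos θ hθ
      refine ⟨_, (hC12_xx _ ht x hx).hasDerivAt, ?_⟩
      have d1 := (hC12_t _ ht x hx).hasDerivAt
      rw [tt_eq θ ⟨hθ.1.le, hθ.2⟩] at d1
      have d2 : HasDerivAt (fun σ : ℝ => T - σ / lam ^ 2) (-(1 / lam ^ 2)) θ :=
        ((hasDerivAt_id θ).div_const _).const_sub T
      have d3 := (HasDerivAt.comp θ d1 d2).hasDerivWithinAt (s := Iic θ)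
      have hev : (fun σ => P σ x) =ᶠ[nhdsWithin θ (Iic θ)] ((fun s => R s x) ∘ fun σ : ℝ => T - σ / lam ^ 2) := by
        filter_upwards [self_mem_nhdsWithin, mem_nhdsWithin_of_mem_nhds (Ioi_mem_nhds hθ.1)] with σ h1 h2
        rw [P_eq σ x hx, tt_eq σ ⟨(mem_Ioi.1 h2).le, (mem_Iic.1 h1).trans hθ.2⟩]
        rfl
      refine (d3.congr_of_eventuallyEq hev (hev.self_of_nhdsWithin (mem_Iic.2 le_rfl))).congr_deriv ?_
      have e := hpde _ ht x hx
      rw [tt_eq θ ⟨hθ.1.le, hθ.2⟩] at e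
      rw [P_eq θ x hx, tt_eq θ ⟨hθ.1.le, hθ.2⟩]
      simp only [partialT, partialXX] at e
      have e' : deriv (fun s => R s x) (T - θ / lam ^ 2) =
        -(lam ^ 2 / 2 * R (T - θ / lam ^ 2) x ^ 2 * deriv (deriv (R (T - θ / lam ^ 2))) x) := by linarith
      rw [e']
      field_simp
  have P0 : ∀ x, 0 < x → P 0 x = rf H0 h0 0 x := fun x hx => by
    rw [P_eq 0 x hx, tt_zero, hterm x (mem_Ici.2 hx.le), F.r_zero hh0 (mem_Ioi.2 hx)]
  obtain ⟨W, Y, D, hW0⟩ := S.exists_W (W0 := Wf V0 H0 0) (Y0 := Yf H0 0)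
    (fun x hx => F.W_x 0 (mem_Ioi.2 hx)) (fun x hx => by
      rw [P0 x hx]
      exact F.Y_x 0 (mem_Ioi.2 hx))
  intro j hj
  obtain ⟨M, hM⟩ := F.final c1 c2 c3 c4 j hj
  refine ⟨|M| + 1, by positivity, fun t ht x hx => ?_⟩
  set θ := lam ^ 2 * (T - t) with hθ
  have hθ0 : 0 ≤ θ := mul_nonneg hl2.le (by linarith [ht.2])
  have hθ1 : θ ≤ Θ := by
    rw [hθ, hΘ]
    exact mul_le_mul_of_nonneg_left (by linarith [ht.1]) hl2.le
  have ett : tt θ = t := by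
    rw [tt_eq θ ⟨hθ0, hθ1⟩, hθ]
    field_simp
    ring
  have hsq : √θ ^ 2 = θ := Real.sq_sqrt hθ0
  have hRr : ∀ z, 0 < z → R t z = rf H0 h0 (√θ) z := fun z hz => by
    have h1 := D.eqP F hH (fun x _ => hW0 x) (Real.sqrt_nonneg θ) (by rw [hsq]; exact hθ1) hz
    rw [hsq, P_eq θ z hz, ett] at h1
    exact h1
  have hev : R t =ᶠ[nhds x] rf H0 h0 (√θ) := by
    filter_upwards [Ioi_mem_nhds hx] with z hz
    exact hRr z hz
  rw [hRr x hx, hev.iteratedDeriv_eq]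
  have := hM (√θ) x hx
  have := le_abs_self M
  linarith
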